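/- arXiv:0710.3095 — 2 statements merged into one kernel-verified Lean document; each statement's English description precedes it below -/
import Mathlib

section
/- Let d ≥ 1 and let φ : ℕ → [0,∞] satisfy φ(0)=0, φ nondecreasing (condition (N)) and the repulsive condition (R): φ(l+m) ≥ φ(l)+φ(m). Then for every λ > λ₀ and every x ∈ ℝ^d the limit ξ_λ(x) = −lim_{M→∞} (1/M) log H_λ(⌊Mx⌋) exists, and moreover −lim_{M→∞} (1/M) log D_λ(⌊Mx⌋) exists and equals ξ_λ(x). -/
open scoped BigOperators ENNReal
open Filter Topology

noncomputable section

namespace SIRW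

abbrev Pt (d : ℕ) := Fin d → ℤ

variable {d : ℕ}

/-- A step of a nearest-neighbour walk: a vector of ℓ¹-norm one. -/
def IsStep (s : Pt d) : Prop := (∑ i, |s i|) = 1

/-- A nearest-neighbour path started at the origin, encoded by its list of steps. -/
def IsPath (γ : List (Pt d)) : Prop := ∀ s ∈ γ, IsStep s

/-- Position of the path after `k` steps (the path starts at the origin). -/
def pos (γ : List (Pt d)) (k : ℕ) : Pt d := (γ.take k).sum

/-- Displacement `D(γ) = γ(n) - γ(0)`. -/
def disp (γ : List (Pt d)) : Pt d := γ.sum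

/-- Local time of the path at the site `x`. -/
def locTime (γ : List (Pt d)) (x : Pt d) : ℕ :=
  ((Finset.range (γ.length + 1)).filter (fun k => pos γ k = x)).card

/-- The (finite) set of sites visited by the path. -/
def visited (γ : List (Pt d)) : Finset (Pt d) :=
  (Finset.range (γ.length + 1)).image (pos γ)

/-- Site potential `Φ(γ) = ∑_x φ(l_x(γ))`, for `φ : ℕ → [0,∞]` with `φ 0 = 0`. -/
def PotE (φ : ℕ → ℝ≥0∞) (γ : List (Pt d)) : ℝ≥0∞ :=
  ∑ x ∈ visited γ, φ (locTime γ x)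

/-- Site potential `Φ(γ) = ∑_x φ(l_x(γ))`, for real-valued `φ` with `φ 0 = 0`. -/
def PotR (φ : ℕ → ℝ) (γ : List (Pt d)) : ℝ :=
  ∑ x ∈ visited γ, φ (locTime γ x)

/-- `e^{-a}` for `a ∈ [0,∞]`, with `e^{-∞} = 0`. -/
def expNegE (a : ℝ≥0∞) : ℝ≥0∞ :=
  if a = ⊤ then 0 else ENNReal.ofReal (Real.exp (-a.toReal))

/-- `e^{a}` for `a ∈ [0,∞]`, with `e^{∞} = ∞`. -/
def expE (a : ℝ≥0∞) : ℝ≥0∞ :=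
  if a = ⊤ then ⊤ else ENNReal.ofReal (Real.exp a.toReal)

/-- Weight `W_λ(γ) = e^{-Φ(γ) - λ|γ|}` (extended-real-valued potential). -/
def wE (φ : ℕ → ℝ≥0∞) (lam : ℝ) (γ : List (Pt d)) : ℝ≥0∞ :=
  expNegE (PotE φ γ) * ENNReal.ofReal (Real.exp (-(lam * γ.length)))

/-- Weight `W_λ(γ) = e^{-Φ(γ) - λ|γ|}` (real-valued potential). -/
def wR (φ : ℕ → ℝ) (lam : ℝ) (γ : List (Pt d)) : ℝ≥0∞ :=
  ENNReal.ofReal (Real.exp (-PotR φ γ - lam * γ.length))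

/-- The set of `n`-step nearest-neighbour paths started at the origin. -/
def PathsN (d n : ℕ) : Set (List (Pt d)) := {γ | IsPath γ ∧ γ.length = n}

/-- Partition function `Z_n` (extended-real-valued potential). -/
def ZE (d : ℕ) (φ : ℕ → ℝ≥0∞) (n : ℕ) : ℝ≥0∞ :=
  ∑' γ : PathsN d n, expNegE (PotE φ (γ : List (Pt d)))

/-- Partition function `Z_n` (real-valued potential). -/
def ZR (d : ℕ) (φ : ℕ → ℝ) (n : ℕ) : ℝ≥0∞ :=
  ∑' γ : PathsN d n, ENNReal.ofReal (Real.exp (-PotR φ (γ : List (Pt d))))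

/-- Paths from `0` to `x`. -/
def Dpaths (x : Pt d) : Set (List (Pt d)) := {γ | IsPath γ ∧ disp γ = x}

/-- Paths from `0` to `x` hitting `x` only at their final point. -/
def Hpaths (x : Pt d) : Set (List (Pt d)) := {γ | IsPath γ ∧ disp γ = x ∧ locTime γ x = 1}

/-- Two-point function `D_λ(x)` (extended-real-valued potential). -/
def DEf (φ : ℕ → ℝ≥0∞) (lam : ℝ) (x : Pt d) : ℝ≥0∞ :=
  ∑' γ : Dpaths x, wE φ lam (γ : List (Pt d))

/-- Two-point function `H_λ(x)` (extended-real-valued potential). -/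
def HEf (φ : ℕ → ℝ≥0∞) (lam : ℝ) (x : Pt d) : ℝ≥0∞ :=
  ∑' γ : Hpaths x, wE φ lam (γ : List (Pt d))

/-- Two-point function `D_λ(x)` (real-valued potential). -/
def DRf (φ : ℕ → ℝ) (lam : ℝ) (x : Pt d) : ℝ≥0∞ :=
  ∑' γ : Dpaths x, wR φ lam (γ : List (Pt d))

/-- Two-point function `H_λ(x)` (real-valued potential). -/
def HRf (φ : ℕ → ℝ) (lam : ℝ) (x : Pt d) : ℝ≥0∞ :=
  ∑' γ : Hpaths x, wR φ lam (γ : List (Pt d))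

/-- Coercion of a lattice point to a real vector. -/
def ctR (x : Pt d) : Fin d → ℝ := fun i => (x i : ℝ)

/-- Componentwise floor `⌊M x⌋`. -/
def flr (M : ℝ) (x : Fin d → ℝ) : Pt d := fun i => ⌊M * x i⌋

/-- Euclidean scalar product on `ℝ^d`. -/
def inr (h x : Fin d → ℝ) : ℝ := ∑ i, h i * x i

/-- Euclidean norm on `ℝ^d`. -/
def nrm (x : Fin d → ℝ) : ℝ := Real.sqrt (∑ i, x i ^ 2)

/-- Wulff shape `K = {h : (h,x) ≤ ξ(x) ∀x}` associated with a norm `ξ`. -/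
def Kset (ξ : (Fin d → ℝ) → ℝ) : Set (Fin d → ℝ) := {h | ∀ x, inr h x ≤ ξ x}

/-- Weight `W_h(γ) = e^{-Φ(γ) + (h, D(γ))}` (extended-real-valued potential). -/
def wHE (φ : ℕ → ℝ≥0∞) (h : Fin d → ℝ) (γ : List (Pt d)) : ℝ≥0∞ :=
  expNegE (PotE φ γ) * ENNReal.ofReal (Real.exp (inr h (ctR (disp γ))))

/-- Partition function `Z_n^h` with drift `h` (extended-real-valued potential). -/
def ZHE (d : ℕ) (φ : ℕ → ℝ≥0∞) (h : Fin d → ℝ) (n : ℕ) : ℝ≥0∞ :=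
  ∑' γ : PathsN d n, wHE φ h (γ : List (Pt d))

/-- Weight `W_h(γ) = e^{-Φ(γ) + (h, D(γ))}` (real-valued potential). -/
def wHR (φ : ℕ → ℝ) (h : Fin d → ℝ) (γ : List (Pt d)) : ℝ≥0∞ :=
  ENNReal.ofReal (Real.exp (-PotR φ γ + inr h (ctR (disp γ))))

/-- Partition function `Z_n^h` with drift `h` (real-valued potential). -/
def ZHR (d : ℕ) (φ : ℕ → ℝ) (h : Fin d → ℝ) (n : ℕ) : ℝ≥0∞ :=
  ∑' γ : PathsN d n, wHR φ h (γ : List (Pt d))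

/-- Condition (SL) for an extended-real-valued potential: finiteness and sublinearity. -/
def SLE (φ : ℕ → ℝ≥0∞) : Prop :=
  (∀ n, φ n ≠ ⊤) ∧ Tendsto (fun n : ℕ => (φ n).toReal / n) atTop (𝓝 0)

/-- Forward cone `Y^>_δ(h) = {y : s_h(y) < δ ξ(y)}`, where `s_h(y) = ξ(y) - (h,y)`. -/
def Ygt (ξ : (Fin d → ℝ) → ℝ) (h : Fin d → ℝ) (δ : ℝ) : Set (Pt d) :=
  {y | ξ (ctR y) - inr h (ctR y) < δ * ξ (ctR y)}

/-- `γ(k)` is an `(h,δ)`-cone point of `γ`: the whole path lies in the union of the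
forward and backward cones of aperture `3δ` centred at `γ(k)`. -/
def IsConePt (ξ : (Fin d → ℝ) → ℝ) (h : Fin d → ℝ) (δ : ℝ) (γ : List (Pt d)) (k : ℕ) : Prop :=
  k ≤ γ.length ∧ ∀ j ≤ γ.length, j ≠ k →
    ((pos γ j - pos γ k) ∈ Ygt ξ h (3 * δ) ∨ (pos γ k - pos γ j) ∈ Ygt ξ h (3 * δ))

open scoped Classical in
/-- The number of `(h,δ)`-cone points of the path `γ`. -/
def coneCount (ξ : (Fin d → ℝ) → ℝ) (h : Fin d → ℝ) (δ : ℝ) (γ : List (Pt d)) : ℕ :=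
  ((Finset.range (γ.length + 1)).filter (fun k => IsConePt ξ h δ γ k)).card

/-- Unoriented edges traversed by the path `γ` started at the point `a`. -/
def pathEdges (a : Pt d) (γ : List (Pt d)) : Set (Sym2 (Pt d)) :=
  {e | ∃ k < γ.length, e = s(a + pos γ k, a + pos γ (k + 1))}

/-- Starting point of the `i`-th piece in the concatenation of the paths `γv 0, …, γv (m-1)`. -/
def famStart {m : ℕ} (γv : Fin m → List (Pt d)) (i : Fin m) : Pt d :=
  ∑ j ∈ Finset.univ.filter (fun j : Fin m => j < i), disp (γv j)

/-- The pieces `γv 0, …, γv (m-1)` of a concatenation are edge-disjoint. -/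
def EdgeDisjointFam {m : ℕ} (γv : Fin m → List (Pt d)) : Prop :=
  ∀ i j : Fin m, i ≠ j →
    Disjoint (pathEdges (famStart γv i) (γv i)) (pathEdges (famStart γv j) (γv j))

/-- Concatenation `γ₁ ∪ ⋯ ∪ γ_m` of paths (as step lists). -/
def concatFam {m : ℕ} (γv : Fin m → List (Pt d)) : List (Pt d) := (List.ofFn γv).flatten

/-- Perturbed weight `e^{-Φ(γ) - R(γ,g) + (g, D(γ))}`. -/
def wPert (φ : ℕ → ℝ≥0∞) (Rp : List (Pt d) → (Fin d → ℝ) → ℝ) (g : Fin d → ℝ)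
    (γ : List (Pt d)) : ℝ≥0∞ :=
  expNegE (PotE φ γ) * ENNReal.ofReal (Real.exp (-Rp γ g + inr g (ctR (disp γ))))

/-- Perturbed partition function `Z̃_n^g`. -/
def ZPert (d : ℕ) (φ : ℕ → ℝ≥0∞) (Rp : List (Pt d) → (Fin d → ℝ) → ℝ)
    (g : Fin d → ℝ) (n : ℕ) : ℝ≥0∞ :=
  ∑' γ : PathsN d n, wPert φ Rp g (γ : List (Pt d))

/-- The segment of `γ` of length `p` started at time `l` matches the pattern
`(u 0, …, u p)` up to a shift. -/
def patMatch (u : ℕ → Pt d) (p : ℕ) (γ : List (Pt d)) (l : ℕ) : Prop :=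
  ∀ j ≤ p, pos γ (l + j) - pos γ l = u j - u 0

open scoped Classical in
/-- Number of occurrences `N_η(γ)` of the pattern `η = (u 0, …, u p)` in `γ`. -/
def Npat (u : ℕ → Pt d) (p : ℕ) (γ : List (Pt d)) : ℕ :=
  ((Finset.range (γ.length + 1 - p)).filter (fun l => patMatch u p γ l)).card

/-- The gradient vector of `f : ℝ^d → ℝ` at `g`. -/
def gradVec (f : (Fin d → ℝ) → ℝ) (g : Fin d → ℝ) : Fin d → ℝ :=
  fun i => fderiv ℝ f g (Pi.single i 1)

end SIRW

open SIRW

namespace SIRWAux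

variable {d : ℕ}

/-- vertex list of a path -/
def vl : List (Pt d) → List (Pt d)
  | [] => [0]
  | s :: γ => 0 :: (vl γ).map (fun y => s + y)

/-- potential of a list of sites -/
def Psi (φ : ℕ → ℝ≥0∞) (S : List (Pt d)) : ℝ≥0∞ := ∑ x ∈ S.toFinset, φ (S.count x)

lemma vl_eq_range (γ : List (Pt d)) : vl γ = (List.range (γ.length + 1)).map (pos γ) := by
  induction γ with
  | nil => simp [vl, pos]
  | cons s γ ih =>
    rw [List.length_cons, List.range_succ_eq_map, vl, ih]
    simp [pos, Function.comp_def]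

lemma locTime_eq (γ : List (Pt d)) (x : Pt d) : locTime γ x = (vl γ).count x := by
  rw [vl_eq_range, List.count, List.countP_map, locTime]
  rw [Finset.card_def, Finset.filter_val, ← Multiset.countP_eq_card_filter]
  rw [Finset.range_val, Multiset.range, Multiset.coe_countP]
  apply List.countP_congr
  intro a _
  simp

lemma PotE_eq (φ : ℕ → ℝ≥0∞) (γ : List (Pt d)) : PotE φ γ = Psi φ (vl γ) := by
  have h : visited γ = (vl γ).toFinset := by
    ext x
    rw [vl_eq_range]
    simp [visited]
  rw [PotE, Psi, h]
  exact Finset.sum_congr rfl (fun x _ => by rw [locTime_eq])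

lemma psi_superset {φ : ℕ → ℝ≥0∞} (h0 : φ 0 = 0) (S : List (Pt d)) (F : Finset (Pt d))
    (hF : S.toFinset ⊆ F) : Psi φ S = ∑ x ∈ F, φ (S.count x) := by
  apply Finset.sum_subset hF
  intro x _ hx
  rw [List.mem_toFinset] at hx
  rw [List.count_eq_zero_of_not_mem hx, h0]

lemma psi_append {φ : ℕ → ℝ≥0∞} (h0 : φ 0 = 0) (hR : ∀ l m : ℕ, φ l + φ m ≤ φ (l + m))
    (S T : List (Pt d)) : Psi φ S + Psi φ T ≤ Psi φ (S ++ T) := by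
  rw [psi_superset h0 S (S ++ T).toFinset (by intro x; simp; tauto),
    psi_superset h0 T (S ++ T).toFinset (by intro x; simp; tauto), ← Finset.sum_add_distrib, Psi]
  apply Finset.sum_le_sum
  intro x _
  rw [List.count_append]
  exact hR _ _

lemma psi_append_disj {φ : ℕ → ℝ≥0∞} (h0 : φ 0 = 0)
    (S T : List (Pt d)) (hd : ∀ x ∈ S, x ∉ T) : Psi φ (S ++ T) = Psi φ S + Psi φ T := by
  rw [psi_superset h0 S (S ++ T).toFinset (by intro x; simp; tauto),
    psi_superset h0 T (S ++ T).toFinset (by intro x; simp; tauto), ← Finset.sum_add_distrib, Psi]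
  apply Finset.sum_congr rfl
  intro x _
  rw [List.count_append]
  by_cases hx : x ∈ S
  · rw [List.count_eq_zero_of_not_mem (hd x hx)]; simp [h0]
  · rw [List.count_eq_zero_of_not_mem hx]; simp [h0]

lemma psi_map {φ : ℕ → ℝ≥0∞} (f : Pt d → Pt d) (hf : Function.Injective f)
    (S : List (Pt d)) : Psi φ (S.map f) = Psi φ S := by
  have : (S.map f).toFinset = S.toFinset.image f := by ext x; simp
  rw [Psi, this, Finset.sum_image (fun a _ b _ h => hf h), Psi]
  apply Finset.sum_congr rfl
  intro x _
  rw [List.count_map_of_injective _ _ hf]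

lemma psi_reverse {φ : ℕ → ℝ≥0∞} (S : List (Pt d)) : Psi φ S.reverse = Psi φ S := by
  simp [Psi]

lemma zero_mem_vl (γ : List (Pt d)) : (0 : Pt d) ∈ vl γ := by
  cases γ <;> simp [vl]

lemma disp_cons (s : Pt d) (γ : List (Pt d)) : disp (s :: γ) = s + disp γ := by simp [disp]

lemma disp_nil : disp ([] : List (Pt d)) = 0 := by simp [disp]

lemma disp_append (γ γ' : List (Pt d)) : disp (γ ++ γ') = disp γ + disp γ' := by simp [disp]

lemma disp_reverse (γ : List (Pt d)) : disp γ.reverse = disp γ := by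
  simp [disp, List.sum_reverse]

lemma disp_mem_vl (γ : List (Pt d)) : disp γ ∈ vl γ := by
  induction γ with
  | nil => simp [vl, disp]
  | cons s γ ih =>
    rw [vl, disp_cons]
    exact List.mem_cons_of_mem _ (List.mem_map_of_mem ih)

lemma vl_append_cons (γ γ' : List (Pt d)) (e : Pt d) :
    vl (γ ++ e :: γ') = vl γ ++ (vl γ').map (fun y => disp γ + e + y) := by
  induction γ with
  | nil => simp [vl, disp]
  | cons s γ ih =>
    rw [List.cons_append, vl, ih, vl, disp_cons]
    simp [Function.comp_def, add_assoc]

lemma vl_reverse (γ : List (Pt d)) :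
    vl γ.reverse = (vl γ).reverse.map (fun y => disp γ - y) := by
  induction γ with
  | nil => simp [vl, disp]
  | cons s γ ih =>
    rw [List.reverse_cons, vl_append_cons, ih, vl, disp_cons, disp_reverse]
    simp [vl, Function.comp_def, add_comm, ← List.map_reverse]

lemma psi_vl_reverse {φ : ℕ → ℝ≥0∞} (γ : List (Pt d)) :
    Psi φ (vl γ.reverse) = Psi φ (vl γ) := by
  rw [vl_reverse, psi_map _ (fun a b h => sub_right_injective h), psi_reverse]

lemma mem_vl_reverse (γ : List (Pt d)) (y : Pt d) :
    y ∈ vl γ.reverse ↔ disp γ - y ∈ vl γ := by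
  rw [vl_reverse]
  simp only [List.mem_map, List.mem_reverse]
  constructor
  · rintro ⟨a, ha, rfl⟩; simpa using ha
  · intro h; exact ⟨_, h, by simp⟩

/-- reflections -/
def rf (ρ : Fin d → ℤˣ) (y : Pt d) : Pt d := fun k => (ρ k : ℤ) * y k

lemma rf_add (ρ : Fin d → ℤˣ) (a b : Pt d) : rf ρ (a + b) = rf ρ a + rf ρ b := by
  ext k; simp [rf, mul_add]

lemma rf_zero (ρ : Fin d → ℤˣ) : rf ρ (0 : Pt d) = 0 := by ext k; simp [rf]

lemma rf_rf (ρ : Fin d → ℤˣ) (a : Pt d) : rf ρ (rf ρ a) = a := by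
  ext k
  simp only [rf]
  rw [← mul_assoc, ← Units.val_mul, Int.units_mul_self]; simp

lemma rf_inj (ρ : Fin d → ℤˣ) : Function.Injective (rf ρ) := by
  intro a b h
  rw [← rf_rf ρ a, h, rf_rf]

lemma rf_rf_map (ρ : Fin d → ℤˣ) (γ : List (Pt d)) : (γ.map (rf ρ)).map (rf ρ) = γ := by
  rw [List.map_map]
  convert List.map_id γ
  ext a : 1
  simp [rf_rf]

lemma isStep_rf (ρ : Fin d → ℤˣ) {s : Pt d} (h : IsStep s) : IsStep (rf ρ s) := by
  unfold IsStep at *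
  rw [← h]
  apply Finset.sum_congr rfl
  intro i _
  rcases Int.units_eq_one_or (ρ i) with h | h <;> simp [rf, h]

lemma isPath_rf (ρ : Fin d → ℤˣ) {γ : List (Pt d)} (h : IsPath γ) : IsPath (γ.map (rf ρ)) := by
  intro s hs
  obtain ⟨a, ha, rfl⟩ := List.mem_map.1 hs
  exact isStep_rf ρ (h a ha)

lemma vl_rf (ρ : Fin d → ℤˣ) (γ : List (Pt d)) : vl (γ.map (rf ρ)) = (vl γ).map (rf ρ) := by
  induction γ with
  | nil => simp [vl, rf_zero]
  | cons s γ ih => simp [vl, rf_zero, ih, Function.comp_def, rf_add]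

lemma disp_rf (ρ : Fin d → ℤˣ) (γ : List (Pt d)) : disp (γ.map (rf ρ)) = rf ρ (disp γ) := by
  induction γ with
  | nil => simp [disp, rf_zero]
  | cons s γ ih => rw [List.map_cons, disp_cons, disp_cons, rf_add, ih]

lemma psi_vl_rf {φ : ℕ → ℝ≥0∞} (ρ : Fin d → ℤˣ) (γ : List (Pt d)) :
    Psi φ (vl (γ.map (rf ρ))) = Psi φ (vl γ) := by
  rw [vl_rf, psi_map _ (rf_inj ρ)]

lemma isPath_append {γ γ' : List (Pt d)} : IsPath (γ ++ γ') ↔ IsPath γ ∧ IsPath γ' := by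
  simp only [IsPath, List.mem_append]
  constructor
  · intro h; exact ⟨fun s hs => h s (Or.inl hs), fun s hs => h s (Or.inr hs)⟩
  · rintro ⟨h1, h2⟩ s (hs | hs)
    exacts [h1 s hs, h2 s hs]

lemma isPath_cons {s : Pt d} {γ : List (Pt d)} : IsPath (s :: γ) ↔ IsStep s ∧ IsPath γ := by
  simp [IsPath]

lemma isPath_nil : IsPath ([] : List (Pt d)) := by simp [IsPath]

lemma isPath_reverse {γ : List (Pt d)} (h : IsPath γ) : IsPath γ.reverse := by
  intro s hs; exact h s (List.mem_reverse.1 hs)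

lemma step_coord {s : Pt d} (h : IsStep s) (i : Fin d) : |s i| ≤ 1 := by
  unfold IsStep at h
  rw [← h]
  exact Finset.single_le_sum (f := fun i => |s i|) (fun _ _ => abs_nonneg _) (Finset.mem_univ i)

lemma coord_le_length {γ : List (Pt d)} (h : IsPath γ) (i : Fin d) :
    ∀ y ∈ vl γ, |y i| ≤ γ.length := by
  induction γ with
  | nil => simp [vl]
  | cons s γ ih =>
    rw [isPath_cons] at h
    intro y hy
    rw [vl, List.mem_cons, List.mem_map] at hy
    rcases hy with rfl | ⟨z, hz, rfl⟩
    · simp; positivity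
    · have h1 := ih h.2 z hz
      have h2 := step_coord h.1 i
      have := abs_add_le (s i) (z i)
      push_cast [List.length_cons]
      simp only [Pi.add_apply]
      linarith

/-- reflection of a single coordinate -/
def sg (i : Fin d) : Fin d → ℤˣ := Function.update 1 i (-1)

lemma rf_sg_same (i : Fin d) (y : Pt d) : rf (sg i) y i = - y i := by simp [rf, sg]

lemma rf_sg_ne {i j : Fin d} (h : j ≠ i) (y : Pt d) : rf (sg i) y j = y j := by
  simp [rf, sg, h]

lemma split_max (i : Fin d) (γ : List (Pt d)) :
    (∀ y ∈ vl γ, y i ≤ disp γ i) ∨ ∃ γ1 e γ2, γ = γ1 ++ e :: γ2 ∧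
      (∀ y ∈ vl γ1, y i ≤ disp γ1 i) ∧ (∀ y ∈ vl γ2, e i + y i < 0) := by
  induction γ with
  | nil => left; simp [vl, disp]
  | cons s γ ih =>
    rcases ih with h | ⟨γ1, e, γ2, rfl, h1, h2⟩
    · by_cases h0 : 0 ≤ disp (s :: γ) i
      · left
        intro y hy
        rw [vl, List.mem_cons, List.mem_map] at hy
        rcases hy with rfl | ⟨z, hz, rfl⟩
        · simpa using h0
        · rw [disp_cons]; simpa using h z hz
      · right
        refine ⟨[], s, γ, rfl, by simp [vl, disp], ?_⟩
        intro y hy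
        have := h y hy
        rw [disp_cons] at h0
        simp only [Pi.add_apply] at h0
        linarith
    · right
      by_cases h0 : 0 ≤ disp (s :: γ1) i
      · refine ⟨s :: γ1, e, γ2, rfl, ?_, h2⟩
        intro y hy
        rw [vl, List.mem_cons, List.mem_map] at hy
        rcases hy with rfl | ⟨z, hz, rfl⟩
        · simpa using h0
        · rw [disp_cons]; simpa using h1 z hz
      · refine ⟨[], s, _, rfl, by simp [vl, disp], ?_⟩
        rw [disp_cons] at h0
        simp only [Pi.add_apply] at h0
        intro y hy
        rw [vl_append_cons, List.mem_append, List.mem_map] at hy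
        rcases hy with hy | ⟨z, hz, rfl⟩
        · have := h1 y hy; linarith
        · have := h2 z hz
          simp only [Pi.add_apply]
          linarith

lemma split_min (i : Fin d) (γ : List (Pt d)) :
    (∀ y ∈ vl γ, 0 ≤ y i) ∨ ∃ γ0 e γ1, γ = γ0 ++ e :: γ1 ∧
      (∀ y ∈ vl γ1, 0 ≤ y i) ∧ (∀ y ∈ vl γ0, disp γ0 i + e i < y i) := by
  induction γ with
  | nil => left; simp [vl]
  | cons s γ ih =>
    rcases ih with h | ⟨γ0, e, γ1, rfl, h1, h2⟩
    · by_cases h0 : 0 ≤ s i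
      · left
        intro y hy
        rw [vl, List.mem_cons, List.mem_map] at hy
        rcases hy with rfl | ⟨z, hz, rfl⟩
        · simp
        · have := h z hz; simp only [Pi.add_apply]; linarith
      · right
        refine ⟨[], s, γ, rfl, h, ?_⟩
        simp [vl, disp]; linarith
    · by_cases h0 : 0 ≤ s i + (disp γ0 i + e i)
      · left
        intro y hy
        rw [vl, List.mem_cons, List.mem_map] at hy
        rcases hy with rfl | ⟨z, hz, rfl⟩
        · simp
        · rw [vl_append_cons, List.mem_append, List.mem_map] at hz
          rcases hz with hz | ⟨z, hz, rfl⟩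
          · have := h2 z hz; simp only [Pi.add_apply]; linarith
          · have := h1 z hz; simp only [Pi.add_apply]; linarith
      · right
        refine ⟨s :: γ0, e, γ1, rfl, h1, ?_⟩
        intro y hy
        rw [disp_cons]
        simp only [Pi.add_apply]
        rw [vl, List.mem_cons, List.mem_map] at hy
        rcases hy with rfl | ⟨z, hz, rfl⟩
        · simp only [Pi.zero_apply]; linarith
        · have := h2 z hz; simp only [Pi.add_apply]; linarith

end SIRWAux

namespace SIRWAux

variable {d : ℕ}

/-- decoding of half-space unfolding -/
def dec (i : Fin d) : List ℕ → List (Pt d) → List (Pt d)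
  | [], u => u
  | n :: c, u => u.take n ++ ((u.drop n).take 1 ++ dec i c (u.drop (n + 1))).map (rf (sg i))

lemma dec_nil (i : Fin d) (c : List ℕ) : dec i c [] = [] := by
  induction c with
  | nil => rfl
  | cons n c ih => simp [dec, ih]

lemma dec_big (i : Fin d) (c : List ℕ) (u : List (Pt d)) (h : ∀ a ∈ c, u.length ≤ a) :
    dec i c u = u := by
  cases c with
  | nil => rfl
  | cons n c =>
    have h1 : u.length ≤ n := h n (by simp)
    have h2 : u.length ≤ n + 1 := by omega
    simp [dec, List.take_of_length_le h1, List.drop_of_length_le h1, List.drop_of_length_le h2,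
      dec_nil]

lemma dec_pad (i : Fin d) (c : List ℕ) (m b : ℕ) : ∀ (u : List (Pt d)), u.length ≤ b →
    dec i (c ++ List.replicate m b) u = dec i c u := by
  induction c with
  | nil =>
    intro u hu
    rw [List.nil_append, dec_big, dec]
    intro a ha
    rw [List.eq_of_mem_replicate ha]; exact hu
  | cons n c ih =>
    intro u hu
    rw [List.cons_append, dec, dec, ih]
    rw [List.length_drop]; omega

lemma unfoldHS {φ : ℕ → ℝ≥0∞} (h0 : φ 0 = 0) (hR : ∀ l m : ℕ, φ l + φ m ≤ φ (l + m))
    (i : Fin d) : ∀ n, ∀ γ : List (Pt d), γ.length = n → IsPath γ → (∀ y ∈ vl γ, 0 ≤ y i) →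
    ∀ A : ℕ, (∀ y ∈ vl γ, y i ≤ A) → ∃ u c, IsPath u ∧ u.length = γ.length ∧
      Psi φ (vl u) ≤ Psi φ (vl γ) ∧
      (∀ j, j ≠ i → (vl u).map (fun y => y j) = (vl γ).map (fun y => y j) ∧
        disp u j = disp γ j) ∧
      (∀ y ∈ vl u, 0 ≤ y i ∧ y i ≤ disp u i) ∧
      (∀ y ∈ vl γ, y i ≤ disp u i) ∧ dec i c u = γ ∧ (∀ a ∈ c, a ≤ γ.length) ∧
      c.length ≤ A ∧ c.length * (c.length + 1) ≤ 2 * γ.length := by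
  intro n
  induction n using Nat.strong_induction_on with
  | _ n ih =>
  intro γ hn hγ hpos A hA
  rcases split_max i γ with h | ⟨γ1, e, γ2, rfl, h1, h2⟩
  · exact ⟨γ, [], hγ, rfl, le_rfl, fun _ _ => ⟨rfl, rfl⟩, fun y hy => ⟨hpos y hy, h y hy⟩, h, rfl,
      by simp, by simp, by simp⟩
  · rw [isPath_append, isPath_cons] at hγ
    obtain ⟨hγ1, he, hγ2⟩ := hγ
    have hei : e i = -1 := by
      have a1 := h2 0 (zero_mem_vl _)
      have a2 := abs_le.1 (step_coord he i)
      simp only [Pi.zero_apply] at a1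
      omega
    have hP : ∀ y ∈ vl γ2, 0 ≤ disp γ1 i - 1 + y i := by
      intro y hy
      have := hpos (disp γ1 + e + y) (by
        rw [vl_append_cons]
        exact List.mem_append_right _ (List.mem_map_of_mem hy))
      simp only [Pi.add_apply] at this
      omega
    have hP1 : 1 ≤ disp γ1 i := by
      have := hP 0 (zero_mem_vl _)
      simp only [Pi.zero_apply] at this
      omega
    have hlen1 := coord_le_length hγ1 i _ (disp_mem_vl γ1)
    rw [abs_of_nonneg (by omega)] at hlen1
    have hA1 : disp γ1 i ≤ A := hA _ (by
      rw [vl_append_cons]; exact List.mem_append_left _ (disp_mem_vl γ1))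
    have hlen : (γ1 ++ e :: γ2).length = γ1.length + 1 + γ2.length := by simp; omega
    obtain ⟨u, c, hu, hul, hupsi, huj, hui, huγ, hdec, hcN, hcA, hck⟩ :=
      ih γ2.length (by omega) (γ2.map (rf (sg i))) (by simp) (isPath_rf _ hγ2)
        (by
          intro y hy
          rw [vl_rf, List.mem_map] at hy
          obtain ⟨z, hz, rfl⟩ := hy
          rw [rf_sg_same]
          have := h2 z hz
          omega) (disp γ1 i - 1).toNat
        (by
          intro y hy
          rw [vl_rf, List.mem_map] at hy
          obtain ⟨z, hz, rfl⟩ := hy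
          rw [rf_sg_same]
          have := hP z hz
          omega)
    have hdu : disp (γ1 ++ rf (sg i) e :: u) i = disp γ1 i + 1 + disp u i := by
      rw [disp_append, disp_cons]
      simp only [Pi.add_apply, rf_sg_same]
      omega
    have hu0 := (hui 0 (zero_mem_vl _)).2
    simp only [Pi.zero_apply] at hu0
    rw [List.length_map] at hul hcN hck
    refine ⟨γ1 ++ rf (sg i) e :: u, γ1.length :: c, ?_, by simp [hul], ?_, ?_, ?_, ?_, ?_, ?_,
      ?_, ?_⟩
    · rw [isPath_append, isPath_cons]
      exact ⟨hγ1, isStep_rf _ he, hu⟩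
    · rw [vl_append_cons, vl_append_cons, psi_append_disj h0]
      · refine le_trans ?_ (psi_append h0 hR _ _)
        rw [psi_map _ (add_right_injective _), psi_map _ (add_right_injective _)]
        rw [psi_vl_rf] at hupsi
        gcongr
      · intro x hx hx'
        rw [List.mem_map] at hx'
        obtain ⟨z, hz, rfl⟩ := hx'
        have a1 := h1 _ hx
        have a2 := (hui z hz).1
        simp only [Pi.add_apply, rf_sg_same] at a1
        omega
    · intro j hj
      obtain ⟨hj1, hj2⟩ := huj j hj
      constructor
      · rw [vl_append_cons, vl_append_cons, List.map_append, List.map_append, List.map_map,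
          List.map_map]
        have e1 : ((fun y : Pt d => y j) ∘ fun y => disp γ1 + rf (sg i) e + y) =
          (fun z : ℤ => disp γ1 j + e j + z) ∘ (fun y : Pt d => y j) := by
          ext y; simp [rf_sg_ne hj]
        have e2 : ((fun y : Pt d => y j) ∘ fun y => disp γ1 + e + y) =
          (fun z : ℤ => disp γ1 j + e j + z) ∘ (fun y : Pt d => y j) := by
          ext y; simp
        rw [e1, e2, ← List.map_map, hj1, vl_rf, List.map_map, List.map_map]
        congr 2
        ext y
        simp [rf_sg_ne hj]
      · rw [disp_append, disp_cons, disp_append, disp_cons]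
        simp only [Pi.add_apply, rf_sg_ne hj, hj2, disp_rf]
    · intro y hy
      rw [hdu]
      rw [vl_append_cons, List.mem_append, List.mem_map] at hy
      rcases hy with hy | ⟨z, hz, rfl⟩
      · have := h1 y hy
        have := hpos y (by rw [vl_append_cons]; exact List.mem_append_left _ hy)
        omega
      · have := hui z hz
        simp only [Pi.add_apply, rf_sg_same]
        omega
    · intro y hy
      rw [hdu]
      rw [vl_append_cons, List.mem_append, List.mem_map] at hy
      rcases hy with hy | ⟨z, hz, rfl⟩
      · have := h1 y hy
        omega
      · have := h2 z hz
        simp only [Pi.add_apply]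
        omega
    · have d1 : (γ1 ++ rf (sg i) e :: u).drop γ1.length = rf (sg i) e :: u := by simp
      have d2 : (γ1 ++ rf (sg i) e :: u).drop (γ1.length + 1) = u := by
        rw [← List.drop_drop, d1]; simp
      rw [dec, d1, d2, hdec]
      simp [rf_rf, List.map_map, Function.comp_def]
    · intro a ha
      rw [hlen]
      rcases List.mem_cons.1 ha with rfl | ha
      · omega
      · have := hcN a ha; omega
    · rw [List.length_cons]; omega
    · rw [List.length_cons, hlen]
      have : c.length + 1 ≤ γ1.length := by omega
      nlinarith

/-- decoding of full unfolding -/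
def dec2 (i : Fin d) (o : Option ℕ) (c0 c1 : List ℕ) (u : List (Pt d)) : List (Pt d) :=
  match o with
  | none => dec i c1 u
  | some n => ((dec i c0 (u.take n).reverse).map (rf (sg i))).reverse ++
      ((u.drop n).take 1).map (rf (sg i)) ++ dec i c1 (u.drop (n + 1))

lemma unfold_full {φ : ℕ → ℝ≥0∞} (h0 : φ 0 = 0) (hR : ∀ l m : ℕ, φ l + φ m ≤ φ (l + m))
    (i : Fin d) (γ : List (Pt d)) (hγ : IsPath γ) (N K : ℕ) (hN : γ.length = N)
    (hK : 2 * N < (K + 1) * (K + 2)) : ∃ u o c0 c1, IsPath u ∧ u.length = N ∧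
      Psi φ (vl u) ≤ Psi φ (vl γ) ∧
      (∀ j, j ≠ i → (vl u).map (fun y => y j) = (vl γ).map (fun y => y j) ∧
        disp u j = disp γ j) ∧
      (∀ y ∈ vl u, 0 ≤ y i ∧ y i ≤ disp u i) ∧
      |disp γ i| ≤ disp u i ∧ dec2 i o c0 c1 u = γ ∧
      (∀ a ∈ o, a ≤ N) ∧ (∀ a ∈ c0, a ≤ N) ∧ (∀ a ∈ c1, a ≤ N) ∧
      c0.length = K ∧ c1.length = K := by
  have hpad : ∀ γ : List (Pt d), γ.length ≤ N → IsPath γ → (∀ y ∈ vl γ, 0 ≤ y i) →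
      ∃ u c, IsPath u ∧ u.length = γ.length ∧
      Psi φ (vl u) ≤ Psi φ (vl γ) ∧
      (∀ j, j ≠ i → (vl u).map (fun y => y j) = (vl γ).map (fun y => y j) ∧
        disp u j = disp γ j) ∧
      (∀ y ∈ vl u, 0 ≤ y i ∧ y i ≤ disp u i) ∧
      (∀ y ∈ vl γ, y i ≤ disp u i) ∧ dec i c u = γ ∧ (∀ a ∈ c, a ≤ N) ∧ c.length = K := by
    intro γ hl hγ hp
    obtain ⟨u, c, a1, a2, a3, a4, a5, a6, a7, a8, a9, a10⟩ := unfoldHS h0 hR i _ γ rfl hγ hp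
      γ.length (fun y hy => le_trans (le_abs_self _) (coord_le_length hγ i y hy))
    have hcK : c.length ≤ K := by
      by_contra hcon
      push Not at hcon
      have : (K + 1) * (K + 2) ≤ c.length * (c.length + 1) :=
        Nat.mul_le_mul (by omega) (by omega)
      omega
    refine ⟨u, c ++ List.replicate (K - c.length) N, a1, a2, a3, a4, a5, a6, ?_, ?_, ?_⟩
    · rw [dec_pad _ _ _ _ _ (by omega), a7]
    · intro a ha
      rcases List.mem_append.1 ha with ha | ha
      · exact le_trans (a8 a ha) hl
      · rw [List.eq_of_mem_replicate ha]
    · simp; omega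
  rcases split_min i γ with h | ⟨γ0, e, γ1, rfl, h1, h2⟩
  · obtain ⟨u, c, a1, a2, a3, a4, a5, a6, a7, a8, a9⟩ := hpad γ hN.le hγ h
    refine ⟨u, none, c, c, a1, by omega, a3, a4, a5, ?_, a7, by simp, a8, a8, a9, a9⟩
    rw [abs_of_nonneg (h _ (disp_mem_vl _))]
    exact a6 _ (disp_mem_vl _)
  · rw [isPath_append, isPath_cons] at hγ
    obtain ⟨hγ0, he, hγ1⟩ := hγ
    have hlen : (γ0 ++ e :: γ1).length = γ0.length + 1 + γ1.length := by simp; omega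
    have hei : e i = -1 := by
      have a1 := h2 _ (disp_mem_vl _)
      have a2 := abs_le.1 (step_coord he i)
      omega
    obtain ⟨u, c, a1, a2, a3, a4, a5, a6, a7, a8, a9⟩ := hpad γ1 (by omega) hγ1 h1
    obtain ⟨v, c', b1, b2, b3, b4, b5, b6, b7, b8, b9⟩ := hpad (γ0.reverse.map (rf (sg i)))
      (by simp; omega) (isPath_rf _ (isPath_reverse hγ0)) (by
        intro y hy
        rw [vl_rf, List.mem_map] at hy
        obtain ⟨z, hz, rfl⟩ := hy
        rw [mem_vl_reverse] at hz
        have := h2 _ hz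
        simp only [Pi.sub_apply] at this
        rw [rf_sg_same]
        omega)
    rw [List.length_map, List.length_reverse] at b2
    rw [psi_vl_rf, psi_vl_reverse] at b3
    have hdu : disp (v.reverse ++ rf (sg i) e :: u) i = disp v i + 1 + disp u i := by
      rw [disp_append, disp_cons, disp_reverse]
      simp only [Pi.add_apply, rf_sg_same]
      omega
    have hu0 := (a5 0 (zero_mem_vl _)).2
    have hv0 := (b5 0 (zero_mem_vl _)).2
    simp only [Pi.zero_apply] at hu0 hv0
    refine ⟨v.reverse ++ rf (sg i) e :: u, some γ0.length, c', c, ?_, ?_, ?_, ?_, ?_, ?_, ?_,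
      ?_, b8, a8, b9, a9⟩
    · rw [isPath_append, isPath_cons]
      exact ⟨isPath_reverse b1, isStep_rf _ he, a1⟩
    · simp; omega
    · rw [vl_append_cons, vl_append_cons, psi_append_disj h0]
      · refine le_trans ?_ (psi_append h0 hR _ _)
        rw [psi_map _ (add_right_injective _), psi_map _ (add_right_injective _), psi_vl_reverse]
        gcongr
      · intro x hx hx'
        rw [mem_vl_reverse] at hx
        rw [List.mem_map] at hx'
        obtain ⟨z, hz, rfl⟩ := hx'
        have c1 := (b5 _ hx).1
        have c2 := (a5 z hz).1
        simp only [Pi.add_apply, rf_sg_same, Pi.sub_apply, disp_reverse] at c1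
        omega
    · intro j hj
      obtain ⟨hj1, hj2⟩ := a4 j hj
      obtain ⟨hj3, hj4⟩ := b4 j hj
      have hj5 : disp v j = disp γ0 j := by
        rw [hj4, disp_rf, rf_sg_ne hj, disp_reverse]
      constructor
      · rw [vl_append_cons, vl_append_cons, List.map_append, List.map_append, List.map_map,
          List.map_map]
        have e1 : ((fun y : Pt d => y j) ∘ fun y => disp v.reverse + rf (sg i) e + y) =
          (fun z : ℤ => disp γ0 j + e j + z) ∘ (fun y : Pt d => y j) := by
          ext y; simp [rf_sg_ne hj, disp_reverse, hj5]
        have e2 : ((fun y : Pt d => y j) ∘ fun y => disp γ0 + e + y) =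
          (fun z : ℤ => disp γ0 j + e j + z) ∘ (fun y : Pt d => y j) := by
          ext y; simp
        rw [e1, e2, ← List.map_map, hj1, List.map_map]
        congr 1
        have e3 : ∀ z, ((fun y : Pt d => y j) ∘ fun y => z - y) =
          (fun w : ℤ => z j - w) ∘ (fun y : Pt d => y j) := by
          intro z; ext y; simp
        have e4 : (fun y : Pt d => y j) ∘ rf (sg i) = fun y : Pt d => y j := by
          ext y; simp [rf_sg_ne hj]
        rw [vl_rf, List.map_map, e4] at hj3
        rw [vl_reverse, List.map_map, List.map_reverse, e3, ← List.map_map, hj3, vl_reverse]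
        simp [hj5, Function.comp_def]
      · rw [disp_append, disp_cons, disp_append, disp_cons, disp_reverse]
        simp only [Pi.add_apply, rf_sg_ne hj, hj2, hj5]
    · intro y hy
      rw [hdu]
      rw [vl_append_cons, List.mem_append, List.mem_map] at hy
      rcases hy with hy | ⟨z, hz, rfl⟩
      · rw [mem_vl_reverse] at hy
        have := b5 _ hy
        simp only [Pi.sub_apply] at this
        omega
      · have := a5 z hz
        simp only [Pi.add_apply, rf_sg_same, disp_reverse]
        omega
    · rw [hdu, disp_append, disp_cons]
      have c1 := a6 _ (disp_mem_vl _)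
      have c2 := b6 _ (disp_mem_vl _)
      rw [disp_rf, rf_sg_same, disp_reverse] at c2
      have c3 := h2 0 (zero_mem_vl _)
      have c4 := h1 _ (disp_mem_vl _)
      simp only [Pi.add_apply, Pi.zero_apply] at *
      rw [abs_le]
      constructor <;> omega
    · have d0 : (v.reverse ++ rf (sg i) e :: u).take γ0.length = v.reverse := by
        rw [List.take_left']; simp [b2]
      have d1 : (v.reverse ++ rf (sg i) e :: u).drop γ0.length = rf (sg i) e :: u := by
        rw [List.drop_left']; simp [b2]
      have d2 : (v.reverse ++ rf (sg i) e :: u).drop (γ0.length + 1) = u := by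
        rw [← List.drop_drop, d1]; simp
      simp only [dec2]
      rw [d0, d1, d2, a7, List.reverse_reverse, b7, rf_rf_map]
      simp [rf_rf]
    · intro a ha
      simp only [Option.mem_def, Option.some.injEq] at ha
      omega

end SIRWAux

namespace SIRWAux

variable {d : ℕ}

lemma expNegE_anti {a b : ℝ≥0∞} (h : a ≤ b) : expNegE b ≤ expNegE a := by
  unfold expNegE
  by_cases hb : b = ⊤
  · simp [hb]
  · have ha : a ≠ ⊤ := ne_top_of_le_ne_top hb h
    rw [if_neg hb, if_neg ha]
    apply ENNReal.ofReal_le_ofReal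
    apply Real.exp_le_exp.2
    have := ENNReal.toReal_mono hb h
    linarith

lemma expNegE_add (a b : ℝ≥0∞) : expNegE (a + b) = expNegE a * expNegE b := by
  unfold expNegE
  by_cases ha : a = ⊤
  · simp [ha]
  by_cases hb : b = ⊤
  · simp [hb]
  rw [if_neg ha, if_neg hb, if_neg (ENNReal.add_ne_top.2 ⟨ha, hb⟩), ENNReal.toReal_add ha hb,
    ← ENNReal.ofReal_mul (Real.exp_nonneg _), ← Real.exp_add]
  congr 2
  ring

lemma expNegE_le_one (a : ℝ≥0∞) : expNegE a ≤ 1 := by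
  unfold expNegE
  split_ifs
  · simp
  · rw [ENNReal.ofReal_le_one, Real.exp_le_one_iff]
    simp

/-- sum of weights over a set of paths -/
def Sm (φ : ℕ → ℝ≥0∞) (T : Set (List (Pt d))) : ℝ≥0∞ :=
  ∑' γ : T, expNegE (PotE φ (γ : List (Pt d)))

lemma sm_code (φ : ℕ → ℝ≥0∞) {C : Type} [Fintype C] (T T' : Set (List (Pt d)))
    (D : C → List (Pt d) → List (Pt d))
    (h : ∀ γ ∈ T, ∃ u ∈ T', ∃ c, PotE φ u ≤ PotE φ γ ∧ D c u = γ) :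
    Sm φ T ≤ (Fintype.card C : ℝ≥0∞) * Sm φ T' := by
  choose u hu c hc hD using h
  let F : T → C × T' := fun γ => (c γ γ.2, ⟨u γ γ.2, hu γ γ.2⟩)
  have hF : Function.Injective F := by
    intro a b hab
    simp only [F, Prod.mk.injEq, Subtype.mk.injEq] at hab
    apply Subtype.ext
    rw [← hD a a.2, ← hD b b.2, hab.1, hab.2]
  calc Sm φ T ≤ ∑' γ : T, (fun p : C × T' => expNegE (PotE φ (p.2 : List (Pt d)))) (F γ) :=
        ENNReal.tsum_le_tsum (fun γ => expNegE_anti (hc γ γ.2))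
    _ ≤ ∑' p : C × T', expNegE (PotE φ (p.2 : List (Pt d))) :=
        ENNReal.tsum_comp_le_tsum_of_injective hF _
    _ = (Fintype.card C : ℝ≥0∞) * Sm φ T' := by
        refine (ENNReal.tsum_prod (f := fun (_ : C) (b : T') =>
          expNegE (PotE φ (b : List (Pt d))))).trans ?_
        rw [tsum_fintype]
        simp [Sm]

/-- partially unfolded paths -/
def TI (N : ℕ) (v : Pt d) (I : Finset (Fin d)) : Set (List (Pt d)) :=
  {γ | IsPath γ ∧ γ.length = N ∧
    (∀ j ∈ I, (∀ y ∈ vl γ, 0 ≤ y j ∧ y j ≤ disp γ j) ∧ |v j| ≤ disp γ j) ∧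
    ∀ j, j ∉ I → disp γ j = v j}

/-- number of codes -/
def Q (N : ℕ) : ℕ := (N + 2) * ((N + 1) ^ Nat.sqrt (2 * N) * (N + 1) ^ Nat.sqrt (2 * N))

lemma list_code (N K : ℕ) (c : List ℕ) (hc : ∀ a ∈ c, a ≤ N) (hK : c.length = K) :
    ∃ f : Fin K → Fin (N + 1), (List.ofFn f).map Fin.val = c := by
  subst hK
  refine ⟨fun k => ⟨c.get k, Nat.lt_succ_of_le (hc _ (by simp))⟩, ?_⟩
  apply List.ext_getElem
  · simp
  · intro n h1 h2
    simp

lemma TI_step {φ : ℕ → ℝ≥0∞} (h0 : φ 0 = 0) (hR : ∀ l m : ℕ, φ l + φ m ≤ φ (l + m))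
    (N : ℕ) (v : Pt d) (I : Finset (Fin d)) (i : Fin d) (hi : i ∉ I) :
    Sm φ (TI N v I) ≤ (Q N : ℝ≥0∞) * Sm φ (TI N v (insert i I)) := by
  set K := Nat.sqrt (2 * N) with hKd
  have hK : 2 * N < (K + 1) * (K + 2) := by
    have := Nat.lt_succ_sqrt (2 * N)
    rw [← hKd] at this
    calc 2 * N < (K + 1) * (K + 1) := this
      _ ≤ _ := Nat.mul_le_mul le_rfl (by omega)
  have := sm_code φ (C := Option (Fin (N + 1)) × (Fin K → Fin (N + 1)) × (Fin K → Fin (N + 1)))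
    (TI N v I) (TI N v (insert i I))
    (fun c u => dec2 i (c.1.map Fin.val) ((List.ofFn c.2.1).map Fin.val)
      ((List.ofFn c.2.2).map Fin.val) u) (by
    rintro γ ⟨hγ, hl, hI, hnI⟩
    obtain ⟨u, o, c0, c1, a1, a2, a3, a4, a5, a6, a7, a8, a9, a10, a11, a12⟩ :=
      unfold_full h0 hR i γ hγ N K hl hK
    refine ⟨u, ⟨a1, a2, ?_, ?_⟩, ?_⟩
    · intro j hj
      by_cases hji : j = i
      · subst hji
        refine ⟨a5, ?_⟩
        rw [← hnI j hi]; exact a6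
      · have hjI : j ∈ I := by
          rcases Finset.mem_insert.1 hj with h | h
          · exact absurd h hji
          · exact h
        obtain ⟨b1, b2⟩ := hI j hjI
        obtain ⟨b3, b4⟩ := a4 j hji
        rw [b4]
        refine ⟨?_, b2⟩
        intro y hy
        have : y j ∈ (vl γ).map (fun y => y j) := by
          rw [← b3]; exact List.mem_map_of_mem (f := fun y : Pt d => y j) hy
        obtain ⟨z, hz, hzy⟩ := List.mem_map.1 this
        rw [← hzy]
        exact b1 z hz
    · intro j hj
      rw [Finset.mem_insert, not_or] at hj
      rw [(a4 j hj.1).2]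
      exact hnI j hj.2
    · obtain ⟨f0, hf0⟩ := list_code N K c0 a9 a11
      obtain ⟨f1, hf1⟩ := list_code N K c1 a10 a12
      have : ∃ o' : Option (Fin (N + 1)), o'.map Fin.val = o := by
        cases o with
        | none => exact ⟨none, rfl⟩
        | some n => exact ⟨some ⟨n, Nat.lt_succ_of_le (a8 n rfl)⟩, rfl⟩
      obtain ⟨o', ho'⟩ := this
      refine ⟨(o', f0, f1), ?_, ?_⟩
      · rw [PotE_eq, PotE_eq]; exact a3
      · simp only [ho', hf0, hf1]; exact a7)
  refine this.trans (le_of_eq ?_)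
  congr 2
  simp [Q, hKd]

lemma TI_all {φ : ℕ → ℝ≥0∞} (h0 : φ 0 = 0) (hR : ∀ l m : ℕ, φ l + φ m ≤ φ (l + m))
    (N : ℕ) (v : Pt d) (I : Finset (Fin d)) :
    Sm φ (TI N v ∅) ≤ (Q N : ℝ≥0∞) ^ I.card * Sm φ (TI N v I) := by
  induction I using Finset.induction_on with
  | empty => simp
  | insert i I hi ih =>
    rw [Finset.card_insert_of_notMem hi, pow_succ, mul_assoc]
    exact ih.trans (mul_le_mul_right (TI_step h0 hR N v I i hi) _)

/-- box paths: bridges in all coordinates -/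
def BN (N : ℕ) (w : Pt d) : Set (List (Pt d)) :=
  {γ | IsPath γ ∧ γ.length = N ∧ disp γ = w ∧ ∀ y ∈ vl γ, ∀ j, 0 ≤ y j ∧ y j ≤ w j}

lemma exists_box {φ : ℕ → ℝ≥0∞} (h0 : φ 0 = 0) (hR : ∀ l m : ℕ, φ l + φ m ≤ φ (l + m))
    (N : ℕ) (v : Pt d) : ∃ w : Pt d, (∀ j, |v j| ≤ w j) ∧
    Sm φ (TI N v ∅) ≤ ((Q N : ℝ≥0∞) ^ d * ((N + 1 : ℕ) : ℝ≥0∞) ^ d) * Sm φ (BN N w) := by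
  have h1 := TI_all h0 hR N v Finset.univ
  rw [Finset.card_univ, Fintype.card_fin] at h1
  let Box : Finset (Pt d) := Fintype.piFinset (fun j => Finset.Icc |v j| (N : ℤ))
  have hcard : Box.card ≤ (N + 1) ^ d := by
    rw [Fintype.card_piFinset]
    calc _ ≤ ∏ _j : Fin d, (N + 1) := by
          apply Finset.prod_le_prod'
          intro j _
          rw [Int.card_Icc]
          have := abs_nonneg (v j)
          omega
      _ = _ := by simp
  have hsub : TI N v Finset.univ ⊆ ⋃ w ∈ Box, BN N w := by
    rintro γ ⟨a1, a2, a3, -⟩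
    rw [Set.mem_iUnion₂]
    refine ⟨disp γ, ?_, a1, a2, rfl, fun y hy j => (a3 j (Finset.mem_univ j)).1 y hy⟩
    rw [Fintype.mem_piFinset]
    intro j
    rw [Finset.mem_Icc]
    refine ⟨(a3 j (Finset.mem_univ j)).2, ?_⟩
    rw [← a2]
    exact (le_abs_self _).trans (coord_le_length a1 j _ (disp_mem_vl _))
  have hsum : Sm φ (TI N v Finset.univ) ≤ ∑ w ∈ Box, Sm φ (BN N w) := by
    calc Sm φ (TI N v Finset.univ) ≤ ∑' γ : ↥(⋃ w ∈ Box, BN N w),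
          expNegE (PotE φ (γ : List (Pt d))) := 
            ENNReal.tsum_mono_subtype (fun γ => expNegE (PotE φ γ)) hsub
      _ ≤ _ := ENNReal.tsum_biUnion_le (fun γ => expNegE (PotE φ γ)) Box (fun w => BN N w)
  rcases Box.eq_empty_or_nonempty with he | hne
  · refine ⟨fun j => |v j|, fun j => le_rfl, ?_⟩
    rw [he, Finset.sum_empty, nonpos_iff_eq_zero] at hsum
    rw [hsum, mul_zero, nonpos_iff_eq_zero] at h1
    rw [h1]; exact zero_le
  · obtain ⟨w, hw, hmax⟩ := Finset.exists_max_image Box (fun w => Sm φ (BN N w)) hne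
    refine ⟨w, fun j => (Finset.mem_Icc.1 (Fintype.mem_piFinset.1 hw j)).1, ?_⟩
    rw [mul_assoc]
    refine h1.trans (mul_le_mul_right ?_ _)
    refine hsum.trans ((Finset.sum_le_card_nsmul _ _ _ hmax).trans ?_)
    rw [nsmul_eq_mul]
    apply mul_le_mul_left
    exact_mod_cast hcard

/-- paths in a half space hitting their endpoint once -/
def Cs (s : ℤˣ) (j : Fin d) (t : Pt d) : Set (List (Pt d)) :=
  {γ | IsPath γ ∧ disp γ = t ∧ (∀ y ∈ vl γ, 0 ≤ (s : ℤ) * y j) ∧ (vl γ).count t = 1}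

/-- weight of a set -/
def SW (φ : ℕ → ℝ≥0∞) (lam : ℝ) (T : Set (List (Pt d))) : ℝ≥0∞ :=
  ∑' γ : T, wE φ lam (γ : List (Pt d))

lemma SW_le_H (φ : ℕ → ℝ≥0∞) (lam : ℝ) (s : ℤˣ) (j : Fin d) (t : Pt d) :
    SW φ lam (Cs s j t) ≤ HEf φ lam t := by
  apply ENNReal.tsum_mono_subtype
  rintro γ ⟨a1, a2, a3, a4⟩
  exact ⟨a1, a2, by rw [locTime_eq, a4]⟩

lemma H_le_D (φ : ℕ → ℝ≥0∞) (lam : ℝ) (t : Pt d) : HEf φ lam t ≤ DEf φ lam t := by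
  apply ENNReal.tsum_mono_subtype
  rintro γ ⟨a1, a2, a3⟩
  exact ⟨a1, a2⟩

lemma unit_sq (s : ℤˣ) : (s : ℤ) * (s : ℤ) = 1 := by
  rw [← Units.val_mul, Int.units_mul_self]; simp

lemma isStep_single (j : Fin d) (s : ℤˣ) : IsStep (Pi.single j (s : ℤ) : Pt d) := by
  unfold IsStep
  rw [Finset.sum_eq_single j]
  · rcases Int.units_eq_one_or s with h | h <;> simp [h]
  · intro b _ hb; simp [hb]
  · simp

lemma glue {φ : ℕ → ℝ≥0∞} (h0 : φ 0 = 0) (lam : ℝ) (N : ℕ) (w : Pt d)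
    (s : ℤˣ) (j : Fin d) (ρ : Fin d → ℤˣ) (hρ : ρ j = s) (t t' : Pt d)
    (ht : t = rf ρ w + Pi.single j (s : ℤ) + t') :
    (ENNReal.ofReal (Real.exp (-(lam * (N + 1)))) * Sm φ (BN N w)) * SW φ lam (Cs s j t') ≤
      SW φ lam (Cs s j t) := by
  have hmem : ∀ u ∈ BN N w, ∀ γ ∈ Cs s j t',
      u.map (rf ρ) ++ Pi.single j (s : ℤ) :: γ ∈ Cs s j t ∧
      PotE φ (u.map (rf ρ) ++ Pi.single j (s : ℤ) :: γ) = PotE φ u + PotE φ γ := by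
    rintro u ⟨a1, a2, a3, a4⟩ γ ⟨b1, b2, b3, b4⟩
    have hw0 : 0 ≤ w j := by
      have := (a4 0 (zero_mem_vl _) j).2; simpa using this
    have hu : ∀ y ∈ vl (u.map (rf ρ)), 0 ≤ (s : ℤ) * y j ∧ (s : ℤ) * y j ≤ w j := by
      intro y hy
      rw [vl_rf, List.mem_map] at hy
      obtain ⟨z, hz, rfl⟩ := hy
      have h1 : (s : ℤ) * rf ρ z j = z j := by
        simp only [rf, hρ]; rw [← mul_assoc, unit_sq, one_mul]
      rw [h1]; exact a4 z hz j
    have hsh : ∀ z : Pt d, (s : ℤ) * (rf ρ w + Pi.single j (s : ℤ) + z : Pt d) j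
        = w j + 1 + s * z j := by
      intro z
      simp only [rf, hρ, Pi.add_apply, Pi.single_eq_same, mul_add, ← mul_assoc, unit_sq, one_mul]
    have hvl : vl (u.map (rf ρ) ++ Pi.single j (s : ℤ) :: γ) = vl (u.map (rf ρ)) ++
        (vl γ).map (fun y => rf ρ w + Pi.single j (s : ℤ) + y) := by
      rw [vl_append_cons, disp_rf, a3]
    refine ⟨⟨?_, ?_, ?_, ?_⟩, ?_⟩
    · rw [isPath_append, isPath_cons]
      exact ⟨isPath_rf _ a1, isStep_single _ _, b1⟩
    · rw [disp_append, disp_cons, disp_rf, a3, b2, ht, add_assoc]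
    · intro y hy
      rw [hvl, List.mem_append, List.mem_map] at hy
      rcases hy with hy | ⟨z, hz, rfl⟩
      · exact (hu y hy).1
      · rw [hsh]
        have := b3 z hz
        omega
    · rw [hvl, List.count_append, List.count_eq_zero_of_not_mem, ht,
        List.count_map_of_injective _ _ (add_right_injective _), b4]
      intro hy
      have h1 := (hu _ hy).2
      rw [ht, hsh] at h1
      have := b3 t' (b2 ▸ disp_mem_vl γ)
      omega
    · rw [PotE_eq, PotE_eq, PotE_eq, hvl, psi_append_disj h0, psi_vl_rf,
        psi_map _ (add_right_injective _)]
      intro y hy hy'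
      rw [List.mem_map] at hy'
      obtain ⟨z, hz, rfl⟩ := hy'
      have h1 := (hu _ hy).2
      rw [hsh] at h1
      have := b3 z hz
      omega
  let F : BN N w × Cs s j t' → Cs s j t := fun p =>
    ⟨p.1.1.map (rf ρ) ++ Pi.single j (s : ℤ) :: p.2.1, (hmem p.1.1 p.1.2 p.2.1 p.2.2).1⟩
  have hF : Function.Injective F := by
    rintro ⟨⟨u, hu⟩, ⟨γ, hγ⟩⟩ ⟨⟨u', hu'⟩, ⟨γ', hγ'⟩⟩ h
    simp only [F, Subtype.mk.injEq] at h
    have := List.append_inj h (by simp [hu.2.1, hu'.2.1])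
    simp only [List.cons.injEq, true_and] at this
    have h2 := (List.map_injective_iff.2 (rf_inj ρ)) this.1
    simp [h2, this.2]
  have e1 : (ENNReal.ofReal (Real.exp (-(lam * (N + 1)))) * Sm φ (BN N w)) * SW φ lam (Cs s j t')
      = ∑' p : BN N w × Cs s j t', wE φ lam (F p : List (Pt d)) := by
    refine Eq.trans ?_ (ENNReal.tsum_prod
      (f := fun (a : BN N w) (b : Cs s j t') => wE φ lam (F (a, b) : List (Pt d)))).symm
    rw [Sm, ← ENNReal.tsum_mul_left, ← ENNReal.tsum_mul_right]
    apply tsum_congr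
    rintro ⟨u, hu⟩
    rw [SW, ← ENNReal.tsum_mul_left]
    apply tsum_congr
    rintro ⟨γ, hγ⟩
    simp only [F, wE]
    rw [(hmem u hu γ hγ).2, expNegE_add]
    have : Real.exp (-(lam * ((u.map (rf ρ) ++ Pi.single j (s : ℤ) :: γ).length : ℝ))) =
        Real.exp (-(lam * (N + 1))) * Real.exp (-(lam * γ.length)) := by
      rw [← Real.exp_add]
      congr 1
      simp only [List.length_append, List.length_map, hu.2.1, List.length_cons]
      push_cast
      ring
    rw [this, ENNReal.ofReal_mul (Real.exp_nonneg _)]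
    ring
  rw [e1]
  exact ENNReal.tsum_comp_le_tsum_of_injective hF (fun γ : Cs s j t => wE φ lam (γ : List (Pt d)))

lemma chain {φ : ℕ → ℝ≥0∞} (h0 : φ 0 = 0) (lam : ℝ) (N : ℕ) (w : Pt d) (hw : ∀ i, 0 ≤ w i)
    (s : ℤˣ) (j : Fin d) (β : ℝ≥0∞)
    (hβ : β ≤ ENNReal.ofReal (Real.exp (-(lam * (N + 1)))) * Sm φ (BN N w)) :
    ∀ (q : ℕ) (t : Pt d), ∃ r : Pt d,
      (s : ℤ) * r j = s * t j - q * (w j + 1) ∧ (∀ i, i ≠ j → |r i| ≤ max (|t i| - q * w i) (w i)) ∧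
      β ^ q * SW φ lam (Cs s j r) ≤ SW φ lam (Cs s j t) := by
  intro q
  induction q with
  | zero => intro t; exact ⟨t, by simp, by simp, by simp⟩
  | succ q ih =>
    intro t
    let ρ : Fin d → ℤˣ := fun i => if i = j then s else if 0 ≤ t i then 1 else -1
    let t' : Pt d := t - rf ρ w - Pi.single j (s : ℤ)
    obtain ⟨r, h1, h2, h3⟩ := ih t'
    refine ⟨r, ?_, ?_, ?_⟩
    · rw [h1]
      simp only [t', ρ, rf, Pi.sub_apply, Pi.single_eq_same, if_true, mul_sub, ← mul_assoc,
        unit_sq]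
      push_cast
      ring
    · intro i hi
      refine (h2 i hi).trans ?_
      have hwi := hw i
      have hq : (0 : ℤ) ≤ q * w i := by positivity
      have ht' : |t' i| = |(|t i| - w i)| := by
        simp only [t', ρ, rf, Pi.sub_apply, Pi.single_eq_of_ne hi, if_neg hi]
        split_ifs with h
        · rw [abs_of_nonneg h]; simp
        · push Not at h
          rw [abs_of_neg h, ← abs_neg]; congr 1; simp; ring
      rw [ht']
      push_cast
      have ha := abs_nonneg (t i)
      rcases le_total (w i) (|t i|) with h | h
      · rw [abs_of_nonneg (by linarith)]
        apply max_le
        · apply le_max_of_le_left; linarith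
        · exact le_max_right _ _
      · rw [abs_of_nonpos (by linarith)]
        apply le_max_of_le_right
        apply max_le <;> linarith
    · have hg := glue h0 lam N w s j ρ (by simp [ρ]) t t' (by simp [t'])
      rw [pow_succ', mul_assoc]
      calc β * (β ^ q * SW φ lam (Cs s j r)) ≤ β * SW φ lam (Cs s j t') := by gcongr
        _ ≤ _ := by gcongr
        _ ≤ _ := hg

lemma staircase (ε : Fin d → ℤˣ) : ∀ (n : ℕ) (t : Pt d), (∑ k, |t k|) = n →
    (∀ k, 0 ≤ (ε k : ℤ) * t k) → ∃ γ : List (Pt d), IsPath γ ∧ γ.length = n ∧ disp γ = t ∧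
      (∀ y ∈ vl γ, ∀ k, 0 ≤ (ε k : ℤ) * y k) ∧ (vl γ).Nodup := by
  intro n
  induction n with
  | zero =>
    intro t ht _
    have : t = 0 := by
      ext k
      have := (Finset.sum_eq_zero_iff_of_nonneg (fun k _ => abs_nonneg (t k))).1 ht k
        (Finset.mem_univ k)
      simpa using this
    subst this
    exact ⟨[], isPath_nil, rfl, disp_nil, by simp [vl], by simp [vl]⟩
  | succ n ih =>
    intro t ht hε
    have : ∃ k, t k ≠ 0 := by
      by_contra hcon
      push Not at hcon
      simp [hcon] at ht
      omega
    obtain ⟨k, hk⟩ := this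
    have habs : ∀ i (z : ℤ), 0 ≤ (ε i : ℤ) * z → |z| = ε i * z := by
      intro i z hz
      rw [← abs_of_nonneg hz]
      rcases Int.units_eq_one_or (ε i) with h | h <;> simp [h]
    have hk1 : 1 ≤ (ε k : ℤ) * t k := by
      rw [← habs k _ (hε k)]; exact Int.one_le_abs hk
    let e : Pt d := Pi.single k (ε k : ℤ)
    have hpos : ∀ i, 0 ≤ (ε i : ℤ) * (t - e) i := by
      intro i
      by_cases hik : i = k
      · subst hik
        simp only [e, Pi.sub_apply, Pi.single_eq_same, mul_sub, unit_sq]; omega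
      · simp only [e, Pi.sub_apply, Pi.single_eq_of_ne hik, sub_zero]; exact hε i
    obtain ⟨γ, a1, a2, a3, a4, a5⟩ := ih (t - e) (by
      have h1 : ∀ i, |(t - e) i| = |t i| - (if i = k then 1 else 0) := by
        intro i
        rw [habs i _ (hpos i), habs i _ (hε i)]
        by_cases hik : i = k
        · subst hik; simp [e, mul_sub, unit_sq]
        · simp [e, hik]
      rw [Finset.sum_congr rfl (fun i _ => h1 i), Finset.sum_sub_distrib, ht]
      simp) hpos
    refine ⟨e :: γ, ?_, by simp [a2], by rw [disp_cons, a3]; simp, ?_, ?_⟩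
    · rw [isPath_cons]; exact ⟨isStep_single _ _, a1⟩
    · intro y hy i
      rw [vl, List.mem_cons, List.mem_map] at hy
      rcases hy with rfl | ⟨z, hz, rfl⟩
      · simp
      · have := a4 z hz i
        by_cases hik : i = k
        · subst hik; simp only [e, Pi.add_apply, Pi.single_eq_same, mul_add, unit_sq]; omega
        · simpa [e, hik] using this
    · rw [vl, List.nodup_cons]
      refine ⟨?_, a5.map (add_right_injective _)⟩
      intro h
      rw [List.mem_map] at h
      obtain ⟨z, hz, hz0⟩ := h
      have := a4 z hz k
      have h2 := congrFun hz0 k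
      simp only [e, Pi.add_apply, Pi.single_eq_same, Pi.zero_apply] at h2
      have h3 : z k = - (ε k : ℤ) := by omega
      rw [h3, mul_neg, unit_sq] at this
      omega

lemma vl_length (γ : List (Pt d)) : (vl γ).length = γ.length + 1 := by
  rw [vl_eq_range]; simp

lemma psi_nodup (φ : ℕ → ℝ≥0∞) (S : List (Pt d)) (h : S.Nodup) :
    Psi φ S = S.length * φ 1 := by
  rw [Psi, Finset.sum_congr rfl (g := fun _ => φ 1), Finset.sum_const,
    List.toFinset_card_of_nodup h, nsmul_eq_mul]
  intro x hx
  rw [List.count_eq_one_of_mem h (List.mem_toFinset.1 hx)]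

lemma base {φ : ℕ → ℝ≥0∞} (h1 : φ 1 ≠ ⊤) (lam : ℝ) (s : ℤˣ) (j : Fin d) (t : Pt d)
    (ht : 0 ≤ (s : ℤ) * t j) :
    ENNReal.ofReal (Real.exp (-((|lam| + (φ 1).toReal) * ((∑ k, |t k| : ℤ) + 1)))) ≤
      SW φ lam (Cs s j t) := by
  let ε : Fin d → ℤˣ := fun i => if i = j then s else if 0 ≤ t i then 1 else -1
  obtain ⟨n, hn⟩ : ∃ n : ℕ, (∑ k, |t k|) = n :=
    Int.eq_ofNat_of_zero_le (Finset.sum_nonneg (fun k _ => abs_nonneg _))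
  obtain ⟨γ, a1, a2, a3, a4, a5⟩ := staircase ε n t hn (by
    intro k
    simp only [ε]
    split_ifs with h h'
    · rw [h]; exact ht
    · simpa using h'
    · simp; omega)
  have hmem : γ ∈ Cs s j t := by
    refine ⟨a1, a3, ?_, ?_⟩
    · intro y hy; have := a4 y hy j; simpa [ε] using this
    · rw [List.count_eq_one_of_mem a5]; rw [← a3]; exact disp_mem_vl _
  refine le_trans ?_ (ENNReal.le_tsum (⟨γ, hmem⟩ : Cs s j t))
  simp only [wE]
  rw [PotE_eq, psi_nodup _ _ a5, vl_length, a2, hn, expNegE, if_neg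
    (ENNReal.mul_ne_top (ENNReal.natCast_ne_top _) h1), ← ENNReal.ofReal_mul (Real.exp_nonneg _),
    ← Real.exp_add]
  apply ENNReal.ofReal_le_ofReal
  apply Real.exp_le_exp.2
  rw [ENNReal.toReal_mul, ENNReal.toReal_natCast]
  push_cast
  have := le_abs_self lam
  have h3 := abs_nonneg lam
  have h4 : (0 : ℝ) ≤ n := by positivity
  nlinarith

end SIRWAux

namespace SIRWAux

variable {d : ℕ}

lemma abstract_lim (f g : ℝ → ℝ) (h1 : ∀ᶠ M in atTop, f M ≤ g M) (h2 : ∀ᶠ M in atTop, -1 ≤ f M)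
    (h3 : ∀ ε > 0, ∀ᶠ M in atTop, ∀ᶠ M' in atTop, g M' ≤ f M + ε) :
    ∃ A : ℝ, Tendsto g atTop (𝓝 A) ∧ Tendsto f atTop (𝓝 A) := by
  let S : Set ℝ := {c | ∀ᶠ M in atTop, c ≤ f M}
  have hne : S.Nonempty := ⟨-1, h2⟩
  have hbdd : BddAbove S := by
    obtain ⟨M, hM⟩ := (h3 1 one_pos).exists
    refine ⟨f M + 1, ?_⟩
    intro c hc
    obtain ⟨M', a1, a2, a3⟩ := (hM.and (h1.and hc)).exists
    linarith
  have hlow : ∀ ε > 0, ∀ᶠ M in atTop, sSup S - ε < f M := by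
    intro ε hε
    obtain ⟨c, hc, hc'⟩ := exists_lt_of_lt_csSup hne (show sSup S - ε < sSup S by linarith)
    filter_upwards [hc] with M hM
    linarith
  have hup : ∀ ε > 0, ∀ᶠ M in atTop, g M < sSup S + ε := by
    intro ε hε
    have hS : sSup S + ε / 2 ∉ S := by
      intro h
      have := le_csSup hbdd h
      linarith
    have hf : ∃ᶠ M in atTop, f M < sSup S + ε / 2 := by
      refine fun h => hS ?_
      change ∀ᶠ M in atTop, _
      filter_upwards [h] with M hM
      exact not_lt.1 hM
    obtain ⟨M, a1, a2⟩ := (hf.and_eventually (h3 (ε / 2) (by linarith))).exists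
    filter_upwards [a2] with M' hM'
    linarith
  refine ⟨sSup S, ?_, ?_⟩
  · rw [Metric.tendsto_nhds]
    intro ε hε
    filter_upwards [hlow ε hε, hup ε hε, h1] with M a1 a2 a3
    rw [Real.dist_eq, abs_lt]; constructor <;> linarith
  · rw [Metric.tendsto_nhds]
    intro ε hε
    filter_upwards [hlow ε hε, hup ε hε, h1] with M a1 a2 a3
    rw [Real.dist_eq, abs_lt]; constructor <;> linarith

lemma pathsN_finite (d n : ℕ) : (PathsN d n).Finite := by
  have hs : {s : Pt d | IsStep s}.Finite := by
    apply (Set.finite_Icc (fun _ => -1 : Pt d) (fun _ => 1)).subset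
    intro s hs
    have : ∀ i, |s i| ≤ 1 := by
      intro i
      rw [← (show (∑ i, |s i|) = 1 from hs)]
      exact Finset.single_le_sum (f := fun i => |s i|) (fun _ _ => abs_nonneg _)
        (Finset.mem_univ i)
    exact ⟨fun i => (abs_le.1 (this i)).1, fun i => (abs_le.1 (this i)).2⟩
  have : Finite {s : Pt d | IsStep s} := hs
  have h2 := List.finite_length_eq {s : Pt d | IsStep s} n
  apply (h2.image (fun l => l.map Subtype.val)).subset
  rintro γ ⟨h3, h4⟩
  lift γ to List {s : Pt d | IsStep s} using h3
  exact ⟨γ, by simpa using h4, rfl⟩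

lemma ZE_ne_top (φ : ℕ → ℝ≥0∞) (n : ℕ) : ZE d φ n ≠ ⊤ := by
  have : Fintype (PathsN d n) := (pathsN_finite d n).fintype
  rw [ZE, tsum_fintype]
  apply ENNReal.sum_ne_top.2
  intro γ _
  exact ne_top_of_le_ne_top ENNReal.one_ne_top (expNegE_le_one _)

lemma Z_bound (φ : ℕ → ℝ≥0∞) (lam0 lam : ℝ) (hl : lam0 < lam)
    (hlam0 : Tendsto (fun n : ℕ => Real.log (ZE d φ n).toReal / n) atTop (𝓝 lam0)) :
    ∃ C > 0, ∃ δ > 0, ∀ n : ℕ, Real.exp (-(lam * n)) * (ZE d φ n).toReal ≤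
      C * Real.exp (-(δ * n)) := by
  let δ := (lam - lam0) / 2
  have hδ : 0 < δ := by simp only [δ]; linarith
  have hev : ∀ᶠ n : ℕ in atTop, Real.log (ZE d φ n).toReal / n < lam - δ :=
    hlam0.eventually_lt_const (by simp only [δ]; linarith)
  obtain ⟨n0, hn0⟩ := eventually_atTop.1 (hev.and (eventually_gt_atTop 0))
  let g : ℕ → ℝ := fun n => Real.exp (-(lam * n)) * (ZE d φ n).toReal * Real.exp (δ * n)
  have hg : ∀ n, 0 ≤ g n := fun n => by positivity
  have hgs : 0 ≤ ∑ n ∈ Finset.range n0, g n := Finset.sum_nonneg (fun n _ => hg n)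
  refine ⟨1 + ∑ n ∈ Finset.range n0, g n, by linarith, δ, hδ, ?_⟩
  intro n
  have key : g n ≤ 1 + ∑ n ∈ Finset.range n0, g n := by
    by_cases hn : n < n0
    · have := Finset.single_le_sum (f := g) (fun n _ => hg n) (Finset.mem_range.2 hn)
      linarith
    · obtain ⟨h1, h2⟩ := hn0 n (not_lt.1 hn)
      have h2' : (0 : ℝ) < n := by exact_mod_cast h2
      rw [div_lt_iff₀ h2'] at h1
      have h3 : (ZE d φ n).toReal ≤ Real.exp ((lam - δ) * n) :=
        (Real.le_exp_log _).trans (Real.exp_le_exp.2 h1.le)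
      have : g n ≤ 1 := by
        calc g n ≤ Real.exp (-(lam * n)) * Real.exp ((lam - δ) * n) * Real.exp (δ * n) := by
              simp only [g]; gcongr
          _ = 1 := by
              rw [← Real.exp_add, ← Real.exp_add, ← Real.exp_zero]; congr 1; ring
      linarith
  calc Real.exp (-(lam * n)) * (ZE d φ n).toReal = g n * Real.exp (-(δ * n)) := by
        simp only [g]; rw [mul_assoc _ (Real.exp (δ * n)), ← Real.exp_add]; simp
    _ ≤ _ := by gcongr

lemma D_le_sum (φ : ℕ → ℝ≥0∞) (lam : ℝ) (v : Pt d) :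
    DEf φ lam v ≤ ∑' N : ℕ, ENNReal.ofReal (Real.exp (-(lam * N))) * Sm φ (TI N v ∅) := by
  have hsub : Dpaths v ⊆ ⋃ N : ℕ, TI N v ∅ := by
    rintro γ ⟨a1, a2⟩
    rw [Set.mem_iUnion]
    exact ⟨γ.length, a1, rfl, by simp, fun j _ => by rw [a2]⟩
  calc DEf φ lam v ≤ ∑' γ : ↥(⋃ N : ℕ, TI N v ∅), wE φ lam (γ : List (Pt d)) :=
        ENNReal.tsum_mono_subtype (wE φ lam) hsub
    _ ≤ ∑' N : ℕ, ∑' γ : TI N v ∅, wE φ lam (γ : List (Pt d)) :=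
        ENNReal.tsum_iUnion_le_tsum (wE φ lam) _
    _ = _ := by
        apply tsum_congr
        intro N
        rw [Sm, ← ENNReal.tsum_mul_left]
        apply tsum_congr
        rintro ⟨γ, hγ⟩
        simp only [wE]
        rw [hγ.2.1, mul_comm]

lemma Sm_le_Z (φ : ℕ → ℝ≥0∞) (N : ℕ) (v : Pt d) : Sm φ (TI N v ∅) ≤ ZE d φ N :=
  ENNReal.tsum_mono_subtype (fun γ => expNegE (PotE φ γ)) (fun _ h => ⟨h.1, h.2.1⟩)

lemma tail_split (b : ℕ → ℝ≥0∞) (C δ : ℝ) (hC : 0 < C) (hδ : 0 < δ)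
    (hb : ∀ N : ℕ, b N ≤ ENNReal.ofReal (C * Real.exp (-(δ * N)))) (L : ℕ) :
    ∑' N, b N ≤ (∑ N ∈ Finset.range L, b N) +
      ENNReal.ofReal (C * (1 - Real.exp (-δ))⁻¹ * Real.exp (-(δ * L))) := by
  have he : Real.exp (-δ) < 1 := by rw [Real.exp_lt_one_iff]; linarith
  have h0 := Summable.sum_add_tsum_nat_add' (f := b) (k := L) ENNReal.summable
  rw [← h0]
  refine add_le_add le_rfl ?_
  have hs : HasSum (fun N : ℕ => C * Real.exp (-(δ * L)) * Real.exp (-δ) ^ N)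
      (C * Real.exp (-(δ * L)) * (1 - Real.exp (-δ))⁻¹) :=
    (hasSum_geometric_of_lt_one (Real.exp_nonneg (-δ)) he).mul_left _
  calc ∑' N : ℕ, b (N + L)
      ≤ ∑' N : ℕ, ENNReal.ofReal (C * Real.exp (-(δ * L)) * Real.exp (-δ) ^ N) := by
        apply ENNReal.tsum_le_tsum
        intro N
        refine (hb (N + L)).trans (le_of_eq ?_)
        congr 1
        rw [← Real.exp_nat_mul, mul_assoc, ← Real.exp_add]
        congr 2
        push_cast; ring
    _ = ENNReal.ofReal (∑' N : ℕ, C * Real.exp (-(δ * L)) * Real.exp (-δ) ^ N) := by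
        rw [ENNReal.ofReal_tsum_of_nonneg (fun N => by positivity) hs.summable]
    _ = _ := by
        rw [hs.tsum_eq]; congr 1; ring

/-- finiteness and tail splitting -/
lemma D_split (φ : ℕ → ℝ≥0∞) (lam0 lam : ℝ) (hl : lam0 < lam)
    (hlam0 : Tendsto (fun n : ℕ => Real.log (ZE d φ n).toReal / n) atTop (𝓝 lam0)) :
    ∃ C > 0, ∃ δ > 0, ∀ (v : Pt d) (L : ℕ), DEf φ lam v ≤
      (∑ N ∈ Finset.range L, ENNReal.ofReal (Real.exp (-(lam * N))) * Sm φ (TI N v ∅)) +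
      ENNReal.ofReal (C * Real.exp (-(δ * L))) := by
  obtain ⟨C, hC, δ, hδ, h⟩ := Z_bound φ lam0 lam hl hlam0
  have he : Real.exp (-δ) < 1 := by rw [Real.exp_lt_one_iff]; linarith
  refine ⟨C * (1 - Real.exp (-δ))⁻¹, mul_pos hC (inv_pos.2 (by linarith)), δ, hδ, ?_⟩
  intro v L
  refine (D_le_sum φ lam v).trans (tail_split _ C δ hC hδ ?_ L)
  intro N
  calc _ ≤ ENNReal.ofReal (Real.exp (-(lam * N))) * ZE d φ N :=
        mul_le_mul_right (Sm_le_Z φ N v) _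
    _ = ENNReal.ofReal (Real.exp (-(lam * N)) * (ZE d φ N).toReal) := by
        rw [ENNReal.ofReal_mul (Real.exp_nonneg _), ENNReal.ofReal_toReal (ZE_ne_top φ N)]
    _ ≤ _ := ENNReal.ofReal_le_ofReal (h N)

lemma D_pick (φ : ℕ → ℝ≥0∞) (lam C δ : ℝ) (v : Pt d) (L : ℕ)
    (h : DEf φ lam v ≤
      (∑ N ∈ Finset.range L, ENNReal.ofReal (Real.exp (-(lam * N))) * Sm φ (TI N v ∅)) +
      ENNReal.ofReal (C * Real.exp (-(δ * L)))) (D : ℝ) (hD : 0 < D)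
    (hDv : ENNReal.ofReal D ≤ DEf φ lam v)
    (hL : C * Real.exp (-(δ * L)) < D / 2) (hC : 0 ≤ C) :
    ∃ N < L, ENNReal.ofReal (D / (2 * L)) ≤
      ENNReal.ofReal (Real.exp (-(lam * N))) * Sm φ (TI N v ∅) := by
  by_contra hcon
  push Not at hcon
  have h1 : (∑ N ∈ Finset.range L, ENNReal.ofReal (Real.exp (-(lam * N))) * Sm φ (TI N v ∅)) ≤
      ENNReal.ofReal (D / 2) := by
    rcases Nat.eq_zero_or_pos L with hz | hz
    · subst hz; simp
    have hz' : (0 : ℝ) < L := by exact_mod_cast hz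
    refine (Finset.sum_le_sum (fun N hN => (hcon N (Finset.mem_range.1 hN)).le)).trans ?_
    rw [Finset.sum_const, Finset.card_range, nsmul_eq_mul, ← ENNReal.ofReal_natCast,
      ← ENNReal.ofReal_mul hz'.le]
    apply ENNReal.ofReal_le_ofReal
    rw [le_iff_lt_or_eq]; right; field_simp
  have h2 : ENNReal.ofReal D ≤ ENNReal.ofReal (D / 2 + C * Real.exp (-(δ * L))) := by
    rw [ENNReal.ofReal_add (by positivity) (by positivity)]
    exact hDv.trans (h.trans (add_le_add h1 le_rfl))
  rw [ENNReal.ofReal_le_ofReal_iff (by positivity)] at h2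
  linarith

end SIRWAux

namespace SIRWAux

variable {d : ℕ}

/-- sign as a unit -/
def sgu (a : ℝ) : ℤˣ := if 0 ≤ a then 1 else -1

lemma flr_facts (M : ℝ) (hM : 0 ≤ M) (x : Fin d → ℝ) (i : Fin d) :
    ((|flr M x i| : ℤ) : ℝ) ≤ M * |x i| + 1 ∧ M * |x i| - 1 ≤ ((|flr M x i| : ℤ) : ℝ) ∧
    0 ≤ (sgu (x i) : ℤ) * flr M x i ∧ (sgu (x i) : ℤ) * flr M x i = |flr M x i| := by
  have h1 := Int.floor_le (M * x i)
  have h2 := Int.lt_floor_add_one (M * x i)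
  by_cases hx : 0 ≤ x i
  · have h0 : 0 ≤ ⌊M * x i⌋ := Int.floor_nonneg.2 (mul_nonneg hM hx)
    simp only [flr, sgu, if_pos hx, abs_of_nonneg hx, abs_of_nonneg h0]
    refine ⟨by linarith, by linarith, by simpa using h0, by simp⟩
  · push Not at hx
    have h0 : ⌊M * x i⌋ ≤ 0 := by
      have : ((⌊M * x i⌋ : ℤ) : ℝ) ≤ 0 := h1.trans (mul_nonpos_of_nonneg_of_nonpos hM hx.le)
      exact_mod_cast this
    simp only [flr, sgu, if_neg (not_le.2 hx), abs_of_neg hx, abs_of_nonpos h0]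
    refine ⟨by push_cast; linarith, by push_cast; linarith, by simpa using h0, by simp⟩

lemma key_box {φ : ℕ → ℝ≥0∞} (h0 : φ 0 = 0) (h1 : φ 1 ≠ ⊤) (lam : ℝ) (x : Fin d → ℝ) (hx : x ≠ 0)
    (M : ℝ) (hM : 0 < M) (N : ℕ) (w : Pt d) (hw : ∀ j, |flr M x j| ≤ w j) (b : ℝ) (hb : 0 ≤ b)
    (hβ : ENNReal.ofReal (Real.exp (-(M * b))) ≤
      ENNReal.ofReal (Real.exp (-(lam * (N + 1)))) * Sm φ (BN N w)) :
    ∃ K : ℝ, ∀ᶠ M' : ℝ in atTop, ENNReal.ofReal (Real.exp (-(M' * b +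
      (|lam| + (φ 1).toReal) * d * (M' / M) + K))) ≤ HEf φ lam (flr M' x) := by
  have hw0 : ∀ i, 0 ≤ w i := fun i => (abs_nonneg _).trans (hw i)
  have hw1 : ∀ i, (0 : ℝ) < w i + 1 := fun i => by
    have : (0 : ℝ) ≤ w i := by exact_mod_cast hw0 i
    linarith
  obtain ⟨i0, hi0⟩ : ∃ i, x i ≠ 0 := by
    by_contra hcon; push Not at hcon; exact hx (funext hcon)
  obtain ⟨j, -, hj⟩ := Finset.exists_max_image Finset.univ (fun i => |x i| / (w i + 1 : ℝ))
    ⟨i0, Finset.mem_univ _⟩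
  have hxj : 0 < |x j| := by
    have a1 := hj i0 (Finset.mem_univ _)
    have a2 : 0 < |x i0| / (w i0 + 1 : ℝ) := div_pos (abs_pos.2 hi0) (hw1 i0)
    by_contra hcon
    have : |x j| = 0 := le_antisymm (not_lt.1 hcon) (abs_nonneg _)
    simp only [this, zero_div] at a1
    linarith
  set C2 := |lam| + (φ 1).toReal with hC2
  have hC20 : 0 ≤ C2 := by positivity
  refine ⟨C2 * ((∑ i, (2 * (w i : ℝ) + 3)) + 1), ?_⟩
  filter_upwards [eventually_ge_atTop (1 / |x j|), eventually_ge_atTop 0] with M' hM' hM'0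
  have hM'x : 1 ≤ M' * |x j| := by rwa [div_le_iff₀ hxj] at hM'
  let q : ℕ := ⌊(M' * |x j| - 1) / (w j + 1 : ℝ)⌋₊
  have hqn : 0 ≤ (M' * |x j| - 1) / (w j + 1 : ℝ) := div_nonneg (by linarith) (hw1 j).le
  have hq1 : (q : ℝ) * (w j + 1) ≤ M' * |x j| - 1 := by
    have := Nat.floor_le hqn
    rwa [le_div_iff₀ (hw1 j)] at this
  have hq2 : M' * |x j| - 1 < (q + 1 : ℝ) * (w j + 1) := by
    have := Nat.lt_floor_add_one ((M' * |x j| - 1) / (w j + 1 : ℝ))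
    rwa [div_lt_iff₀ (hw1 j)] at this
  have hqM : (q : ℝ) * M ≤ M' := by
    have a1 : M * |x j| ≤ w j + 1 := by
      have := (flr_facts M hM.le x j).2.1
      have a3 : ((|flr M x j| : ℤ) : ℝ) ≤ w j := by exact_mod_cast hw j
      linarith
    have a2 : (q : ℝ) * (M * |x j|) ≤ q * (w j + 1) := by gcongr
    have a4 : ((q : ℝ) * M) * |x j| ≤ M' * |x j| := by linarith
    exact le_of_mul_le_mul_right a4 hxj
  have hqi : ∀ i, M' * |x i| - 2 * (w i + 1) ≤ (q : ℝ) * (w i + 1) := by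
    intro i
    have a1 := hj i (Finset.mem_univ i)
    rw [div_le_div_iff₀ (hw1 i) (hw1 j)] at a1
    have a2 : (1 : ℝ) ≤ w j + 1 := by
      have : (0 : ℝ) ≤ w j := by exact_mod_cast hw0 j
      linarith
    have a3 : M' * |x j| ≤ (q + 2 : ℝ) * (w j + 1) := by linarith
    have a4 : M' * (|x i| * (w j + 1)) ≤ M' * (|x j| * (w i + 1)) := by gcongr
    have a5 : M' * |x j| * (w i + 1) ≤ (q + 2 : ℝ) * (w j + 1) * (w i + 1) := by
      have := (hw1 i).le
      gcongr
    have a6 : (M' * |x i|) * (w j + 1) ≤ ((q + 2 : ℝ) * (w i + 1)) * (w j + 1) := by linarith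
    have := le_of_mul_le_mul_right a6 (hw1 j)
    linarith
  set t := flr M' x with ht
  have hf := flr_facts M' hM'0 x
  rw [← ht] at hf
  obtain ⟨r, r1, r2, r3⟩ := chain h0 lam N w hw0 (sgu (x j)) j _ hβ q t
  have hrj : 0 ≤ (sgu (x j) : ℤ) * r j := by
    rw [r1, (hf j).2.2.2]
    have a1 := (hf j).2.1
    have : (0 : ℝ) ≤ ((|t j| - q * (w j + 1) : ℤ) : ℝ) := by push_cast at a1 ⊢; linarith
    exact_mod_cast this
  have hri : ∀ i, ((|r i| : ℤ) : ℝ) ≤ q + (2 * w i + 3) := by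
    intro i
    have b1 := (hf i).1
    have b2 := hqi i
    have b3 : (0 : ℝ) ≤ w i := by exact_mod_cast hw0 i
    have b4 : (0 : ℝ) ≤ q := by positivity
    by_cases hij : i = j
    · subst hij
      have a1 : |r i| = (sgu (x i) : ℤ) * r i := by
        rw [← abs_of_nonneg hrj]
        rcases Int.units_eq_one_or (sgu (x i)) with h | h <;> simp [h]
      rw [a1, r1, (hf i).2.2.2]
      push_cast at b1 ⊢
      linarith
    · have a1 : ((|r i| : ℤ) : ℝ) ≤ ((max (|t i| - q * w i) (w i) : ℤ) : ℝ) := by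
        exact_mod_cast r2 i hij
      refine a1.trans ?_
      rw [Int.cast_max]
      apply max_le
      · push_cast at b1 ⊢; linarith
      · linarith
  have hbase := base h1 lam (sgu (x j)) j r hrj
  refine le_trans ?_ (SW_le_H φ lam (sgu (x j)) j t)
  refine le_trans ?_ r3
  refine le_trans ?_ (mul_le_mul_right hbase _)
  rw [← ENNReal.ofReal_pow (Real.exp_nonneg _), ← ENNReal.ofReal_mul (by positivity),
    ← Real.exp_nat_mul, ← Real.exp_add]
  apply ENNReal.ofReal_le_ofReal
  apply Real.exp_le_exp.2
  have c1 : (q : ℝ) * M * b ≤ M' * b := by gcongr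
  have c2 : ((∑ k, |r k| : ℤ) : ℝ) ≤ d * q + ∑ i, (2 * (w i : ℝ) + 3) := by
    push_cast
    calc ∑ k, |(r k : ℝ)| ≤ ∑ k : Fin d, ((q : ℝ) + (2 * w k + 3)) := by
          apply Finset.sum_le_sum
          intro k _
          have := hri k
          push_cast at this
          exact this
      _ = _ := by rw [Finset.sum_add_distrib]; simp
  have c3 : (q : ℝ) ≤ M' / M := by rwa [le_div_iff₀ hM]
  have c4 : (d : ℝ) * q ≤ d * (M' / M) := by gcongr
  have c5 : C2 * (((∑ k, |r k| : ℤ) : ℝ) + 1) ≤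
      C2 * (d * (M' / M) + ∑ i, (2 * (w i : ℝ) + 3) + 1) := by
    gcongr; linarith
  rw [← hC2]
  linarith

lemma Q_mono {N L : ℕ} (h : N ≤ L) : Q N ≤ Q L := by
  unfold Q
  have : Nat.sqrt (2 * N) ≤ Nat.sqrt (2 * L) := Nat.sqrt_le_sqrt (by omega)
  have h2 : (N + 1) ^ Nat.sqrt (2 * N) ≤ (L + 1) ^ Nat.sqrt (2 * L) :=
    (Nat.pow_le_pow_left (by omega) _).trans (Nat.pow_le_pow_right (by omega) this)
  gcongr

/-- entropy factor -/
def Gf (d L : ℕ) : ℝ := 2 * L * ((Q L : ℝ) ^ d * ((L + 1 : ℕ) : ℝ) ^ d)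

lemma Gf_le (d L : ℕ) : Gf d L ≤ ((L : ℝ) + 2) ^ (2 + d * (2 + 2 * Nat.sqrt (2 * L))) := by
  have hL : (0 : ℝ) ≤ L := by positivity
  set k := Nat.sqrt (2 * L)
  have hQ : (Q L : ℝ) ≤ ((L : ℝ) + 2) ^ (1 + 2 * k) := by
    unfold Q
    push_cast
    calc ((L : ℝ) + 2) * ((L + 1) ^ k * (L + 1) ^ k) ≤
          ((L : ℝ) + 2) * ((L + 2) ^ k * (L + 2) ^ k) := by gcongr <;> norm_num
      _ = _ := by ring
  calc Gf d L ≤ ((L : ℝ) + 2) ^ 2 * ((((L : ℝ) + 2) ^ (1 + 2 * k)) ^ d * ((L : ℝ) + 2) ^ d) := by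
        unfold Gf
        push_cast
        gcongr
        · nlinarith
        · norm_num
    _ = _ := by
        rw [← pow_mul, ← pow_add, ← pow_add]; congr 1; ring

lemma growth (d : ℕ) (c ε : ℝ) (hε : 0 < ε) :
    ∀ᶠ L : ℕ in atTop, Real.log (Gf d L) + c ≤ ε * L := by
  have h1 : ∀ᶠ L : ℕ in atTop, c ≤ ε / 2 * L := by
    have : Tendsto (fun L : ℕ => ε / 2 * (L : ℝ)) atTop atTop :=
      tendsto_natCast_atTop_atTop.const_mul_atTop (by linarith)
    exact this.eventually_ge_atTop c
  have h2 : Tendsto (fun L : ℕ => ((2 + 6 * d : ℝ) * 4) * ((L : ℝ) + 2) ^ (-(1/4) : ℝ)) atTop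
      (𝓝 (((2 + 6 * d : ℝ) * 4) * 0)) := by
    apply Tendsto.const_mul
    apply (tendsto_rpow_neg_atTop (by norm_num : (0 : ℝ) < 1/4)).comp
    exact tendsto_atTop_add_const_right _ _ tendsto_natCast_atTop_atTop
  rw [mul_zero] at h2
  filter_upwards [h1, h2.eventually_lt_const (show (0 : ℝ) < ε / 4 by linarith),
    eventually_ge_atTop 2] with L a1 a2 a3
  have a3' : (2 : ℝ) ≤ L := by exact_mod_cast a3
  set y : ℝ := (L : ℝ) + 2 with hy
  have hy1 : 1 ≤ y := by linarith
  have hy0 : 0 < y := by linarith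
  have hG0 : 0 < Gf d L := by
    unfold Gf Q
    positivity
  have b1 : Real.log (Gf d L) ≤ (2 + d * (2 + 2 * (Nat.sqrt (2 * L) : ℝ))) * Real.log y := by
    refine (Real.log_le_log hG0 (Gf_le d L)).trans ?_
    rw [Real.log_pow]
    push_cast
    exact le_rfl
  have b2 : (Nat.sqrt (2 * L) : ℝ) ≤ 2 * y ^ (1/2 : ℝ) := by
    rw [← Real.sqrt_eq_rpow]
    apply (Real.nat_sqrt_le_real_sqrt).trans
    rw [Real.sqrt_le_left (by positivity), mul_pow, Real.sq_sqrt hy0.le]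
    push_cast; linarith
  have b3 : 1 ≤ y ^ (1/2 : ℝ) := Real.one_le_rpow hy1 (by norm_num)
  have b4 : Real.log y ≤ y ^ (1/4 : ℝ) / (1/4) := Real.log_le_rpow_div hy0.le (by norm_num)
  have b5 : (2 + d * (2 + 2 * (Nat.sqrt (2 * L) : ℝ))) ≤ (2 + 6 * d) * y ^ (1/2 : ℝ) := by
    have hd : (0 : ℝ) ≤ d := by positivity
    have : d * (2 + 2 * (Nat.sqrt (2 * L) : ℝ)) ≤ d * (6 * y ^ (1/2 : ℝ)) := by
      gcongr; linarith
    linarith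
  have b6 : y ^ (1/2 : ℝ) * y ^ (1/4 : ℝ) = y ^ (-(1/4) : ℝ) * y := by
    rw [← Real.rpow_add hy0]
    nth_rewrite 3 [← Real.rpow_one y]
    rw [← Real.rpow_add hy0]; norm_num
  have b7 : (2 + d * (2 + 2 * (Nat.sqrt (2 * L) : ℝ))) * Real.log y ≤
      ((2 + 6 * d) * y ^ (1/2 : ℝ)) * (y ^ (1/4 : ℝ) / (1/4)) :=
    mul_le_mul b5 b4 (Real.log_nonneg hy1) (by positivity)
  have b8 : ((2 + 6 * d) * y ^ (1/2 : ℝ)) * (y ^ (1/4 : ℝ) / (1/4)) =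
      ((2 + 6 * d : ℝ) * 4 * y ^ (-(1/4) : ℝ)) * y := by
    rw [mul_assoc _ (y ^ (-(1/4) : ℝ)) y, ← b6]; ring
  have b9 : ((2 + 6 * d : ℝ) * 4 * y ^ (-(1/4) : ℝ)) * y ≤ ε / 4 * y := by gcongr
  have : ε / 4 * y ≤ ε / 2 * L := by
    rw [hy]; nlinarith
  linarith

end SIRWAux

namespace SIRWAux

variable {d : ℕ}

lemma wE_top {φ : ℕ → ℝ≥0∞} (hm : Monotone φ) (h1 : φ 1 = ⊤) (lam : ℝ) (γ : List (Pt d)) :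
    wE φ lam γ = 0 := by
  have h0 : (0 : Pt d) ∈ visited γ := by
    unfold visited
    rw [Finset.mem_image]
    exact ⟨0, by simp, by simp [pos]⟩
  have hl : 1 ≤ locTime γ (0 : Pt d) := by
    unfold locTime
    rw [Nat.one_le_iff_ne_zero, ← Nat.pos_iff_ne_zero, Finset.card_pos]
    exact ⟨0, Finset.mem_filter.2 ⟨by simp, by simp [pos]⟩⟩
  have h2 : φ (locTime γ (0 : Pt d)) = ⊤ := top_le_iff.1 (h1 ▸ hm hl)
  have : PotE φ γ = ⊤ := by
    unfold PotE
    exact ENNReal.sum_eq_top.2 ⟨0, h0, h2⟩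
  simp [wE, expNegE, this]

lemma key {φ : ℕ → ℝ≥0∞} (h0 : φ 0 = 0) (h1 : φ 1 ≠ ⊤)
    (hR : ∀ l m : ℕ, φ l + φ m ≤ φ (l + m)) (lam C δ : ℝ) (hC : 0 < C) (hδ : 0 < δ)
    (hsp : ∀ (v : Pt d) (L : ℕ), DEf φ lam v ≤
      (∑ N ∈ Finset.range L, ENNReal.ofReal (Real.exp (-(lam * N))) * Sm φ (TI N v ∅)) +
      ENNReal.ofReal (C * Real.exp (-(δ * L)))) (x : Fin d → ℝ) (hx : x ≠ 0)
    (C0 : ℝ) (hC0 : 0 ≤ C0) (a : ℝ → ℝ)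
    (ha : ∀ᶠ M in atTop, ENNReal.ofReal (Real.exp (-(M * a M))) ≤ DEf φ lam (flr M x) ∧ a M ≤ C0)
    (ha2 : ∀ ε > 0, ∀ᶠ M in atTop, -ε ≤ a M) (ε : ℝ) (hε : 0 < ε) :
    ∀ᶠ M in atTop, ∃ K : ℝ, ∀ᶠ M' : ℝ in atTop, ENNReal.ofReal (Real.exp (-(M' * (a M + ε) +
      (|lam| + (φ 1).toReal) * d * (M' / M) + K))) ≤ HEf φ lam (flr M' x) := by
  let κ := (C0 + 1) / δ
  have hκ : 0 < κ := by simp only [κ]; positivity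
  have hLt : Tendsto (fun M : ℝ => ⌈κ * M⌉₊) atTop atTop :=
    tendsto_nat_ceil_atTop.comp (tendsto_id.const_mul_atTop hκ)
  have hg := hLt.eventually (growth d |lam| (ε / (2 * κ)) (by positivity))
  have hexp : ∀ᶠ M : ℝ in atTop, C * Real.exp (-M) < 1 / 2 := by
    have : Tendsto (fun M : ℝ => C * Real.exp (-M)) atTop (𝓝 (C * 0)) :=
      (Real.tendsto_exp_neg_atTop_nhds_zero).const_mul C
    rw [mul_zero] at this
    exact this.eventually_lt_const (by norm_num)
  filter_upwards [ha, ha2 ε hε, hg, hexp, eventually_gt_atTop 0, eventually_ge_atTop (1 / κ)]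
    with M ⟨b1, b2⟩ b3 b4 b5 hM hM2
  set L := ⌈κ * M⌉₊ with hL
  have hM3 : 1 ≤ κ * M := by rwa [div_le_iff₀ hκ, mul_comm] at hM2
  have hL1 : κ * M ≤ L := Nat.le_ceil _
  have hL2 : (L : ℝ) ≤ 2 * (κ * M) := by
    have := Nat.ceil_lt_add_one (show 0 ≤ κ * M by linarith)
    rw [← hL] at this
    linarith
  have hG : Real.log (Gf d L) + |lam| ≤ ε * M := by
    refine b4.trans ?_
    calc ε / (2 * κ) * L ≤ ε / (2 * κ) * (2 * (κ * M)) := by gcongr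
      _ = ε * M := by field_simp
  have htail : C * Real.exp (-(δ * L)) < Real.exp (-(M * a M)) / 2 := by
    have c1 : (C0 + 1) * M ≤ δ * L := by
      calc (C0 + 1) * M = δ * (κ * M) := by simp only [κ]; field_simp
        _ ≤ _ := by gcongr
    have c2 : Real.exp (-(δ * L)) ≤ Real.exp (-M) * Real.exp (-(M * a M)) := by
      rw [← Real.exp_add]
      apply Real.exp_le_exp.2
      have : M * a M ≤ M * C0 := by gcongr
      linarith
    have c3 := Real.exp_pos (-(M * a M))
    calc C * Real.exp (-(δ * L)) ≤ C * (Real.exp (-M) * Real.exp (-(M * a M))) := by gcongr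
      _ = (C * Real.exp (-M)) * Real.exp (-(M * a M)) := by ring
      _ < 1 / 2 * Real.exp (-(M * a M)) := by gcongr
      _ = _ := by ring
  obtain ⟨N, hN, hpick⟩ := D_pick φ lam C δ (flr M x) L (hsp _ L) _ (Real.exp_pos _) b1 htail hC.le
  obtain ⟨w, hw, hbox⟩ := exists_box h0 hR N (flr M x)
  refine key_box h0 h1 lam x hx M hM N w hw (a M + ε) (by linarith) ?_
  have hL0 : 0 < L := by omega
  have hL0' : (0 : ℝ) < L := by exact_mod_cast hL0
  let P : ℝ := (Q L : ℝ) ^ d * ((L + 1 : ℕ) : ℝ) ^ d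
  have hP : 0 < P := by simp only [P, Q]; positivity
  have hGP : Gf d L = 2 * L * P := rfl
  have hG0 : 0 < Gf d L := by rw [hGP]; positivity
  -- combine
  have e1 : ENNReal.ofReal (Real.exp (-(M * a M)) / (2 * L)) ≤
      ENNReal.ofReal P * (ENNReal.ofReal (Real.exp (-(lam * N))) * Sm φ (BN N w)) := by
    refine hpick.trans ((mul_le_mul_right hbox _).trans ?_)
    rw [mul_left_comm]
    refine mul_le_mul_left ?_ _
    simp only [P]
    rw [ENNReal.ofReal_mul (by positivity), ENNReal.ofReal_pow (by positivity),
      ENNReal.ofReal_pow (by positivity), ENNReal.ofReal_natCast, ENNReal.ofReal_natCast]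
    have := Q_mono hN.le
    gcongr
  have e2 : Real.exp (-(M * (a M + ε))) ≤
      Real.exp (-lam) * (P⁻¹ * (Real.exp (-(M * a M)) / (2 * L))) := by
    have f1 : P⁻¹ * (Real.exp (-(M * a M)) / (2 * L)) =
        Real.exp (-(M * a M) - Real.log (Gf d L)) := by
      rw [Real.exp_sub, Real.exp_log hG0, hGP]; field_simp
    rw [f1, ← Real.exp_add]
    apply Real.exp_le_exp.2
    have := le_abs_self lam
    linarith
  calc ENNReal.ofReal (Real.exp (-(M * (a M + ε)))) ≤
        ENNReal.ofReal (Real.exp (-lam) * (P⁻¹ * (Real.exp (-(M * a M)) / (2 * L)))) :=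
        ENNReal.ofReal_le_ofReal e2
    _ = ENNReal.ofReal (Real.exp (-lam)) * (ENNReal.ofReal P⁻¹ *
        ENNReal.ofReal (Real.exp (-(M * a M)) / (2 * L))) := by
        rw [ENNReal.ofReal_mul (Real.exp_nonneg _), ENNReal.ofReal_mul (by positivity)]
    _ ≤ ENNReal.ofReal (Real.exp (-lam)) * (ENNReal.ofReal P⁻¹ *
        (ENNReal.ofReal P * (ENNReal.ofReal (Real.exp (-(lam * N))) * Sm φ (BN N w)))) :=
        mul_le_mul_right (mul_le_mul_right e1 _) _
    _ = _ := by
        rw [← mul_assoc (ENNReal.ofReal P⁻¹), ← ENNReal.ofReal_mul (by positivity),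
          inv_mul_cancel₀ hP.ne', ENNReal.ofReal_one, one_mul, ← mul_assoc,
          ← ENNReal.ofReal_mul (Real.exp_nonneg _), ← Real.exp_add]
        congr 3
        ring

theorem main {φ : ℕ → ℝ≥0∞} (h0 : φ 0 = 0) (hm : Monotone φ)
    (hR : ∀ l m : ℕ, φ l + φ m ≤ φ (l + m)) (lam0 lam : ℝ) (hl : lam0 < lam)
    (hlam0 : Tendsto (fun n : ℕ => Real.log (ZE d φ n).toReal / n) atTop (𝓝 lam0))
    (x : Fin d → ℝ) : ∃ ξx : ℝ,
      Tendsto (fun M : ℝ => -Real.log (HEf φ lam (flr M x)).toReal / M) atTop (𝓝 ξx) ∧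
      Tendsto (fun M : ℝ => -Real.log (DEf φ lam (flr M x)).toReal / M) atTop (𝓝 ξx) := by
  by_cases hx : x = 0
  · have : ∀ M, flr M x = 0 := by
      intro M; subst hx; ext i; simp [flr]
    simp only [this]
    exact ⟨0, tendsto_const_nhds.div_atTop tendsto_id, tendsto_const_nhds.div_atTop tendsto_id⟩
  by_cases h1 : φ 1 = ⊤
  · have e1 : ∀ v : Pt d, HEf φ lam v = 0 := fun v => by simp [HEf, wE_top hm h1]
    have e2 : ∀ v : Pt d, DEf φ lam v = 0 := fun v => by simp [DEf, wE_top hm h1]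
    refine ⟨0, ?_, ?_⟩
    · simp [e1]
    · simp [e2]
  obtain ⟨C, hC, δ, hδ, hsp⟩ := D_split φ lam0 lam hl hlam0
  have hDC : ∀ v : Pt d, DEf φ lam v ≤ ENNReal.ofReal C := by
    intro v; simpa using hsp v 0
  have hDtop : ∀ v : Pt d, DEf φ lam v ≠ ⊤ := fun v =>
    ne_top_of_le_ne_top ENNReal.ofReal_ne_top (hDC v)
  have hHtop : ∀ v : Pt d, HEf φ lam v ≠ ⊤ := fun v =>
    ne_top_of_le_ne_top (hDtop v) (H_le_D φ lam v)
  have hHD : ∀ v : Pt d, (HEf φ lam v).toReal ≤ (DEf φ lam v).toReal := fun v =>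
    ENNReal.toReal_mono (hDtop v) (H_le_D φ lam v)
  obtain ⟨i0, hi0⟩ : ∃ i, x i ≠ 0 := by
    by_contra hcon; push Not at hcon; exact hx (funext hcon)
  set C2 := |lam| + (φ 1).toReal with hC2
  have hC20 : 0 ≤ C2 := by positivity
  set C0 := C2 * (∑ i, (|x i| + 1) + 1) with hC0d
  have hC0 : 0 ≤ C0 := by positivity
  have hlow : ∀ M : ℝ, 1 ≤ M → Real.exp (-(M * C0)) ≤ (HEf φ lam (flr M x)).toReal := by
    intro M hM
    have hb := (base h1 lam (sgu (x i0)) i0 (flr M x)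
      (flr_facts M (by linarith) x i0).2.2.1).trans (SW_le_H φ lam _ _ _)
    rw [ENNReal.ofReal_le_iff_le_toReal (hHtop _)] at hb
    refine le_trans (Real.exp_le_exp.2 ?_) hb
    rw [← hC2, neg_le_neg_iff, hC0d]
    have : ((∑ k, |flr M x k| : ℤ) : ℝ) ≤ M * ∑ i, (|x i| + 1) := by
      rw [Int.cast_sum, Finset.mul_sum]
      apply Finset.sum_le_sum
      intro k _
      have := (flr_facts M (by linarith) x k).1
      linarith
    calc C2 * (((∑ k, |flr M x k| : ℤ) : ℝ) + 1) ≤ C2 * (M * ∑ i, (|x i| + 1) + M * 1) := by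
          gcongr; linarith
      _ = _ := by ring
  have hHpos : ∀ M : ℝ, 1 ≤ M → 0 < (HEf φ lam (flr M x)).toReal := fun M hM =>
    (Real.exp_pos _).trans_le (hlow M hM)
  have hDpos : ∀ M : ℝ, 1 ≤ M → 0 < (DEf φ lam (flr M x)).toReal := fun M hM =>
    (hHpos M hM).trans_le (hHD _)
  set a : ℝ → ℝ := fun M => -Real.log (DEf φ lam (flr M x)).toReal / M with ha
  have hMa : ∀ M : ℝ, 1 ≤ M → Real.exp (-(M * a M)) = (DEf φ lam (flr M x)).toReal := by
    intro M hM
    have : -(M * a M) = Real.log (DEf φ lam (flr M x)).toReal := by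
      simp only [ha]; field_simp
    rw [this, Real.exp_log (hDpos M hM)]
  have ha1 : ∀ᶠ M in atTop, ENNReal.ofReal (Real.exp (-(M * a M))) ≤ DEf φ lam (flr M x) ∧
      a M ≤ C0 := by
    filter_upwards [eventually_ge_atTop 1] with M hM
    constructor
    · rw [hMa M hM, ENNReal.ofReal_toReal (hDtop _)]
    · have := (hlow M hM).trans (hHD _)
      rw [← hMa M hM, Real.exp_le_exp] at this
      have h2 : M * a M ≤ M * C0 := by linarith
      exact le_of_mul_le_mul_left h2 (by linarith)
  have ha2 : ∀ ε > 0, ∀ᶠ M in atTop, -ε ≤ a M := by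
    intro ε hε
    filter_upwards [eventually_ge_atTop 1, eventually_ge_atTop (Real.log C / ε)] with M hM hM2
    have h2 : (DEf φ lam (flr M x)).toReal ≤ C := ENNReal.toReal_le_of_le_ofReal hC.le (hDC _)
    have h3 := Real.log_le_log (hDpos M hM) h2
    simp only [ha]
    rw [le_div_iff₀ (by linarith)]
    rw [div_le_iff₀ hε] at hM2
    linarith
  apply abstract_lim a
  · filter_upwards [eventually_ge_atTop 1] with M hM
    have := Real.log_le_log (hHpos M hM) (hHD (flr M x))
    simp only [ha]
    gcongr
  · exact ha2 1 one_pos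
  · intro ε hε
    have hk := key h0 h1 hR lam C δ hC hδ hsp x hx C0 hC0 a ha1 ha2 (ε / 3) (by linarith)
    filter_upwards [hk, eventually_ge_atTop 1, eventually_ge_atTop (C2 * d / (ε / 3))]
      with M ⟨K, hK⟩ hM hM2
    filter_upwards [hK, eventually_ge_atTop 1, eventually_ge_atTop (K / (ε / 3))] with M' b1 b2 b3
    rw [ENNReal.ofReal_le_iff_le_toReal (hHtop _)] at b1
    have b4 := Real.log_le_log (Real.exp_pos _) b1
    rw [Real.log_exp, ← hC2] at b4
    rw [div_le_iff₀ (by linarith)] at hM2 b3 ⊢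
    have c1 : C2 * d * (M' / M) ≤ M' * (ε / 3) := by
      rw [← mul_div_assoc, div_le_iff₀ (by linarith)]
      have : C2 * d * M' ≤ (M * (ε / 3)) * M' := by gcongr
      linarith
    linarith

end SIRWAux

/-- repulsive case: for every `λ > λ₀` and `x ∈ ℝ^d`, the Lyapunov exponent
`ξ_λ(x) = -lim (1/M) log H_λ(⌊Mx⌋)` exists, and the corresponding limit for `D_λ` exists
and has the same value. -/
theorem stmt7 (d : ℕ) (hd : 1 ≤ d) (φ : ℕ → ℝ≥0∞)
    (hN0 : φ 0 = 0) (hNmono : Monotone φ)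
    (hR : ∀ l m : ℕ, φ l + φ m ≤ φ (l + m))
    (lam0 : ℝ)
    (hlam0 : Filter.Tendsto (fun n : ℕ => Real.log (ZE d φ n).toReal / n) Filter.atTop
      (nhds lam0)) :
    ∀ lam : ℝ, lam0 < lam → ∀ x : Fin d → ℝ, ∃ ξx : ℝ,
      Filter.Tendsto (fun M : ℝ => -Real.log (HEf φ lam (flr M x)).toReal / M)
        Filter.atTop (nhds ξx) ∧
      Filter.Tendsto (fun M : ℝ => -Real.log (DEf φ lam (flr M x)).toReal / M)
        Filter.atTop (nhds ξx) := by
  intro lam hlam x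
  exact SIRWAux.main hN0 hNmono hR lam0 lam hlam hlam0 x
end
end

section
/- Let d ≥ 1 and let φ : ℕ → [0,∞] satisfy φ(0)=0, φ nondecreasing (condition (N)) and the repulsive condition (R): φ(l+m) ≥ φ(l)+φ(m). Then the limiting Lyapunov exponent vanishes identically at the connectivity constant: ξ_{λ₀}(x) := lim_{λ↓λ₀} ξ_λ(x) = 0 for every x ∈ ℝ^d. Equivalently, if there were c > 0 with ξ_λ(x) ≥ c‖x‖ uniformly in λ > λ₀, then Σ_x D_{λ₀}(x) = Σ_n Z_n e^{−λ₀ n} would converge, contradicting Z_n ≥ e^{λ₀ n} (which holds by submultiplicativity in the repulsive case). -/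
open scoped BigOperators ENNReal
open Filter Topology

noncomputable section

namespace SIRW

variable {d : ℕ}

/-! ### Lists of vertices and potentials of lists -/

def pre (γ : List (Pt d)) : List (Pt d) := (List.range γ.length).map (pos γ)

def vs (γ : List (Pt d)) : List (Pt d) := (List.range (γ.length + 1)).map (pos γ)

def Pot {α : Type*} [DecidableEq α] (φ : ℕ → ℝ≥0∞) (L : List α) : ℝ≥0∞ :=
  ∑ x ∈ L.toFinset, φ (L.count x)

lemma vs_eq (γ : List (Pt d)) : vs γ = pre γ ++ [γ.sum] := by
  simp [vs, pre, List.range_succ, pos]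

lemma pos_append_left (a b : List (Pt d)) {k : ℕ} (hk : k ≤ a.length) :
    pos (a ++ b) k = pos a k := by
  simp [pos, List.take_append_of_le_length hk]

lemma pos_append_right (a b : List (Pt d)) (k : ℕ) :
    pos (a ++ b) (a.length + k) = a.sum + pos b k := by
  simp [pos, List.take_append, List.take_of_length_le]

lemma pre_append (a b : List (Pt d)) : pre (a ++ b) = pre a ++ (pre b).map (a.sum + ·) := by
  unfold pre
  rw [List.length_append, List.range_add, List.map_append]
  congr 1
  · apply List.map_congr_left
    intro k hk
    exact pos_append_left a b (List.mem_range.1 hk).le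
  · simp only [List.map_map]
    apply List.map_congr_left
    intro k _
    exact pos_append_right a b k

@[simp] lemma pre_nil : pre ([] : List (Pt d)) = [] := by simp [pre]
@[simp] lemma vs_nil : vs ([] : List (Pt d)) = [0] := by simp [vs, pos]
lemma pre_singleton (s : Pt d) : pre [s] = [0] := by simp [pre, pos]

lemma vs_append (a b : List (Pt d)) : vs (a ++ b) = pre a ++ (vs b).map (a.sum + ·) := by
  simp [vs_eq, pre_append]

lemma pre_snoc (a : List (Pt d)) (s : Pt d) : pre (a ++ [s]) = vs a := by
  simp [pre_append, pre_singleton, vs_eq]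

lemma pre_cons (s : Pt d) (b : List (Pt d)) : pre (s :: b) = 0 :: (pre b).map (s + ·) := by
  have := pre_append [s] b
  simpa [pre_singleton] using this

lemma vs_cons (s : Pt d) (b : List (Pt d)) : vs (s :: b) = 0 :: (vs b).map (s + ·) := by
  have := vs_append [s] b
  simpa [pre_singleton] using this

lemma mem_vs {γ : List (Pt d)} {v : Pt d} : v ∈ vs γ ↔ ∃ k, k ≤ γ.length ∧ pos γ k = v := by
  simp [vs]

lemma mem_pre {γ : List (Pt d)} {v : Pt d} : v ∈ pre γ ↔ ∃ k, k < γ.length ∧ pos γ k = v := by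
  simp [pre]

lemma pre_subset_vs {γ : List (Pt d)} {v : Pt d} (h : v ∈ pre γ) : v ∈ vs γ := by
  rw [vs_eq]; simp [h]

lemma zero_mem_vs (γ : List (Pt d)) : (0 : Pt d) ∈ vs γ :=
  mem_vs.2 ⟨0, Nat.zero_le _, by simp [pos]⟩

lemma sum_mem_vs (γ : List (Pt d)) : γ.sum ∈ vs γ := by rw [vs_eq]; simp

lemma locTime_eq (γ : List (Pt d)) (x : Pt d) : locTime γ x = (vs γ).count x := by
  unfold locTime vs
  rw [List.count, List.countP_map]
  rw [Finset.card_def, Finset.filter_val, Finset.range_val, Multiset.range,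
    Multiset.filter_coe, Multiset.coe_card, ← List.countP_eq_length_filter]
  rfl

lemma visited_eq (γ : List (Pt d)) : visited γ = (vs γ).toFinset := by
  ext v
  simp [visited, mem_vs]

lemma PotE_eq (φ : ℕ → ℝ≥0∞) (γ : List (Pt d)) : PotE φ γ = Pot φ (vs γ) := by
  unfold PotE Pot
  rw [visited_eq]
  exact Finset.sum_congr rfl fun x _ => by rw [locTime_eq]

section pot
variable {α β : Type*} [DecidableEq α] [DecidableEq β] {φ : ℕ → ℝ≥0∞}

lemma Pot_eq_sum (h0 : φ 0 = 0) (L : List α) (S : Finset α) (hS : L.toFinset ⊆ S) :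
    Pot φ L = ∑ x ∈ S, φ (L.count x) := by
  unfold Pot
  apply Finset.sum_subset hS
  intro x _ hx
  rw [List.count_eq_zero_of_not_mem (by simpa using hx), h0]

lemma Pot_append_ge (h0 : φ 0 = 0) (hR : ∀ l m : ℕ, φ l + φ m ≤ φ (l + m)) (L M : List α) :
    Pot φ L + Pot φ M ≤ Pot φ (L ++ M) := by
  rw [Pot_eq_sum h0 L (L ++ M).toFinset (by intro x; simp; tauto),
    Pot_eq_sum h0 M (L ++ M).toFinset (by intro x; simp; tauto), ← Finset.sum_add_distrib]
  unfold Pot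
  apply Finset.sum_le_sum
  intro x _
  rw [List.count_append]
  exact hR _ _

lemma Pot_append_disj (h0 : φ 0 = 0) (L M : List α) (hd : ∀ x ∈ L, x ∉ M) :
    Pot φ (L ++ M) = Pot φ L + Pot φ M := by
  rw [Pot_eq_sum h0 L (L ++ M).toFinset (by intro x; simp; tauto),
    Pot_eq_sum h0 M (L ++ M).toFinset (by intro x; simp; tauto), ← Finset.sum_add_distrib]
  unfold Pot
  apply Finset.sum_congr rfl
  intro x _
  rw [List.count_append]
  by_cases hx : x ∈ L
  · rw [List.count_eq_zero_of_not_mem (hd x hx), h0]; simp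
  · rw [List.count_eq_zero_of_not_mem hx, h0]; simp

lemma Pot_map (f : α → β) (hf : Function.Injective f) (L : List α) :
    Pot φ (L.map f) = Pot φ L := by
  unfold Pot
  have : (L.map f).toFinset = L.toFinset.image f := by ext; simp
  rw [this, Finset.sum_image (fun a _ b _ h => hf h)]
  exact Finset.sum_congr rfl fun x _ => by rw [List.count_map_of_injective _ _ hf]

lemma Pot_reverse (L : List α) : Pot φ L.reverse = Pot φ L := by
  unfold Pot; simp

lemma Pot_singleton (x : α) : Pot φ [x] = φ 1 := by simp [Pot]
lemma Pot_nil : Pot φ ([] : List α) = 0 := by simp [Pot]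

end pot

lemma expNegE_add (a b : ℝ≥0∞) : expNegE (a + b) = expNegE a * expNegE b := by
  unfold expNegE
  by_cases ha : a = ⊤
  · simp [ha]
  by_cases hb : b = ⊤
  · simp [hb]
  simp only [ENNReal.add_eq_top, ha, hb, or_self, if_false]
  rw [ENNReal.toReal_add ha hb, ← ENNReal.ofReal_mul (Real.exp_nonneg _), ← Real.exp_add]
  congr 2; ring

lemma expNegE_anti {a b : ℝ≥0∞} (h : a ≤ b) : expNegE b ≤ expNegE a := by
  obtain ⟨c, rfl⟩ := exists_add_of_le h
  rw [expNegE_add]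
  have : expNegE c ≤ 1 := by
    unfold expNegE
    split_ifs
    · simp
    · rw [← ENNReal.ofReal_one]
      apply ENNReal.ofReal_le_ofReal
      simp
  calc _ ≤ expNegE a * 1 := by gcongr
    _ = _ := by simp

lemma expNegE_zero : expNegE 0 = 1 := by simp [expNegE]

lemma expNegE_le_one (a : ℝ≥0∞) : expNegE a ≤ 1 := by
  rw [← expNegE_zero]; exact expNegE_anti zero_le

lemma expNegE_pos {a : ℝ≥0∞} (h : a ≠ ⊤) : expNegE a ≠ 0 := by
  simp [expNegE, h, Real.exp_pos]

lemma expNegE_ne_top (a : ℝ≥0∞) : expNegE a ≠ ⊤ :=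
  ne_top_of_le_ne_top ENNReal.one_ne_top (expNegE_le_one a)

/-- `e^{-λ n}` -/
def ex (lam : ℝ) (n : ℕ) : ℝ≥0∞ := ENNReal.ofReal (Real.exp (-(lam * n)))

lemma ex_add (lam : ℝ) (m n : ℕ) : ex lam (m + n) = ex lam m * ex lam n := by
  unfold ex
  rw [← ENNReal.ofReal_mul (Real.exp_nonneg _), ← Real.exp_add]
  congr 2; push_cast; ring

lemma ex_zero (lam : ℝ) : ex lam 0 = 1 := by simp [ex]
lemma ex_ne_zero (lam : ℝ) (n : ℕ) : ex lam n ≠ 0 := by simp [ex, Real.exp_pos]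
lemma ex_ne_top (lam : ℝ) (n : ℕ) : ex lam n ≠ ⊤ := by simp [ex]

/-- open weight -/
def wo (φ : ℕ → ℝ≥0∞) (lam : ℝ) (γ : List (Pt d)) : ℝ≥0∞ :=
  expNegE (Pot φ (pre γ)) * ex lam γ.length

lemma wE_eq (φ : ℕ → ℝ≥0∞) (lam : ℝ) (γ : List (Pt d)) :
    wE φ lam γ = expNegE (Pot φ (vs γ)) * ex lam γ.length := by
  rw [wE, PotE_eq]; rfl

lemma add_inj' (a : Pt d) : Function.Injective (a + · : Pt d → Pt d) := fun _ _ h => by simpa using h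

section w
variable {φ : ℕ → ℝ≥0∞} (h0 : φ 0 = 0) (hR : ∀ l m : ℕ, φ l + φ m ≤ φ (l + m)) (lam : ℝ)
include h0

lemma wo_append_disj (a b : List (Pt d)) (hd : ∀ x ∈ pre a, x ∉ (pre b).map (a.sum + ·)) :
    wo φ lam (a ++ b) = wo φ lam a * wo φ lam b := by
  unfold wo
  rw [pre_append, Pot_append_disj h0 _ _ hd, Pot_map _ (add_inj' _), expNegE_add,
    List.length_append, ex_add]
  ring

include hR

lemma wo_append_le (a b : List (Pt d)) : wo φ lam (a ++ b) ≤ wo φ lam a * wo φ lam b := by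
  unfold wo
  calc _ ≤ expNegE (Pot φ (pre a) + Pot φ (pre b)) * ex lam (a ++ b).length := by
        gcongr
        apply expNegE_anti
        rw [pre_append, ← Pot_map (a.sum + ·) (add_inj' _) (pre b)]
        exact Pot_append_ge h0 hR _ _
    _ = _ := by rw [expNegE_add, List.length_append, ex_add]; ring

lemma wE_append_le (a b : List (Pt d)) : wE φ lam (a ++ b) ≤ wo φ lam a * wE φ lam b := by
  rw [wE_eq, wE_eq, wo]
  calc _ ≤ expNegE (Pot φ (pre a) + Pot φ (vs b)) * ex lam (a ++ b).length := by
        gcongr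
        apply expNegE_anti
        rw [vs_append, ← Pot_map (a.sum + ·) (add_inj' _) (vs b)]
        exact Pot_append_ge h0 hR _ _
    _ = _ := by rw [expNegE_add, List.length_append, ex_add]; ring

lemma wE_le_wo (a : List (Pt d)) : wE φ lam a ≤ wo φ lam a := by
  rw [wE_eq, wo]
  gcongr
  apply expNegE_anti
  rw [vs_eq]
  exact le_trans le_self_add (Pot_append_ge h0 hR _ _)

omit hR h0 in
lemma wo_snoc (a : List (Pt d)) (s : Pt d) : wo φ lam (a ++ [s]) = wE φ lam a * ex lam 1 := by
  rw [wo, pre_snoc, wE_eq, List.length_append, ex_add]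
  simp [mul_assoc]

omit hR in
lemma wE_eq_of_not_mem (a : List (Pt d)) (h : a.sum ∉ pre a) :
    wE φ lam a = wo φ lam a * expNegE (φ 1) := by
  rw [wE_eq, wo, vs_eq, Pot_append_disj h0 _ _ (by intro x hx; simp; rintro rfl; exact h hx),
    Pot_singleton, expNegE_add]
  ring

end w

/-- covering lemma for sums -/
lemma tsum_cover {ι κ : Type*} (S : Set ι) (T : Set κ) (F : κ → ι) (f : ι → ℝ≥0∞) (g : κ → ℝ≥0∞)
    (h : ∀ i ∈ S, ∃ k ∈ T, F k = i ∧ f i ≤ g k) : ∑' i : S, f i ≤ ∑' k : T, g k := by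
  have h' : ∀ i : S, ∃ k : T, F k = i ∧ f i ≤ g k := by
    intro i
    obtain ⟨k, hk, h1⟩ := h i i.2
    exact ⟨⟨k, hk⟩, h1⟩
  choose e hG using h'
  calc ∑' i : S, f i ≤ ∑' i : S, g (e i) := ENNReal.tsum_le_tsum fun i => (hG i).2
    _ ≤ ∑' k : T, g k := by
      have he : Function.Injective e := by
        intro i j hij
        apply Subtype.ext
        rw [← (hG i).1, hij, (hG j).1]
      exact ENNReal.tsum_comp_le_tsum_of_injective he (fun k : T => g k)

lemma tsum_prod_set {ι κ : Type*} (S : Set ι) (T : Set κ) (f : ι → ℝ≥0∞) (g : κ → ℝ≥0∞) :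
    ∑' p : (S ×ˢ T : Set (ι × κ)), f p.1.1 * g p.1.2 = (∑' i : S, f i) * ∑' k : T, g k := by
  rw [← (Equiv.Set.prod S T).symm.tsum_eq]
  calc _ = ∑' (i : S) (k : T), f i * g k :=
        ENNReal.tsum_prod (f := fun (i : S) (k : T) => f i * g k)
    _ = _ := by
      rw [← ENNReal.tsum_mul_right]
      congr 1; ext i
      rw [← ENNReal.tsum_mul_left]

/-! ### Partition functions -/

def St (d : ℕ) : Set (Pt d) := {s | IsStep s}
def Pa (d : ℕ) : Set (List (Pt d)) := {γ | IsPath γ}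
def kap (d : ℕ) : ℝ≥0∞ := ∑' _ : St d, 1

lemma isPath_append {a b : List (Pt d)} : IsPath (a ++ b) ↔ IsPath a ∧ IsPath b := by
  simp only [IsPath, List.mem_append]
  constructor
  · intro h; exact ⟨fun s hs => h s (Or.inl hs), fun s hs => h s (Or.inr hs)⟩
  · rintro ⟨h1, h2⟩ s (hs | hs)
    exacts [h1 s hs, h2 s hs]

lemma isPath_nil : IsPath ([] : List (Pt d)) := by simp [IsPath]
lemma isPath_singleton {s : Pt d} : IsPath [s] ↔ IsStep s := by simp [IsPath]
lemma isPath_cons {s : Pt d} {b : List (Pt d)} : IsPath (s :: b) ↔ IsStep s ∧ IsPath b := by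
  simp [IsPath]

lemma St_finite (d : ℕ) : (St d).Finite := by
  apply Set.Finite.subset (Set.finite_Icc (fun _ => -1 : Pt d) (fun _ => 1))
  intro s hs
  have h : ∀ i, |s i| ≤ 1 := by
    intro i
    have : (∑ i, |s i|) = 1 := hs
    rw [← this]
    exact Finset.single_le_sum (f := fun i => |s i|) (fun _ _ => abs_nonneg _) (Finset.mem_univ i)
  exact ⟨fun i => (abs_le.1 (h i)).1, fun i => (abs_le.1 (h i)).2⟩

lemma kap_ne_top (d : ℕ) : kap d ≠ ⊤ := by
  unfold kap
  have := (St_finite d).fintype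
  rw [tsum_fintype]
  simp

lemma PathsN_finite (d n : ℕ) : (PathsN d n).Finite := by
  induction n with
  | zero =>
    apply Set.Finite.subset (Set.finite_singleton ([] : List (Pt d)))
    rintro γ ⟨_, h⟩
    simpa using h
  | succ n ih =>
    apply Set.Finite.subset ((St_finite d).image2 List.cons ih)
    rintro γ ⟨h1, h2⟩
    cases γ with
    | nil => simp at h2
    | cons s b =>
      rw [isPath_cons] at h1
      exact ⟨s, h1.1, b, ⟨h1.2, by simpa using h2⟩, rfl⟩

lemma ZE_ne_top (φ : ℕ → ℝ≥0∞) (n : ℕ) : ZE d φ n ≠ ⊤ := by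
  unfold ZE
  have := (PathsN_finite d n).fintype
  rw [tsum_fintype]
  exact ENNReal.sum_ne_top.2 fun γ _ => expNegE_ne_top _

def chi (d : ℕ) (φ : ℕ → ℝ≥0∞) (lam : ℝ) : ℝ≥0∞ := ∑' γ : Pa d, wE φ lam (γ : List (Pt d))
def chio (d : ℕ) (φ : ℕ → ℝ≥0∞) (lam : ℝ) : ℝ≥0∞ := ∑' γ : Pa d, wo φ lam (γ : List (Pt d))

def lenEquiv (d : ℕ) : (Σ n, PathsN d n) ≃ Pa d where
  toFun p := ⟨p.2.1, p.2.2.1⟩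
  invFun γ := ⟨γ.1.length, γ.1, γ.2, rfl⟩
  left_inv := by rintro ⟨n, γ, h, rfl⟩; rfl
  right_inv _ := rfl

lemma chi_eq (φ : ℕ → ℝ≥0∞) (lam : ℝ) : chi d φ lam = ∑' n, ZE d φ n * ex lam n := by
  unfold chi
  rw [← (lenEquiv d).tsum_eq, ENNReal.tsum_sigma']
  congr 1; ext n
  rw [ZE, ← ENNReal.tsum_mul_right]
  congr 1; ext γ
  obtain ⟨γ, h, rfl⟩ := γ
  rfl

lemma tsum_nil (S : Set (List (Pt d))) (hS : S ⊆ {[]}) (f : List (Pt d) → ℝ≥0∞) :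
    ∑' γ : S, f γ ≤ f [] := by
  calc _ ≤ ∑' γ : ({[]} : Set (List (Pt d))), f γ := ENNReal.tsum_mono_subtype f hS
    _ = f [] := by simp

lemma wo_nil (φ : ℕ → ℝ≥0∞) (lam : ℝ) : wo φ lam ([] : List (Pt d)) = 1 := by
  simp [wo, Pot_nil, expNegE_zero, ex_zero]

lemma wE_nil (φ : ℕ → ℝ≥0∞) (lam : ℝ) : wE φ lam ([] : List (Pt d)) = expNegE (φ 1) := by
  simp [wE_eq, Pot_singleton, ex_zero]

/-- removing a last step -/
lemma tsum_snoc_le (φ : ℕ → ℝ≥0∞) (lam : ℝ) (S T : Set (List (Pt d)))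
    (h : ∀ γ ∈ S, ∃ a ∈ T, ∃ s, IsStep s ∧ γ = a ++ [s]) :
    ∑' γ : S, wo φ lam γ.1 ≤ (∑' γ : T, wE φ lam γ.1) * (kap d * ex lam 1) := by
  calc _ ≤ ∑' p : (T ×ˢ St d : Set (List (Pt d) × Pt d)), wE φ lam p.1.1 * ex lam 1 := by
        apply tsum_cover S (T ×ˢ St d) (fun p => p.1 ++ [p.2]) (wo φ lam)
          (fun p => wE φ lam p.1 * ex lam 1)
        intro γ hγ
        obtain ⟨a, ha, s, hs, rfl⟩ := h γ hγ
        exact ⟨(a, s), ⟨ha, hs⟩, rfl, (wo_snoc lam a s).le⟩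
    _ = _ := by
        have hk : kap d * ex lam 1 = ∑' _ : St d, ex lam 1 := by
          rw [kap, ← ENNReal.tsum_mul_right]; simp
        rw [tsum_prod_set T (St d) (wE φ lam) (fun _ => ex lam 1), hk]

lemma tsum_le_add {ι : Type*} (S A B : Set ι) (h : S ⊆ A ∪ B) (f : ι → ℝ≥0∞) :
    ∑' i : S, f i ≤ ∑' i : A, f i + ∑' i : B, f i :=
  (ENNReal.tsum_mono_subtype f h).trans (ENNReal.tsum_union_le f A B)

lemma chio_le (φ : ℕ → ℝ≥0∞) (lam : ℝ) :
    chio d φ lam ≤ 1 + chi d φ lam * (kap d * ex lam 1) := by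
  unfold chio
  refine (tsum_le_add (Pa d) {[]} {γ | γ ∈ Pa d ∧ γ ≠ []} ?_ (wo φ lam)).trans ?_
  · intro γ hγ
    by_cases h : γ = []
    · left; exact h
    · right; exact ⟨hγ, h⟩
  · gcongr
    · simp [wo_nil]
    · apply tsum_snoc_le
      rintro γ ⟨h1, h2⟩
      obtain ⟨a, s, rfl⟩ := List.eq_nil_or_concat' γ |>.resolve_left h2
      have h1 : IsPath (a ++ [s]) := h1
      rw [isPath_append, isPath_singleton] at h1
      exact ⟨a, h1.1, s, h1.2, rfl⟩

def Zo (d : ℕ) (φ : ℕ → ℝ≥0∞) (n : ℕ) : ℝ≥0∞ := ∑' γ : PathsN d n, wo φ 0 (γ : List (Pt d))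

lemma ex0 (n : ℕ) : ex 0 n = 1 := by simp [ex]

lemma ZE_eq (φ : ℕ → ℝ≥0∞) (n : ℕ) : ZE d φ n = ∑' γ : PathsN d n, wE φ 0 (γ : List (Pt d)) := by
  unfold ZE
  congr 1; ext γ
  rw [wE_eq, ex0, PotE_eq, mul_one]

lemma Zo_succ_le (φ : ℕ → ℝ≥0∞) (n : ℕ) : Zo d φ (n + 1) ≤ ZE d φ n * kap d := by
  rw [ZE_eq]
  refine (tsum_snoc_le φ 0 (PathsN d (n+1)) (PathsN d n) ?_).trans (by simp [ex0])
  rintro γ ⟨h1, h2⟩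
  have h3 : γ ≠ [] := by rintro rfl; simp at h2
  obtain ⟨a, s, rfl⟩ := List.eq_nil_or_concat' γ |>.resolve_left h3
  rw [isPath_append, isPath_singleton] at h1
  exact ⟨a, ⟨h1.1, by simpa using h2⟩, s, h1.2, rfl⟩

lemma Zo_ne_top (φ : ℕ → ℝ≥0∞) (n : ℕ) : Zo d φ n ≠ ⊤ := by
  unfold Zo
  have := (PathsN_finite d n).fintype
  rw [tsum_fintype]
  exact ENNReal.sum_ne_top.2 fun γ _ => ENNReal.mul_ne_top (expNegE_ne_top _) (ex_ne_top _ _)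

section
variable {φ : ℕ → ℝ≥0∞} (h0 : φ 0 = 0) (hR : ∀ l m : ℕ, φ l + φ m ≤ φ (l + m))
include h0 hR

lemma Zo_add_le (m n : ℕ) : Zo d φ (m + n) ≤ Zo d φ m * Zo d φ n := by
  unfold Zo
  rw [← tsum_prod_set]
  apply tsum_cover (PathsN d (m + n)) (PathsN d m ×ˢ PathsN d n) (fun p => p.1 ++ p.2) (wo φ 0)
    (fun p => wo φ 0 p.1 * wo φ 0 p.2)
  rintro γ ⟨h1, h2⟩
  rw [← List.take_append_drop m γ, isPath_append] at h1
  refine ⟨(γ.take m, γ.drop m), ⟨⟨h1.1, by simp; omega⟩, ⟨h1.2, by simp; omega⟩⟩,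
    List.take_append_drop m γ, ?_⟩
  conv_lhs => rw [← List.take_append_drop m γ]
  exact wo_append_le h0 hR 0 _ _

lemma Zo_mul_le (n k : ℕ) : Zo d φ (n * k) ≤ Zo d φ n ^ k := by
  induction k with
  | zero =>
    simp only [mul_zero, pow_zero, Zo]
    refine (tsum_nil _ ?_ _).trans (wo_nil φ 0).le
    rintro γ ⟨_, h⟩
    simpa using h
  | succ k ih =>
    rw [mul_add, mul_one, pow_succ]
    exact (Zo_add_le h0 hR _ _).trans (by gcongr)

lemma ZE_le_Zo (n : ℕ) : ZE d φ n ≤ Zo d φ n := by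
  rw [ZE_eq]
  exact ENNReal.tsum_le_tsum fun γ => wE_le_wo h0 hR 0 _
end

/-- unit vector -/
def e (i : Fin d) : Pt d := Pi.single i 1

lemma isStep_e (i : Fin d) : IsStep (e i) := by
  unfold IsStep e
  rw [Finset.sum_eq_single i]
  · simp
  · intro j _ hj; simp [hj]
  · simp

lemma straight (φ : ℕ → ℝ≥0∞) (h0 : φ 0 = 0) (h1 : φ 1 ≠ ⊤) (i : Fin d) (n : ℕ) :
    (∀ v ∈ vs (List.replicate n (e i)), 0 ≤ v i) ∧ Pot φ (vs (List.replicate n (e i))) ≠ ⊤ := by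
  induction n with
  | zero => simp [Pot_singleton, h1]
  | succ n ih =>
    rw [List.replicate_succ, vs_cons]
    constructor
    · intro v hv
      rw [List.mem_cons, List.mem_map] at hv
      rcases hv with rfl | ⟨u, hu, rfl⟩
      · simp
      · have := ih.1 u hu
        simp [e]; omega
    · have := Pot_append_disj h0 [0] ((vs (List.replicate n (e i))).map (e i + ·)) ?_
      · rw [List.singleton_append] at this
        rw [this, Pot_singleton, Pot_map _ (add_inj' _)]
        exact ENNReal.add_ne_top.2 ⟨h1, ih.2⟩
      · intro x hx hx'
        rw [List.mem_singleton] at hx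
        subst hx
        rw [List.mem_map] at hx'
        obtain ⟨u, hu, h⟩ := hx'
        have h2 := congrFun h i
        have h3 := ih.1 u hu
        simp [e] at h2
        omega

lemma ZE_ne_zero (φ : ℕ → ℝ≥0∞) (h0 : φ 0 = 0) (h1 : φ 1 ≠ ⊤) (i : Fin d) (n : ℕ) :
    ZE d φ n ≠ 0 := by
  intro h
  rw [ZE, ENNReal.tsum_eq_zero] at h
  have := h ⟨List.replicate n (e i), by
    intro s hs
    rw [List.eq_of_mem_replicate hs]
    exact isStep_e i, by simp⟩
  simp only [PotE_eq] at this
  exact expNegE_pos (straight φ h0 h1 i n).2 this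

section
variable {φ : ℕ → ℝ≥0∞} (h0 : φ 0 = 0) (h1 : φ 1 ≠ ⊤) (i : Fin d)
  (lam0 : ℝ)
    (hlam0 : Filter.Tendsto (fun n : ℕ => Real.log (ZE d φ n).toReal / n) Filter.atTop
      (nhds lam0))
include h0 h1 hlam0 i

lemma chi_ne_top (lam : ℝ) (hlam : lam0 < lam) : chi d φ lam ≠ ⊤ := by
  rw [chi_eq]
  obtain ⟨mu, hm1, hm2⟩ := exists_between hlam
  have hev := hlam0.eventually (gt_mem_nhds hm1)
  have hs : Summable (fun n : ℕ => (ZE d φ n).toReal * Real.exp (-(lam * n))) := by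
    have hg : Summable (fun n : ℕ => (Real.exp (-(lam - mu))) ^ n) :=
      summable_geometric_of_lt_one (Real.exp_nonneg _) (by rw [Real.exp_lt_one_iff]; linarith)
    apply Summable.of_norm_bounded_eventually_nat hg
    filter_upwards [hev, eventually_gt_atTop 0] with n hn hn0
    have hz : 0 < (ZE d φ n).toReal := ENNReal.toReal_pos (ZE_ne_zero φ h0 h1 i n) (ZE_ne_top φ n)
    have hn0' : (0:ℝ) < n := by exact_mod_cast hn0
    rw [div_lt_iff₀ hn0', Real.log_lt_iff_lt_exp hz] at hn
    rw [Real.norm_of_nonneg (by positivity), ← Real.exp_nat_mul]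
    calc _ ≤ Real.exp (mu * n) * Real.exp (-(lam * n)) := by gcongr
      _ = _ := by rw [← Real.exp_add]; congr 1; ring
  convert hs.tsum_ofReal_ne_top using 3 with n
  rw [ENNReal.ofReal_mul ENNReal.toReal_nonneg, ENNReal.ofReal_toReal (ZE_ne_top φ n)]
  rfl

lemma Zo_ge (hR : ∀ l m : ℕ, φ l + φ m ≤ φ (l + m)) (n : ℕ) (hn : 0 < n) :
    ENNReal.ofReal (Real.exp (lam0 * n)) ≤ Zo d φ n := by
  have hzo : ∀ n, Zo d φ n ≠ 0 := fun n h =>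
    ZE_ne_zero φ h0 h1 i n (le_antisymm ((ZE_le_Zo h0 hR n).trans h.le) zero_le)
  have hpos : 0 < (Zo d φ n).toReal := ENNReal.toReal_pos (hzo n) (Zo_ne_top φ n)
  have hn' : (0:ℝ) < n := by exact_mod_cast hn
  have hT : Tendsto (fun k : ℕ => n * k) atTop atTop := tendsto_id.const_mul_atTop' hn
  have h2 := hlam0.comp hT
  have h3 : lam0 ≤ Real.log (Zo d φ n).toReal / n := by
    apply le_of_tendsto h2
    filter_upwards [eventually_gt_atTop 0] with k hk
    have hk' : (0:ℝ) < k := by exact_mod_cast hk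
    have h4 : (ZE d φ (n * k)).toReal ≤ (Zo d φ n).toReal ^ k := by
      rw [← ENNReal.toReal_pow]
      exact ENNReal.toReal_mono (ENNReal.pow_ne_top (Zo_ne_top φ n))
        ((ZE_le_Zo h0 hR _).trans (Zo_mul_le h0 hR n k))
    have hz : 0 < (ZE d φ (n * k)).toReal :=
      ENNReal.toReal_pos (ZE_ne_zero φ h0 h1 i _) (ZE_ne_top φ _)
    have h5 := Real.log_le_log hz h4
    rw [Real.log_pow] at h5
    simp only [Function.comp]
    rw [div_le_div_iff₀ (by push_cast; positivity) hn']
    push_cast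
    nlinarith
  rw [le_div_iff₀ hn', Real.le_log_iff_exp_le hpos] at h3
  rw [← ENNReal.ofReal_toReal (Zo_ne_top φ n)]
  exact ENNReal.ofReal_le_ofReal h3

/-- No uniform bound on `chi`. -/
lemma chi_unbounded (hR : ∀ l m : ℕ, φ l + φ m ≤ φ (l + m)) (C : ℝ≥0∞) (hC : C ≠ ⊤)
    (h : ∀ lam, lam0 < lam → lam < lam0 + 1 → chi d φ lam ≤ C) : False := by
  have key : ∀ N : ℕ, 2 ≤ N → (N : ℝ≥0∞) * ENNReal.ofReal (Real.exp (lam0 - 1)) ≤ C * kap d := by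
    intro N hN
    have hN' : (2:ℝ) ≤ N := by exact_mod_cast hN
    have hNi : 0 < (1:ℝ) / N := by positivity
    have hb := h (lam0 + 1 / N) (by linarith) (by
      have : (1:ℝ) / N < 1 := by rw [div_lt_one (by linarith)]; linarith
      linarith)
    rw [chi_eq] at hb
    calc (N : ℝ≥0∞) * ENNReal.ofReal (Real.exp (lam0 - 1))
        = ∑ n ∈ Finset.range N, ENNReal.ofReal (Real.exp (lam0 - 1)) := by simp
      _ ≤ ∑ n ∈ Finset.range N, (ZE d φ n * ex (lam0 + 1 / N) n) * kap d := by
        apply Finset.sum_le_sum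
        intro n hn
        have hn2 : (n : ℝ) ≤ N := by exact_mod_cast (Finset.mem_range.1 hn).le
        have h3 := (Zo_ge h0 h1 i lam0 hlam0 hR (n + 1) (Nat.succ_pos n)).trans (Zo_succ_le φ n)
        calc _ ≤ ENNReal.ofReal (Real.exp (lam0 * (n + 1 : ℕ))) * ex (lam0 + 1 / N) n := by
              unfold ex
              rw [← ENNReal.ofReal_mul (Real.exp_nonneg _), ← Real.exp_add]
              apply ENNReal.ofReal_le_ofReal
              rw [Real.exp_le_exp]
              have : 1 / (N:ℝ) * n ≤ 1 := by rw [one_div_mul_eq_div, div_le_one (by linarith)]; exact hn2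
              push_cast
              nlinarith
          _ ≤ ZE d φ n * kap d * ex (lam0 + 1 / N) n := by gcongr
          _ = _ := by ring
      _ = (∑ n ∈ Finset.range N, (ZE d φ n * ex (lam0 + 1 / N) n)) * kap d := by
        rw [Finset.sum_mul]
      _ ≤ C * kap d := by
        gcongr
        exact (ENNReal.sum_le_tsum _).trans hb
  have hCk : C * kap d ≠ ⊤ := ENNReal.mul_ne_top hC (kap_ne_top d)
  have hpos := Real.exp_pos (lam0 - 1)
  obtain ⟨N, hN⟩ := exists_nat_gt ((C * kap d).toReal / Real.exp (lam0 - 1))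
  have h2 := ENNReal.toReal_mono hCk (key (N + 2) (by omega))
  rw [ENNReal.toReal_mul, ENNReal.toReal_ofReal hpos.le] at h2
  rw [div_lt_iff₀ hpos] at hN
  simp only [ENNReal.toReal_natCast] at h2
  push_cast at h2
  nlinarith
end

/-! ### Splitting of paths, symmetries -/

lemma split_last (γ : List (Pt d)) (p : Pt d → Prop) (h : ∃ v ∈ vs γ, p v) :
    ∃ a b, γ = a ++ b ∧ p a.sum ∧ (b = [] ∨ ∃ s b', b = s :: b' ∧ ∀ v ∈ vs b', ¬ p (a.sum + (s + v))) := by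
  induction γ generalizing p with
  | nil =>
    refine ⟨[], [], rfl, ?_, Or.inl rfl⟩
    obtain ⟨v, hv, hp⟩ := h
    simp at hv
    simpa [hv] using hp
  | cons s γ ih =>
    by_cases h2 : ∃ v ∈ vs γ, p (s + v)
    · obtain ⟨a, b, rfl, hp, hb⟩ := ih (fun v => p (s + v)) h2
      refine ⟨s :: a, b, rfl, by simpa using hp, ?_⟩
      rcases hb with rfl | ⟨t, b', rfl, hb⟩
      · exact Or.inl rfl
      · refine Or.inr ⟨t, b', rfl, ?_⟩
        intro v hv
        have := hb v hv
        simpa [add_assoc] using this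
    · push Not at h2
      refine ⟨[], s :: γ, rfl, ?_, Or.inr ⟨s, γ, rfl, ?_⟩⟩
      · obtain ⟨v, hv, hp⟩ := h
        rw [vs_cons, List.mem_cons, List.mem_map] at hv
        rcases hv with rfl | ⟨u, hu, rfl⟩
        · simpa using hp
        · exact absurd hp (h2 u hu)
      · intro v hv
        simpa using h2 v hv

lemma split_first (γ : List (Pt d)) (p : Pt d → Prop) (h : ∃ v ∈ vs γ, p v) :
    ∃ a b, γ = a ++ b ∧ p a.sum ∧ ∀ v ∈ pre a, ¬ p v := by
  induction γ generalizing p with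
  | nil =>
    refine ⟨[], [], rfl, ?_, by simp⟩
    obtain ⟨v, hv, hp⟩ := h
    simp at hv
    simpa [hv] using hp
  | cons s γ ih =>
    by_cases h0 : p 0
    · exact ⟨[], s :: γ, rfl, by simpa using h0, by simp⟩
    · obtain ⟨v, hv, hp⟩ := h
      rw [vs_cons, List.mem_cons, List.mem_map] at hv
      rcases hv with rfl | ⟨u, hu, rfl⟩
      · exact absurd hp h0
      obtain ⟨a, b, rfl, hp, hb⟩ := ih (fun v => p (s + v)) ⟨u, hu, hp⟩
      refine ⟨s :: a, b, rfl, by simpa using hp, ?_⟩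
      intro v hv
      rw [pre_cons, List.mem_cons, List.mem_map] at hv
      rcases hv with rfl | ⟨u, hu, rfl⟩
      · exact h0
      · exact hb u hu

lemma pos_map (σ : Pt d →+ Pt d) (γ : List (Pt d)) (k : ℕ) : pos (γ.map σ) k = σ (pos γ k) := by
  simp [pos, map_list_sum, List.map_take]

lemma vs_map (σ : Pt d →+ Pt d) (γ : List (Pt d)) : vs (γ.map σ) = (vs γ).map σ := by
  simp only [vs, List.length_map, List.map_map]
  exact List.map_congr_left fun k _ => pos_map σ γ k

lemma pre_map (σ : Pt d →+ Pt d) (γ : List (Pt d)) : pre (γ.map σ) = (pre γ).map σ := by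
  simp only [pre, List.length_map, List.map_map]
  exact List.map_congr_left fun k _ => pos_map σ γ k

lemma wE_map (φ : ℕ → ℝ≥0∞) (lam : ℝ) (σ : Pt d →+ Pt d) (hσ : Function.Injective σ)
    (γ : List (Pt d)) : wE φ lam (γ.map σ) = wE φ lam γ := by
  rw [wE_eq, wE_eq, vs_map, Pot_map _ hσ, List.length_map]

lemma wo_map (φ : ℕ → ℝ≥0∞) (lam : ℝ) (σ : Pt d →+ Pt d) (hσ : Function.Injective σ)
    (γ : List (Pt d)) : wo φ lam (γ.map σ) = wo φ lam γ := by
  rw [wo, wo, pre_map, Pot_map _ hσ, List.length_map]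

def ng : Pt d →+ Pt d := negAddMonoidHom

lemma ng_apply (x : Pt d) : ng x = -x := rfl
lemma ng_inj : Function.Injective (ng : Pt d → Pt d) := neg_injective
lemma ng_ng (γ : List (Pt d)) : (γ.map ng).map ng = γ := by
  rw [List.map_map]
  conv_rhs => rw [← List.map_id γ]
  exact List.map_congr_left fun x _ => by simp [ng_apply]

lemma isStep_neg {s : Pt d} (h : IsStep s) : IsStep (-s) := by
  simpa [IsStep] using h

lemma isPath_map (σ : Pt d →+ Pt d) (hσ : ∀ s, IsStep s → IsStep (σ s)) {γ : List (Pt d)}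
    (h : IsPath γ) : IsPath (γ.map σ) := by
  intro s hs
  rw [List.mem_map] at hs
  obtain ⟨t, ht, rfl⟩ := hs
  exact hσ t (h t ht)

lemma vs_reverse (γ : List (Pt d)) : vs γ.reverse = ((vs γ).map (γ.sum - ·)).reverse := by
  induction γ with
  | nil => simp
  | cons s γ ih =>
    rw [List.reverse_cons, vs_eq (γ.reverse ++ [s]), pre_snoc, ih, vs_cons]
    simp only [List.map_cons, List.reverse_cons, List.map_map, List.sum_cons]
    congr 2
    · congr 1
      funext v
      simp
    · simp [add_comm]

lemma wE_reverse (φ : ℕ → ℝ≥0∞) (lam : ℝ) (γ : List (Pt d)) :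
    wE φ lam γ.reverse = wE φ lam γ := by
  rw [wE_eq, wE_eq, vs_reverse, Pot_reverse, Pot_map, List.length_reverse]
  intro a b h
  simpa using h

lemma step_abs {s : Pt d} (h : IsStep s) (i : Fin d) : |s i| ≤ 1 := by
  have : (∑ i, |s i|) = 1 := h
  rw [← this]
  exact Finset.single_le_sum (f := fun i => |s i|) (fun _ _ => abs_nonneg _) (Finset.mem_univ i)

/-! ### Bridges and half-space walks -/

def Br (i : Fin d) (K : ℕ) : Set (List (Pt d)) :=
  {γ | IsPath γ ∧ (∀ v ∈ pre γ, 0 ≤ v i ∧ v i < K) ∧ γ.sum i = K}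

def Hs (i : Fin d) (A : ℕ) : Set (List (Pt d)) :=
  {γ | IsPath γ ∧ ∀ v ∈ vs γ, 0 ≤ v i ∧ v i ≤ A}

def Hinf (i : Fin d) : Set (List (Pt d)) := {γ | IsPath γ ∧ ∀ v ∈ vs γ, 0 ≤ v i}

def Cb (i : Fin d) (A : ℕ) : Set (List (Pt d)) := {γ | γ ∈ Hs i A ∧ γ.sum i = A}

def bb (φ : ℕ → ℝ≥0∞) (lam : ℝ) (i : Fin d) (K : ℕ) : ℝ≥0∞ := ∑' γ : Br i K, wo φ lam γ.1
def hh (φ : ℕ → ℝ≥0∞) (lam : ℝ) (i : Fin d) (A : ℕ) : ℝ≥0∞ := ∑' γ : Hs i A, wE φ lam γ.1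
def hinf (φ : ℕ → ℝ≥0∞) (lam : ℝ) (i : Fin d) : ℝ≥0∞ := ∑' γ : Hinf i, wE φ lam γ.1

/-- `e^{λ}` -/
def El (lam : ℝ) : ℝ≥0∞ := ENNReal.ofReal (Real.exp lam)

lemma ex_El (lam : ℝ) : ex lam 1 * El lam = 1 := by
  unfold ex El
  rw [← ENNReal.ofReal_mul (Real.exp_nonneg _), ← Real.exp_add]
  simp

lemma Cb_le (φ : ℕ → ℝ≥0∞) (lam : ℝ) (i : Fin d) (A : ℕ) :
    ∑' γ : Cb i A, wE φ lam γ.1 ≤ bb φ lam i (A + 1) * El lam := by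
  unfold bb
  rw [← ENNReal.tsum_mul_right]
  apply tsum_cover (Cb i A) (Br i (A + 1)) List.dropLast (wE φ lam) (fun γ => wo φ lam γ * El lam)
  rintro γ ⟨⟨hp, hv⟩, hs⟩
  refine ⟨γ ++ [e i], ⟨?_, ?_, ?_⟩, by simp, ?_⟩
  · rw [isPath_append, isPath_singleton]; exact ⟨hp, isStep_e i⟩
  · rw [pre_snoc]
    intro v h
    have := hv v h
    push_cast
    omega
  · simp [hs, e]
  · rw [wo_snoc, mul_assoc, ex_El, mul_one]

section
variable {φ : ℕ → ℝ≥0∞} (h0 : φ 0 = 0) (hR : ∀ l m : ℕ, φ l + φ m ≤ φ (l + m)) (lam : ℝ)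
  (i : Fin d)
include h0

lemma bb_mul_le (K L : ℕ) : bb φ lam i K * bb φ lam i L ≤ bb φ lam i (K + L) := by
  unfold bb
  rw [← tsum_prod_set]
  apply tsum_cover (Br i K ×ˢ Br i L) (Br i (K + L))
    (fun γ => (γ.take ((pre γ).countP (fun v : Pt d => decide (v i < (K : ℤ)))),
      γ.drop ((pre γ).countP (fun v : Pt d => decide (v i < (K : ℤ))))))
    (fun p => wo φ lam p.1 * wo φ lam p.2) (wo φ lam)
  rintro ⟨a, b⟩ ⟨⟨ha1, ha2, ha3⟩, ⟨hb1, hb2, hb3⟩⟩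
  simp only at ha1 ha2 ha3 hb1 hb2 hb3
  have hlen : (pre (a ++ b)).countP (fun v : Pt d => decide (v i < (K : ℤ))) = a.length := by
    rw [pre_append, List.countP_append]
    have h1 : (pre a).countP (fun v : Pt d => decide (v i < (K : ℤ))) = a.length := by
      have : (pre a).length = a.length := by simp [pre]
      rw [← this, List.countP_eq_length]
      intro v hv
      simpa using (ha2 v hv).2
    have h2 : ((pre b).map (a.sum + ·)).countP (fun v : Pt d => decide (v i < (K : ℤ))) = 0 := by
      rw [List.countP_eq_zero]
      intro v hv
      rw [List.mem_map] at hv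
      obtain ⟨u, hu, rfl⟩ := hv
      have := (hb2 u hu).1
      simp [ha3]; omega
    omega
  refine ⟨a ++ b, ⟨?_, ?_, ?_⟩, ?_, ?_⟩
  · rw [isPath_append]; exact ⟨ha1, hb1⟩
  · intro v hv
    rw [pre_append, List.mem_append, List.mem_map] at hv
    rcases hv with hv | ⟨u, hu, rfl⟩
    · have := ha2 v hv
      push_cast; omega
    · have := hb2 u hu
      simp [ha3]; omega
  · simp [ha3, hb3]
  · simp only [hlen]
    simp
  · refine (wo_append_disj h0 lam a b ?_).ge
    intro x hx hx'
    rw [List.mem_map] at hx'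
    obtain ⟨u, hu, rfl⟩ := hx'
    have h1 := (ha2 _ hx).2
    have h2 := (hb2 u hu).1
    simp [ha3] at h1
    omega

lemma bb_pow_le (k n : ℕ) : bb φ lam i k ^ n ≤ bb φ lam i (n * k) := by
  induction n with
  | zero =>
    rw [pow_zero, zero_mul, bb]
    have := ENNReal.le_tsum (f := fun γ : Br i 0 => wo φ lam γ.1)
      ⟨[], isPath_nil, by simp, by simp⟩
    simpa only [wo_nil] using this
  | succ n ih =>
    rw [pow_succ, add_mul, one_mul]
    exact le_trans (by gcongr) (bb_mul_le h0 lam i _ _)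

include hR

lemma hh_succ_le (A : ℕ) : hh φ lam i (A + 1) ≤
    hh φ lam i A + (bb φ lam i (A + 2) * El lam + bb φ lam i (A + 2) * (kap d * hh φ lam i A)) := by
  have hcb := Cb_le φ lam i (A + 1)
  let S2 : Set (List (Pt d)) := {γ | γ ∈ Hs i (A + 1) ∧ ∃ (a : List (Pt d)) (s : Pt d) (b : List (Pt d)),
    γ = a ++ s :: b ∧ a.sum i = (A : ℤ) + 1 ∧ ∀ v ∈ vs b, a.sum i + (s i + v i) ≠ (A : ℤ) + 1}
  have hsub : Hs i (A + 1) ⊆ Hs i A ∪ (Cb i (A + 1) ∪ S2) := by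
    intro γ hγ
    by_cases h : ∃ v ∈ vs γ, v i = A + 1
    · right
      obtain ⟨a, b, rfl, hs, hb⟩ := split_last γ _ h
      rcases hb with rfl | ⟨s, b', rfl, hb⟩
      · left
        exact ⟨hγ, by simpa using hs⟩
      · right
        exact ⟨hγ, a, s, b', rfl, hs, fun v hv => by simpa using hb v hv⟩
    · left
      push Not at h
      refine ⟨hγ.1, fun v hv => ?_⟩
      have h1 := hγ.2 v hv
      have h2 := h v hv
      push_cast at h1
      omega
  refine (tsum_le_add _ _ _ hsub _).trans ?_
  refine add_le_add le_rfl ?_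
  refine (ENNReal.tsum_union_le _ _ _).trans ?_
  refine add_le_add hcb ?_
  have hS2 : ∑' γ : S2, wE φ lam γ.1 ≤
      (∑' γ : Cb i (A + 1), wE φ lam γ.1) * ((∑' _ : St d, ex lam 1) * hh φ lam i A) := by
    unfold hh
    rw [← tsum_prod_set (St d) (Hs i A) (fun _ => ex lam 1) (wE φ lam),
      ← tsum_prod_set (Cb i (A + 1)) (St d ×ˢ Hs i A) (wE φ lam)
        (fun p => ex lam 1 * wE φ lam p.2)]
    apply tsum_cover S2 (Cb i (A + 1) ×ˢ (St d ×ˢ Hs i A))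
      (fun p => p.1 ++ p.2.1 :: p.2.2.map ng) (wE φ lam)
      (fun p => wE φ lam p.1 * (ex lam 1 * wE φ lam p.2.2))
    rintro γ ⟨⟨hp, hv⟩, a, s, b, rfl, ha, hb⟩
    rw [isPath_append, isPath_cons] at hp
    obtain ⟨hpa, hps, hpb⟩ := hp
    have hva : ∀ v ∈ vs a, 0 ≤ v i ∧ v i ≤ A + 1 := by
      intro v h
      rw [vs_eq, List.mem_append] at h
      rcases h with h | h
      · have := hv v (by rw [vs_append, List.mem_append]; exact Or.inl h)
        push_cast at this; exact this
      · rw [List.mem_singleton] at h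
        subst h
        omega
    have hvb : ∀ v ∈ vs b, 0 ≤ a.sum i + (s i + v i) ∧ a.sum i + (s i + v i) ≤ A + 1 := by
      intro v h
      have := hv (a.sum + (s + v)) (by
        rw [vs_append, List.mem_append, List.mem_map]
        exact Or.inr ⟨s + v, by rw [vs_cons]; simp [h], rfl⟩)
      push_cast at this; exact this
    have hsi : s i = -1 := by
      have h1 := hvb 0 (zero_mem_vs b)
      have h2 := hb 0 (zero_mem_vs b)
      have h3 := abs_le.1 (step_abs hps i)
      simp at h1 h2
      omega
    refine ⟨(a, s, b.map ng), ⟨⟨⟨hpa, ?_⟩, ?_⟩, hps, isPath_map ng (fun _ => isStep_neg) hpb, ?_⟩, ?_, ?_⟩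
    · push_cast; exact hva
    · push_cast; exact ha
    · intro v h
      rw [vs_map, List.mem_map] at h
      obtain ⟨u, hu, rfl⟩ := h
      have h1 := hvb u hu
      have h2 := hb u hu
      simp only [ng_apply, Pi.neg_apply]
      omega
    · simp only [ng_ng]
    · simp only
      rw [wE_map φ lam ng ng_inj]
      have := wE_append_le h0 hR lam (a ++ [s]) b
      rw [wo_snoc, List.append_assoc, List.singleton_append] at this
      rw [← mul_assoc]
      exact this
  refine hS2.trans ?_
  have hk : (∑' _ : St d, ex lam 1) = kap d * ex lam 1 := by
    rw [kap, ← ENNReal.tsum_mul_right]; simp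
  rw [hk]
  calc _ ≤ (bb φ lam i (A + 1 + 1) * El lam) * (kap d * ex lam 1 * hh φ lam i A) := by gcongr
    _ = bb φ lam i (A + 2) * (kap d * hh φ lam i A) * (ex lam 1 * El lam) := by ring
    _ = _ := by rw [ex_El, mul_one]

lemma chi_le_hinf : chi d φ lam ≤ (1 + hinf φ lam i * (kap d * ex lam 1)) * hinf φ lam i := by
  let Ma : Set (List (Pt d)) := {a | IsPath a ∧ ∀ v ∈ pre a, a.sum i < v i}
  let T : Set (List (Pt d)) := {a | IsPath a ∧ ∀ v ∈ vs a, a.sum i ≤ v i}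
  have h1 : chi d φ lam ≤ (∑' a : Ma, wo φ lam a.1) * hinf φ lam i := by
    unfold chi hinf
    rw [← tsum_prod_set]
    apply tsum_cover (Pa d) (Ma ×ˢ Hinf i) (fun p => p.1 ++ p.2) (wE φ lam)
      (fun p => wo φ lam p.1 * wE φ lam p.2)
    intro γ hγ
    obtain ⟨v0, hv0, hmin⟩ := (vs γ).toFinset.exists_min_image (fun v => v i)
      ⟨0, by simpa using zero_mem_vs γ⟩
    rw [List.mem_toFinset] at hv0
    obtain ⟨a, b, rfl, ha, hpre⟩ := split_first γ (fun v => v i ≤ v0 i) ⟨v0, hv0, le_rfl⟩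
    have hγ : IsPath (a ++ b) := hγ
    rw [isPath_append] at hγ
    refine ⟨(a, b), ⟨⟨hγ.1, ?_⟩, hγ.2, ?_⟩, rfl, wE_append_le h0 hR lam a b⟩
    · intro v hv
      have := hpre v hv
      push Not at this
      exact lt_of_le_of_lt ha this
    · intro v hv
      have := hmin (a.sum + v) (by
        rw [List.mem_toFinset, vs_append, List.mem_append, List.mem_map]
        exact Or.inr ⟨v, hv, rfl⟩)
      simp at this
      omega
  have h2 : ∑' a : T, wE φ lam a.1 ≤ hinf φ lam i := by
    apply tsum_cover T (Hinf i) (fun η => (η.map ng).reverse) (wE φ lam) (wE φ lam)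
    rintro a ⟨ha1, ha2⟩
    refine ⟨(a.reverse).map ng, ⟨?_, ?_⟩, by simp only [ng_ng, List.reverse_reverse], ?_⟩
    · apply isPath_map ng (fun _ => isStep_neg)
      intro s hs
      exact ha1 s (List.mem_reverse.1 hs)
    · intro v hv
      rw [vs_map, vs_reverse, List.mem_map] at hv
      obtain ⟨u, hu, rfl⟩ := hv
      rw [List.mem_reverse, List.mem_map] at hu
      obtain ⟨w, hw, rfl⟩ := hu
      have := ha2 w hw
      simp [ng_apply]
      exact this
    · rw [wE_map φ lam ng ng_inj, wE_reverse]
  have h3 : ∑' a : Ma, wo φ lam a.1 ≤ 1 + hinf φ lam i * (kap d * ex lam 1) := by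
    refine (tsum_le_add Ma {[]} {γ | γ ∈ Ma ∧ γ ≠ []} ?_ (wo φ lam)).trans ?_
    · intro γ hγ
      by_cases h : γ = []
      · left; exact h
      · right; exact ⟨hγ, h⟩
    · gcongr
      · simp [wo_nil]
      · refine (tsum_snoc_le φ lam _ T ?_).trans (by gcongr)
        rintro γ ⟨h1, h2⟩
        obtain ⟨a, s, rfl⟩ := List.eq_nil_or_concat' γ |>.resolve_left h2
        obtain ⟨h1, h3⟩ := h1
        rw [isPath_append, isPath_singleton] at h1
        refine ⟨a, ⟨h1.1, ?_⟩, s, h1.2, rfl⟩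
        intro v hv
        have h4 := h3 v (by rw [pre_snoc]; exact hv)
        have h5 := abs_le.1 (step_abs h1.2 i)
        simp at h4
        omega
  exact h1.trans (by gcongr)

end

lemma hinf_le (φ : ℕ → ℝ≥0∞) (lam : ℝ) (i : Fin d) (C : ℝ≥0∞) (h : ∀ A, hh φ lam i A ≤ C) :
    hinf φ lam i ≤ C := by
  unfold hinf
  rw [ENNReal.tsum_eq_iSup_sum]
  apply iSup_le
  intro s
  have hex : ∃ A : ℕ, ∀ γ ∈ s, γ.1 ∈ Hs i A := by
    have h1 : ∀ γ : Hinf i, ∃ A : ℕ, γ.1 ∈ Hs i A := by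
      intro γ
      obtain ⟨v0, hv0, hmax⟩ := (vs γ.1).toFinset.exists_max_image (fun v => v i)
        ⟨0, by simpa using zero_mem_vs γ.1⟩
      refine ⟨(v0 i).toNat, γ.2.1, fun v hv => ⟨γ.2.2 v hv, ?_⟩⟩
      exact (hmax v (by simpa using hv)).trans (Int.self_le_toNat _)
    choose f hf using h1
    refine ⟨s.sup f, fun γ hγ => ⟨(hf γ).1, fun v hv => ⟨((hf γ).2 v hv).1, ?_⟩⟩⟩
    have := ((hf γ).2 v hv).2
    have h3 : f γ ≤ s.sup f := Finset.le_sup hγ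
    omega
  obtain ⟨A, hA⟩ := hex
  refine le_trans ?_ (h A)
  unfold hh
  rw [← Finset.tsum_subtype s (fun γ : Hinf i => wE φ lam γ.1)]
  let f : s → Hs i A := fun γ => ⟨γ.1.1, hA γ.1 γ.2⟩
  have hf : Function.Injective f := by
    intro a b hab
    apply Subtype.ext
    apply Subtype.ext
    have := congrArg (fun x : Hs i A => x.1) hab
    exact this
  exact ENNReal.tsum_comp_le_tsum_of_injective hf (fun γ : Hs i A => wE φ lam γ.1)

/-! ### Consequence of the Hammersley–Welsh bound -/

section
variable {φ : ℕ → ℝ≥0∞} (h0 : φ 0 = 0) (h1 : φ 1 ≠ ⊤)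
  (hR : ∀ l m : ℕ, φ l + φ m ≤ φ (l + m)) (i : Fin d) (lam0 : ℝ)
    (hlam0 : Filter.Tendsto (fun n : ℕ => Real.log (ZE d φ n).toReal / n) Filter.atTop
      (nhds lam0))
include h0 h1 hR

lemma hh_bound (lam ε : ℝ) (hε : 0 < ε) (h2 : lam < lam0 + 1)
    (hb : ∀ k : ℕ, 1 ≤ k → bb φ lam i k ≤ ex ε k) (A : ℕ) :
    hh φ lam i A ≤ El (lam0 + 1) * ENNReal.ofReal (Real.exp
      ((El (lam0 + 1) * (expNegE (φ 1))⁻¹ + kap d).toReal * (∑ j ∈ Finset.range A, Real.exp (-ε) ^ j))) := by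
  set C := El (lam0 + 1) * (expNegE (φ 1))⁻¹ + kap d with hC
  have hE : El lam ≤ El (lam0 + 1) := by
    unfold El
    exact ENNReal.ofReal_le_ofReal (Real.exp_le_exp.2 h2.le)
  have hCt : C ≠ ⊤ := by
    rw [hC]
    refine ENNReal.add_ne_top.2 ⟨ENNReal.mul_ne_top (by simp [El]) ?_, kap_ne_top d⟩
    exact ENNReal.inv_ne_top.2 (expNegE_pos h1)
  induction A with
  | zero =>
    have hsub : Hs i 0 ⊆ Cb i 0 := by
      intro γ hγ
      refine ⟨hγ, ?_⟩
      have := hγ.2 _ (sum_mem_vs γ)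
      push_cast at *
      omega
    calc hh φ lam i 0 ≤ ∑' γ : Cb i 0, wE φ lam γ.1 := ENNReal.tsum_mono_subtype _ hsub
      _ ≤ bb φ lam i 1 * El lam := Cb_le φ lam i 0
      _ ≤ 1 * El (lam0 + 1) := by
        gcongr
        refine (hb 1 le_rfl).trans ?_
        unfold ex
        rw [← ENNReal.ofReal_one]
        apply ENNReal.ofReal_le_ofReal
        rw [Real.exp_le_one_iff]
        push_cast; linarith
      _ = _ := by simp
  | succ A ih =>
    have hone : 1 ≤ (expNegE (φ 1))⁻¹ * hh φ lam i A := by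
      have h3 : expNegE (φ 1) ≤ hh φ lam i A := by
        rw [← wE_nil (d := d) φ lam]
        exact ENNReal.le_tsum (f := fun γ : Hs i A => wE φ lam γ.1)
          ⟨[], isPath_nil, by simp⟩
      calc (1 : ℝ≥0∞) = (expNegE (φ 1))⁻¹ * expNegE (φ 1) :=
            (ENNReal.inv_mul_cancel (expNegE_pos h1) (expNegE_ne_top _)).symm
        _ ≤ _ := by gcongr
    have hb2 : bb φ lam i (A + 2) ≤ ENNReal.ofReal (Real.exp (-ε) ^ A) := by
      refine (hb (A + 2) (by omega)).trans ?_
      unfold ex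
      apply ENNReal.ofReal_le_ofReal
      rw [← Real.exp_nat_mul, Real.exp_le_exp]
      push_cast; nlinarith
    have hstep : 1 + C * bb φ lam i (A + 2) ≤ ENNReal.ofReal (Real.exp (C.toReal * Real.exp (-ε) ^ A)) := by
      calc _ ≤ 1 + ENNReal.ofReal C.toReal * ENNReal.ofReal (Real.exp (-ε) ^ A) := by
            rw [ENNReal.ofReal_toReal hCt]; gcongr
        _ = ENNReal.ofReal (1 + C.toReal * Real.exp (-ε) ^ A) := by
            rw [ENNReal.ofReal_add zero_le_one (by positivity), ENNReal.ofReal_one,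
              ENNReal.ofReal_mul (by positivity)]
        _ ≤ _ := by
            apply ENNReal.ofReal_le_ofReal
            rw [add_comm]
            exact Real.add_one_le_exp _
    calc hh φ lam i (A + 1) ≤ hh φ lam i A + (bb φ lam i (A + 2) * El lam
          + bb φ lam i (A + 2) * (kap d * hh φ lam i A)) := hh_succ_le h0 hR lam i A
      _ ≤ hh φ lam i A + (bb φ lam i (A + 2) * (El (lam0 + 1) * ((expNegE (φ 1))⁻¹ * hh φ lam i A))
          + bb φ lam i (A + 2) * (kap d * hh φ lam i A)) := by
          gcongr
          calc El lam ≤ El (lam0 + 1) * 1 := by simpa using hE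
            _ ≤ _ := by gcongr
      _ = hh φ lam i A * (1 + C * bb φ lam i (A + 2)) := by rw [hC]; ring
      _ ≤ (El (lam0 + 1) * ENNReal.ofReal (Real.exp
      (C.toReal * (∑ j ∈ Finset.range A, Real.exp (-ε) ^ j)))) *
          ENNReal.ofReal (Real.exp (C.toReal * Real.exp (-ε) ^ A)) := by gcongr
      _ = _ := by
          rw [mul_assoc, ← ENNReal.ofReal_mul (Real.exp_nonneg _), ← Real.exp_add,
            Finset.sum_range_succ, mul_add]

include hlam0

lemma exists_good (ε : ℝ) (hε : 0 < ε) :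
    ∃ lam, lam0 < lam ∧ ∃ k : ℕ, 1 ≤ k ∧ ex ε k ≤ bb φ lam i k := by
  by_contra hcon
  push Not at hcon
  set r := Real.exp (-ε) with hr
  have hr1 : r < 1 := by rw [hr, Real.exp_lt_one_iff]; linarith
  have hr0 : 0 < r := Real.exp_pos _
  set c := (El (lam0 + 1) * (expNegE (φ 1))⁻¹ + kap d).toReal with hc
  set C := El (lam0 + 1) * ENNReal.ofReal (Real.exp (c * (1 - r)⁻¹)) with hC
  have hCt : C ≠ ⊤ := ENNReal.mul_ne_top (by simp [El]) (by simp)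
  apply chi_unbounded h0 h1 i lam0 hlam0 hR ((1 + C * (kap d * El (-lam0))) * C)
  · refine ENNReal.mul_ne_top (ENNReal.add_ne_top.2 ⟨ENNReal.one_ne_top, ?_⟩) hCt
    exact ENNReal.mul_ne_top hCt (ENNReal.mul_ne_top (kap_ne_top d) (by simp [El]))
  · intro lam hl1 hl2
    have hh1 : hinf φ lam i ≤ C := by
      apply hinf_le
      intro A
      refine (hh_bound h0 h1 hR i lam0 lam ε hε hl2 (fun k hk => (hcon lam hl1 k hk).le) A).trans ?_
      rw [hC]
      gcongr
      have hcc : 0 ≤ c := ENNReal.toReal_nonneg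
      rw [← tsum_geometric_of_lt_one hr0.le hr1]
      exact (summable_geometric_of_lt_one hr0.le hr1).sum_le_tsum _ (fun _ _ => by positivity)
    refine (chi_le_hinf h0 hR lam i).trans ?_
    have hexl : ex lam 1 ≤ El (-lam0) := by
      unfold ex El
      apply ENNReal.ofReal_le_ofReal
      rw [Real.exp_le_exp]
      push_cast; linarith
    gcongr
end

/-! ### The two-point function -/

def Go (φ : ℕ → ℝ≥0∞) (lam : ℝ) (x : Pt d) : ℝ≥0∞ := ∑' γ : Dpaths x, wo φ lam γ.1

lemma Go_sym (φ : ℕ → ℝ≥0∞) (lam : ℝ) (σ : Pt d →+ Pt d) (hinv : ∀ x, σ (σ x) = x)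
    (hst : ∀ s, IsStep s → IsStep (σ s)) (x : Pt d) : Go φ lam x ≤ Go φ lam (σ x) := by
  apply tsum_cover (Dpaths x) (Dpaths (σ x)) (fun γ => γ.map σ) (wo φ lam) (wo φ lam)
  rintro γ ⟨hp, hs⟩
  have hinj : Function.Injective σ := fun a b h => by rw [← hinv a, h, hinv]
  refine ⟨γ.map σ, ⟨isPath_map σ hst hp, ?_⟩, ?_, (wo_map φ lam σ hinj γ).ge⟩
  · rw [disp] at *
    rw [← hs, map_list_sum]
  · simp only [List.map_map]
    conv_rhs => rw [← List.map_id γ]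
    exact List.map_congr_left fun x _ => hinv x

lemma Go_le_chio (φ : ℕ → ℝ≥0∞) (lam : ℝ) (x : Pt d) : Go φ lam x ≤ chio d φ lam :=
  ENNReal.tsum_mono_subtype _ fun _ h => h.1

section
variable {φ : ℕ → ℝ≥0∞} (h0 : φ 0 = 0) 
  (hR : ∀ l m : ℕ, φ l + φ m ≤ φ (l + m)) (lam : ℝ)
include h0 hR

lemma Go_mul_le (x y : Pt d) :
    Go φ lam x * Go φ lam y ≤ Go φ lam (x + y) * (chio d φ lam * chio d φ lam) := by
  unfold Go chio
  rw [← tsum_prod_set (Dpaths x), ← tsum_prod_set (Pa d) (Pa d),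
    ← tsum_prod_set (Dpaths (x + y)) (Pa d ×ˢ Pa d) (wo φ lam)
      (fun p => wo φ lam p.1 * wo φ lam p.2)]
  apply tsum_cover (Dpaths x ×ˢ Dpaths y) (Dpaths (x + y) ×ˢ (Pa d ×ˢ Pa d))
    (fun t => (t.1.take ((pre t.1).idxOf (x - t.2.1.sum)) ++ t.2.1,
      t.2.2 ++ t.1.drop ((pre t.1).idxOf (x - t.2.1.sum))))
    (fun p => wo φ lam p.1 * wo φ lam p.2)
    (fun t => wo φ lam t.1 * (wo φ lam t.2.1 * wo φ lam t.2.2))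
  rintro ⟨g1, g2⟩ ⟨⟨hp1, hs1⟩, ⟨hp2, hs2⟩⟩
  simp only [disp] at hp1 hs1 hp2 hs2
  obtain ⟨α, p, rfl, ⟨u, hu, hαu⟩, hα⟩ := split_first g1 (fun v => ∃ u ∈ vs g2, v = x + u)
    ⟨x, by rw [← hs1]; exact sum_mem_vs g1, 0, zero_mem_vs g2, by simp⟩
  obtain ⟨q, β, rfl, hq, -⟩ := split_first g2 (fun v => v = u) ⟨u, hu, rfl⟩
  rw [isPath_append] at hp1 hp2
  rw [List.sum_append] at hs1 hs2
  have hxp : x - p.sum = α.sum := by rw [← hs1]; abel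
  have hna : α.sum ∉ pre α := by
    intro h
    exact hα _ h ⟨u, hu, hαu⟩
  have hidx : (pre (α ++ β)).idxOf (x - p.sum) = α.length := by
    rw [hxp, pre_append, List.idxOf_append_of_notMem hna]
    have h1 : (pre α).length = α.length := by simp [pre]
    rw [h1]
    cases β with
    | nil => simp
    | cons s b => rw [pre_cons]; simp
  refine ⟨(α ++ β, p, q), ⟨⟨isPath_append.2 ⟨hp1.1, hp2.2⟩, ?_⟩, hp1.2, hp2.1⟩, ?_, ?_⟩
  · simp only [disp, List.sum_append]
    rw [hαu, ← hs2, hq]; abel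
  · simp only [hidx]
    simp
  · simp only
    rw [wo_append_disj h0 lam α β]
    · calc _ ≤ (wo φ lam α * wo φ lam p) * (wo φ lam q * wo φ lam β) :=
            mul_le_mul' (wo_append_le h0 hR lam _ _) (wo_append_le h0 hR lam _ _)
        _ = _ := by ring
    · intro v hv hv'
      rw [List.mem_map] at hv'
      obtain ⟨w, hw, rfl⟩ := hv'
      refine hα _ hv ⟨q.sum + w, ?_, ?_⟩
      · rw [vs_append, List.mem_append, List.mem_map]
        exact Or.inr ⟨w, pre_subset_vs hw, rfl⟩
      · rw [hαu, hq]; abel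

lemma Go_le_H (h1 : φ 1 ≠ ⊤) (x : Pt d) :
    Go φ lam x ≤ (HEf φ lam x * (expNegE (φ 1))⁻¹) * chio d φ lam := by
  unfold Go HEf chio
  rw [← ENNReal.tsum_mul_right, ← tsum_prod_set (Hpaths x) (Pa d)
    (fun γ => wE φ lam γ * (expNegE (φ 1))⁻¹)]
  apply tsum_cover (Dpaths x) (Hpaths x ×ˢ Pa d) (fun p => p.1 ++ p.2) (wo φ lam)
    (fun p => wE φ lam p.1 * (expNegE (φ 1))⁻¹ * wo φ lam p.2)
  rintro γ ⟨hp, hs⟩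
  simp only [disp] at hs
  obtain ⟨a, b, rfl, ha, hpre⟩ := split_first γ (fun v => v = x)
    ⟨x, by rw [← hs]; exact sum_mem_vs γ, rfl⟩
  rw [isPath_append] at hp
  have hn : a.sum ∉ pre a := fun h => hpre _ h ha
  refine ⟨(a, b), ⟨⟨hp.1, ha, ?_⟩, hp.2⟩, rfl, ?_⟩
  · rw [locTime_eq, vs_eq, List.count_append, ← ha, List.count_eq_zero_of_not_mem hn]
    simp
  · simp only
    rw [wE_eq_of_not_mem h0 lam a hn, mul_assoc (wo φ lam a),
      ENNReal.mul_inv_cancel (expNegE_pos h1) (expNegE_ne_top _), mul_one]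
    exact wo_append_le h0 hR lam a b

lemma HEf_le_chio (x : Pt d) : HEf φ lam x ≤ chio d φ lam := by
  unfold HEf
  calc _ ≤ ∑' γ : Hpaths x, wo φ lam γ.1 := ENNReal.tsum_le_tsum fun γ => wE_le_wo h0 hR lam _
    _ ≤ _ := ENNReal.tsum_mono_subtype _ fun _ h => h.1
end

lemma Go_e_ne_zero (φ : ℕ → ℝ≥0∞) (h1 : φ 1 ≠ ⊤) (lam : ℝ) (i : Fin d) : Go φ lam (e i) ≠ 0 := by
  intro h
  rw [Go, ENNReal.tsum_eq_zero] at h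
  have := h ⟨[e i], isPath_singleton.2 (isStep_e i), by simp [disp]⟩
  simp only [wo, pre_singleton, Pot_singleton, mul_eq_zero] at this
  exact this.elim (expNegE_pos h1) (ex_ne_zero _ _)

/-! ### Exponential weights on the lattice -/

lemma tsum_pi_prod (f : ℤ → ℝ≥0∞) (d : ℕ) :
    ∑' y : Fin d → ℤ, ∏ j, f (y j) = (∑' n, f n) ^ d := by
  induction d with
  | zero => simp
  | succ d ih =>
    rw [← (Fin.consEquiv (fun _ : Fin (d + 1) => ℤ)).tsum_eq]
    calc _ = ∑' (p : ℤ × (Fin d → ℤ)), f p.1 * ∏ j, f (p.2 j) := by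
          congr 1; ext p
          rw [Fin.prod_univ_succ]
          simp [Fin.consEquiv]
      _ = ∑' (n : ℤ) (y : Fin d → ℤ), f n * ∏ j, f (y j) :=
          ENNReal.tsum_prod (f := fun (n : ℤ) (y : Fin d → ℤ) => f n * ∏ j, f (y j))
      _ = _ := by
          simp_rw [ENNReal.tsum_mul_left, ih, ENNReal.tsum_mul_right]
          ring

def l1 (y : Pt d) : ℝ := ∑ j, |(y j : ℝ)|

lemma tsum_l1 (δ : ℝ) (hδ : 0 < δ) :
    ∑' y : Pt d, ENNReal.ofReal (Real.exp (-(δ * l1 y))) ≠ ⊤ := by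
  have h : ∀ y : Pt d, ENNReal.ofReal (Real.exp (-(δ * l1 y)))
      = ∏ j, ENNReal.ofReal (Real.exp (-(δ * |(y j : ℝ)|))) := by
    intro y
    rw [← ENNReal.ofReal_prod_of_nonneg (fun _ _ => Real.exp_nonneg _), ← Real.exp_sum]
    congr 2
    rw [l1, Finset.mul_sum, Finset.sum_neg_distrib]
  simp_rw [h]
  rw [tsum_pi_prod (fun n : ℤ => ENNReal.ofReal (Real.exp (-(δ * |(n : ℝ)|))))]
  apply ENNReal.pow_ne_top
  apply Summable.tsum_ofReal_ne_top
  have hg : Summable (fun n : ℕ => Real.exp (-δ) ^ n) :=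
      summable_geometric_of_lt_one (Real.exp_nonneg _) (by rw [Real.exp_lt_one_iff]; linarith)
  have hg2 : Summable (fun n : ℕ => Real.exp (-(δ * n))) := by
    convert hg using 2 with n
    rw [← Real.exp_nat_mul]; congr 1; ring
  apply Summable.of_nat_of_neg
  · simpa using hg2
  · simpa using hg2

lemma l1_le_length {γ : List (Pt d)} (h : IsPath γ) : l1 γ.sum ≤ γ.length := by
  induction γ with
  | nil => simp [l1]
  | cons s b ih =>
    rw [isPath_cons] at h
    have h1 := ih h.2
    have h2 : l1 s = 1 := by
      have : (∑ j, |s j|) = 1 := h.1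
      unfold l1
      exact_mod_cast this
    have h3 : l1 (s + b.sum) ≤ l1 s + l1 b.sum := by
      unfold l1
      rw [← Finset.sum_add_distrib]
      apply Finset.sum_le_sum
      intro j _
      simp only [Pi.add_apply, Int.cast_add]
      exact abs_add_le _ _
    rw [List.sum_cons, List.length_cons]
    push_cast
    linarith

lemma Go_le_weight (φ : ℕ → ℝ≥0∞) (lam δ : ℝ) (hδ : 0 < δ) (y : Pt d) :
    Go φ (lam + δ) y ≤ ENNReal.ofReal (Real.exp (-(δ * l1 y))) * Go φ lam y := by
  unfold Go
  rw [← ENNReal.tsum_mul_left]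
  apply ENNReal.tsum_le_tsum
  rintro ⟨γ, hp, hs⟩
  simp only [disp] at hs
  subst hs
  have h1 := l1_le_length hp
  unfold wo ex
  rw [mul_left_comm]
  gcongr
  rw [← ENNReal.ofReal_mul (Real.exp_nonneg _), ← Real.exp_add]
  apply ENNReal.ofReal_le_ofReal
  rw [Real.exp_le_exp]
  nlinarith

/-- reflection of all coordinates but one -/
def refl' (i : Fin d) : Pt d →+ Pt d where
  toFun y := fun j => if j = i then y j else - y j
  map_zero' := by ext j; simp
  map_add' x y := by
    ext j
    simp only [Pi.add_apply]
    split_ifs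
    · rfl
    · ring

lemma refl'_apply (i : Fin d) (y : Pt d) (j : Fin d) :
    refl' i y j = if j = i then y j else - y j := rfl

lemma bb_le_Go (φ : ℕ → ℝ≥0∞) (lam : ℝ) (i : Fin d) (K : ℕ) :
    bb φ lam i K ≤ ∑' y : {y : Pt d | y i = K}, Go φ lam y.1 := by
  unfold bb Go
  rw [← ENNReal.tsum_sigma (f := fun (y : {y : Pt d | y i = K}) (γ : Dpaths y.1) => wo φ lam γ.1)]
  rw [← tsum_univ (fun p : (Σ y : {y : Pt d | y i = K}, Dpaths y.1) => wo φ lam p.2.1)]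
  apply tsum_cover (Br i K) Set.univ
    (fun p : (Σ y : {y : Pt d | y i = K}, Dpaths y.1) => p.2.1) (wo φ lam)
    (fun p => wo φ lam p.2.1)
  rintro γ ⟨hp, -, hs⟩
  exact ⟨⟨⟨γ.sum, hs⟩, ⟨γ, hp, rfl⟩⟩, trivial, rfl, le_rfl⟩

lemma bb_sq_le {φ : ℕ → ℝ≥0∞} (h0 : φ 0 = 0) (hR : ∀ l m : ℕ, φ l + φ m ≤ φ (l + m))
    (lam δ : ℝ) (hδ : 0 < δ) (i : Fin d) (K : ℕ) :
    bb φ (lam + δ) i K ^ 2 ≤ (∑' y : Pt d, ENNReal.ofReal (Real.exp (-(δ * l1 y)))) ^ 2 *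
      (Go φ lam ((2 * K) • e i) * (chio d φ lam * chio d φ lam)) := by
  set X := Go φ lam ((2 * K) • e i) * (chio d φ lam * chio d φ lam) with hX
  have hy : ∀ y : {y : Pt d | y i = K}, Go φ lam y.1 ≤ X ^ (1 / (2:ℝ)) := by
    rintro ⟨y, hy⟩
    rw [one_div, ENNReal.le_rpow_inv_iff (by norm_num)]
    have hsym := Go_sym φ lam (refl' i) (by
      intro x; ext j; simp only [refl'_apply]; split_ifs <;> simp) (by
      intro s hs
      unfold IsStep at *
      rw [← hs]
      apply Finset.sum_congr rfl
      intro j _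
      rw [refl'_apply]; split_ifs <;> simp) y
    have hadd : y + refl' i y = (2 * K) • e i := by
      ext j
      have hy : y i = K := hy
      simp only [Pi.add_apply, refl'_apply, Pi.smul_apply, e]
      by_cases hj : j = i
      · subst hj; simp [hy]; ring
      · simp [hj]
    rw [ENNReal.rpow_two, sq]
    calc _ ≤ Go φ lam y * Go φ lam (refl' i y) := by gcongr
      _ ≤ X := by rw [hX, ← hadd]; exact Go_mul_le h0 hR lam _ _
  have h1 : bb φ (lam + δ) i K ≤
      (∑' y : Pt d, ENNReal.ofReal (Real.exp (-(δ * l1 y)))) * X ^ (1 / (2:ℝ)) := by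
    refine (bb_le_Go φ (lam + δ) i K).trans ?_
    calc _ ≤ ∑' y : {y : Pt d | y i = K},
          ENNReal.ofReal (Real.exp (-(δ * l1 y.1))) * X ^ (1 / (2:ℝ)) := by
          apply ENNReal.tsum_le_tsum
          intro y
          refine (Go_le_weight φ lam δ hδ y.1).trans ?_
          gcongr
          exact hy y
      _ ≤ _ := by
          rw [ENNReal.tsum_mul_right]
          gcongr
          exact ENNReal.tsum_comp_le_tsum_of_injective Subtype.val_injective
            (fun y : Pt d => ENNReal.ofReal (Real.exp (-(δ * l1 y))))
  calc _ ≤ ((∑' y : Pt d, ENNReal.ofReal (Real.exp (-(δ * l1 y)))) * X ^ (1 / (2:ℝ))) ^ 2 := by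
        gcongr
    _ = _ := by
        rw [mul_pow, ← ENNReal.rpow_two (X ^ (1 / (2:ℝ))), ← ENNReal.rpow_mul]
        norm_num

lemma F_bound (F : Pt d → ℝ) (hs : ∀ x y, F (x + y) ≤ F x + F y) (hn : ∀ x, F (-x) ≤ F x)
    (ε : ℝ) (hε : 0 < ε)
    (hi : ∀ i : Fin d, ∃ k : ℕ, 1 ≤ k ∧ ∃ C : ℝ, ∀ n : ℕ,
      F ((2 * (n * k)) • e i) ≤ ε * (2 * (n * k)) + C) :
    ∃ C, ∀ x, F x ≤ ε * l1 x + C := by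
  have hF0 : 0 ≤ F 0 := by have := hs 0 0; simp only [add_zero] at this; linarith
  have hF : ∀ x, 0 ≤ F x := by
    intro x
    have h1 := hs x (-x)
    have h2 := hn x
    rw [add_neg_cancel] at h1
    linarith
  have hr : ∀ (r : ℕ) x, F (r • x) ≤ F 0 + r * F x := by
    intro r x
    induction r with
    | zero => simp
    | succ r ih =>
      rw [succ_nsmul]
      have := hs (r • x) x
      push_cast
      linarith
  have hz : ∀ i : Fin d, ∃ C : ℝ, ∀ z : ℤ, F (z • e i) ≤ ε * |(z : ℝ)| + C := by
    intro i
    obtain ⟨k, hk, C, hC⟩ := hi i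
    have hm : ∀ m : ℕ, F (m • e i) ≤ ε * m + (C + F 0 + (2 * k) * F (e i)) := by
      intro m
      have hdm : 2 * ((m / (2 * k)) * k) + m % (2 * k) = m := by
        have := Nat.div_add_mod m (2 * k)
        nlinarith
      have hlt : m % (2 * k) < 2 * k := Nat.mod_lt _ (by omega)
      generalize m / (2 * k) = q at *
      generalize m % (2 * k) = r at *
      have h1 := hs ((2 * (q * k)) • e i) (r • e i)
      rw [← add_nsmul, hdm] at h1
      have h2 := hC q
      have h3 := hr r (e i)
      have h4 : (r : ℝ) ≤ 2 * k := by exact_mod_cast hlt.le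
      have h5 : (2 * (q * k) : ℝ) ≤ m := by exact_mod_cast (by omega)
      have h6 := mul_le_mul_of_nonneg_right h4 (hF (e i))
      have h7 := mul_le_mul_of_nonneg_left h5 hε.le
      linarith
    refine ⟨C + F 0 + (2 * k) * F (e i), fun z => ?_⟩
    obtain ⟨m, rfl | rfl⟩ := z.eq_nat_or_neg
    · simpa using hm m
    · rw [neg_smul]
      refine (hn _).trans ?_
      simpa using hm m
  choose C hC using hz
  refine ⟨F 0 + ∑ i, C i, fun x => ?_⟩
  have hsum : ∀ s : Finset (Fin d), F (∑ i ∈ s, x i • e i) ≤ F 0 + ∑ i ∈ s, F (x i • e i) := by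
    intro s
    induction s using Finset.induction_on with
    | empty => simp
    | insert a s ha ih =>
      rw [Finset.sum_insert ha, Finset.sum_insert ha]
      have := hs (x a • e a) (∑ i ∈ s, x i • e i)
      linarith
  have hx : ∑ i, x i • e i = x := by
    ext j
    simp [Finset.sum_apply, e, Pi.single_apply]
  have h := hsum Finset.univ
  rw [hx] at h
  have h2 : ∑ i, F (x i • e i) ≤ ∑ i, (ε * |(x i : ℝ)| + C i) :=
    Finset.sum_le_sum fun i _ => hC i (x i)
  rw [Finset.sum_add_distrib, ← Finset.mul_sum] at h2
  unfold l1
  linarith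

lemma HEf_eq_zero {φ : ℕ → ℝ≥0∞} (hm : Monotone φ) (h1 : φ 1 = ⊤) (lam : ℝ) (x : Pt d) :
    HEf φ lam x = 0 := by
  unfold HEf
  rw [ENNReal.tsum_eq_zero]
  intro γ
  have hP : PotE φ γ.1 = ⊤ := by
    rw [PotE_eq, Pot, ENNReal.sum_eq_top]
    refine ⟨0, List.mem_toFinset.2 (zero_mem_vs _), ?_⟩
    have : φ 1 ≤ φ ((vs γ.1).count 0) := hm (List.count_pos_iff.2 (zero_mem_vs _))
    rw [h1] at this
    exact top_le_iff.1 this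
  simp [wE, hP, expNegE]

section fin
variable {φ : ℕ → ℝ≥0∞} (h0 : φ 0 = 0) (h1 : φ 1 ≠ ⊤)
  (hR : ∀ l m : ℕ, φ l + φ m ≤ φ (l + m))

include h0 hR h1

lemma Go_pos (i : Fin d) (lam : ℝ) (hc : chio d φ lam ≠ ⊤) (x : Pt d) : Go φ lam x ≠ 0 := by
  have hmul : ∀ x y : Pt d, Go φ lam x ≠ 0 → Go φ lam y ≠ 0 → Go φ lam (x + y) ≠ 0 := by
    intro x y hx hy h
    have := Go_mul_le h0 hR lam x y
    rw [h, zero_mul] at this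
    exact (mul_ne_zero hx hy) (le_zero_iff.1 this)
  have hneg : ∀ x : Pt d, Go φ lam x ≠ 0 → Go φ lam (-x) ≠ 0 := by
    intro x hx h
    have := Go_sym φ lam ng (fun x => by simp [ng_apply]) (fun s hs => isStep_neg hs) x
    rw [ng_apply, h] at this
    exact hx (le_zero_iff.1 this)
  have hz : Go φ lam (0 : Pt d) ≠ 0 := by
    have := hmul (e i) (-e i) (Go_e_ne_zero φ h1 lam i) (hneg _ (Go_e_ne_zero φ h1 lam i))
    rwa [add_neg_cancel] at this
  have hn : ∀ (j : Fin d) (m : ℕ), Go φ lam (m • e j) ≠ 0 := by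
    intro j m
    induction m with
    | zero => simpa using hz
    | succ m ih => rw [succ_nsmul]; exact hmul _ _ ih (Go_e_ne_zero φ h1 lam j)
  have hzz : ∀ (j : Fin d) (m : ℤ), Go φ lam (m • e j) ≠ 0 := by
    intro j m
    obtain ⟨m, rfl | rfl⟩ := m.eq_nat_or_neg
    · simpa using hn j m
    · rw [neg_smul]; apply hneg; simpa using hn j m
  have hsum : ∀ s : Finset (Fin d), Go φ lam (∑ i ∈ s, x i • e i) ≠ 0 := by
    intro s
    induction s using Finset.induction_on with
    | empty => simpa using hz
    | insert a s ha ih =>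
      rw [Finset.sum_insert ha]
      exact hmul _ _ (hzz _ _) ih
  have hx : ∑ i, x i • e i = x := by
    ext j
    simp [Finset.sum_apply, e, Pi.single_apply]
  rw [← hx]
  exact hsum _

/-- the subadditive function -/
lemma upper (i0 : Fin d) (lam ε : ℝ) (hε : 0 < ε) (hc : chio d φ lam ≠ ⊤)
    (hg : ∀ i : Fin d, ∃ mu, lam < mu ∧ ∃ k : ℕ, 1 ≤ k ∧ ex ε k ≤ bb φ mu i k) :
    ∃ C, ∀ x : Pt d, -Real.log (HEf φ lam x).toReal ≤ ε * l1 x + C := by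
  set c := (chio d φ lam).toReal with hcdef
  have hGp : ∀ x : Pt d, Go φ lam x ≠ 0 := Go_pos h0 h1 hR i0 lam hc
  have hGt : ∀ x : Pt d, Go φ lam x ≠ ⊤ := fun x => ne_top_of_le_ne_top hc (Go_le_chio φ lam x)
  have hG : ∀ x : Pt d, 0 < (Go φ lam x).toReal := fun x => ENNReal.toReal_pos (hGp x) (hGt x)
  have hc0 : 0 < c := ENNReal.toReal_pos
    (fun h => hGp 0 (le_zero_iff.1 (h ▸ Go_le_chio φ lam 0))) hc
  have key : ∃ C, ∀ x : Pt d, 2 * Real.log c - Real.log (Go φ lam x).toReal ≤ ε * l1 x + C := by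
    apply F_bound _ _ _ ε hε
    · intro i
      obtain ⟨mu, hmu, k, hk, hb⟩ := hg i
      refine ⟨k, hk, ?_⟩
      set T := ∑' y : Pt d, ENNReal.ofReal (Real.exp (-((mu - lam) * l1 y))) with hT
      have hTt : T ≠ ⊤ := tsum_l1 _ (by linarith)
      refine ⟨2 * Real.log c + 2 * Real.log T.toReal + 2 * Real.log c, fun n => ?_⟩
      have h2 := bb_sq_le h0 hR lam (mu - lam) (by linarith) i (n * k)
      rw [add_sub_cancel, ← hT] at h2
      have h3 : (ex ε k ^ n) ^ 2 ≤ bb φ mu i (n * k) ^ 2 := by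
        gcongr
        calc _ ≤ bb φ mu i k ^ n := by gcongr
          _ ≤ _ := bb_pow_le h0 mu i k n
      have h4 := h3.trans h2
      have h5 := ENNReal.toReal_mono (by
        refine ENNReal.mul_ne_top (ENNReal.pow_ne_top hTt)
          (ENNReal.mul_ne_top (hGt _) (ENNReal.mul_ne_top hc hc))) h4
      simp only [ENNReal.toReal_mul, ENNReal.toReal_pow] at h5
      have h6 : (ex ε k).toReal = Real.exp (-(ε * k)) :=
        ENNReal.toReal_ofReal (Real.exp_nonneg _)
      rw [h6, ← hcdef] at h5
      have hT0 : T.toReal ≠ 0 := by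
        intro h
        rw [h] at h5
        have : 0 < (Real.exp (-(ε * k)) ^ n) ^ 2 := by positivity
        linarith
      have h7 := Real.log_le_log (by positivity) h5
      have hGG := (hG ((2 * (n * k)) • e i)).ne'
      rw [Real.log_mul (by positivity) (by positivity), Real.log_mul hGG (by positivity),
        Real.log_mul hc0.ne' hc0.ne', Real.log_pow, Real.log_pow, Real.log_pow,
        Real.log_exp] at h7
      push_cast at h7
      linarith
    · intro x y
      have h := ENNReal.toReal_mono (ENNReal.mul_ne_top (hGt _) (ENNReal.mul_ne_top hc hc))
        (Go_mul_le h0 hR lam x y)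
      simp only [ENNReal.toReal_mul] at h
      rw [← hcdef] at h
      have h7 := Real.log_le_log (mul_pos (hG x) (hG y)) h
      rw [Real.log_mul (hG x).ne' (hG y).ne', Real.log_mul (hG _).ne' (by positivity),
        Real.log_mul hc0.ne' hc0.ne'] at h7
      linarith
    · intro x
      have := Go_sym φ lam ng (fun x => by simp [ng_apply]) (fun s hs => isStep_neg hs) x
      rw [ng_apply] at this
      have h7 := Real.log_le_log (hG x) (ENNReal.toReal_mono (hGt _) this)
      linarith
  obtain ⟨C, hC⟩ := key
  set a := ((expNegE (φ 1))⁻¹).toReal with ha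
  have hat : (expNegE (φ 1))⁻¹ ≠ ⊤ := ENNReal.inv_ne_top.2 (expNegE_pos h1)
  refine ⟨C - 2 * Real.log c + Real.log a + Real.log c, fun x => ?_⟩
  have hHt : HEf φ lam x ≠ ⊤ := ne_top_of_le_ne_top hc (HEf_le_chio h0 hR lam x)
  have h := ENNReal.toReal_mono (ENNReal.mul_ne_top (ENNReal.mul_ne_top hHt hat) hc)
    (Go_le_H h0 hR lam h1 x)
  simp only [ENNReal.toReal_mul] at h
  rw [← hcdef, ← ha] at h
  have hp := (hG x).trans_le h
  have hH0 : (HEf φ lam x).toReal ≠ 0 := by rintro h; rw [h] at hp; simp at hp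
  have ha0 : a ≠ 0 := by rintro h; rw [h] at hp; simp at hp
  have h7 := Real.log_le_log (hG x) h
  rw [Real.log_mul (mul_ne_zero hH0 ha0) hc0.ne', Real.log_mul hH0 ha0] at h7
  have := hC x
  linarith

omit h1 in
lemma lower (lam : ℝ) (hc : chio d φ lam ≠ ⊤) :
    ∃ C, ∀ x : Pt d, C ≤ -Real.log (HEf φ lam x).toReal := by
  refine ⟨-|Real.log (chio d φ lam).toReal|, fun x => ?_⟩
  have h := ENNReal.toReal_mono hc (HEf_le_chio h0 hR lam x)
  rcases (ENNReal.toReal_nonneg (a := HEf φ lam x)).eq_or_lt with h' | h'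
  · rw [← h']; simp
  · have := Real.log_le_log h' h
    have := le_abs_self (Real.log (chio d φ lam).toReal)
    linarith
end fin

lemma l1_flr (M : ℝ) (hM : 0 ≤ M) (x : Fin d → ℝ) : l1 (flr M x) ≤ M * ∑ i, |x i| + d := by
  unfold l1 flr
  have : ∀ i ∈ (Finset.univ : Finset (Fin d)), |((⌊M * x i⌋ : ℤ) : ℝ)| ≤ M * |x i| + 1 := by
    intro i _
    have h1 := Int.floor_le (M * x i)
    have h2 := Int.lt_floor_add_one (M * x i)
    have h3 : |M * x i| = M * |x i| := by rw [abs_mul, abs_of_nonneg hM]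
    rw [← h3, abs_le]
    have := neg_abs_le (M * x i)
    have := le_abs_self (M * x i)
    constructor <;> linarith
  refine (Finset.sum_le_sum this).trans ?_
  rw [Finset.sum_add_distrib, ← Finset.mul_sum]
  simp

theorem main (i0 : Fin d) (φ : ℕ → ℝ≥0∞)
    (hN0 : φ 0 = 0) (hNmono : Monotone φ)
    (hR : ∀ l m : ℕ, φ l + φ m ≤ φ (l + m))
    (lam0 : ℝ)
    (hlam0 : Filter.Tendsto (fun n : ℕ => Real.log (ZE d φ n).toReal / n) Filter.atTop
      (nhds lam0))
    (ξ : ℝ → (Fin d → ℝ) → ℝ)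
    (hξ : ∀ lam : ℝ, lam0 < lam → ∀ x : Fin d → ℝ,
      Filter.Tendsto (fun M : ℝ => -Real.log (HEf φ lam (flr M x)).toReal / M)
        Filter.atTop (nhds (ξ lam x))) (x : Fin d → ℝ) :
      Filter.Tendsto (fun lam : ℝ => ξ lam x) (nhdsWithin lam0 (Set.Ioi lam0)) (nhds 0) := by
  by_cases h1 : φ 1 = ⊤
  · refine tendsto_const_nhds.congr' ?_
    filter_upwards [self_mem_nhdsWithin] with lam hlam
    have h := hξ lam hlam x
    simp only [HEf_eq_zero hNmono h1] at h
    simp only [ENNReal.toReal_zero, Real.log_zero, neg_zero, zero_div] at h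
    exact tendsto_nhds_unique tendsto_const_nhds h
  have hcc : ∀ lam, lam0 < lam → chio d φ lam ≠ ⊤ := by
    intro lam hlam
    refine ne_top_of_le_ne_top ?_ (chio_le φ lam)
    refine ENNReal.add_ne_top.2 ⟨ENNReal.one_ne_top, ?_⟩
    exact ENNReal.mul_ne_top (chi_ne_top hN0 h1 i0 lam0 hlam0 lam hlam)
      (ENNReal.mul_ne_top (kap_ne_top d) (ex_ne_top _ _))
  have hdiv : ∀ C : ℝ, Tendsto (fun M : ℝ => C / M) atTop (𝓝 0) := fun C =>
    tendsto_const_nhds.div_atTop tendsto_id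
  have hlow : ∀ lam, lam0 < lam → 0 ≤ ξ lam x := by
    intro lam hlam
    obtain ⟨C, hC⟩ := lower (d := d) hN0 hR lam (hcc lam hlam)
    refine le_of_tendsto_of_tendsto (hdiv C) (hξ lam hlam x) ?_
    filter_upwards [eventually_gt_atTop 0] with M hM
    exact div_le_div_of_nonneg_right (hC _) hM.le
  set S := ∑ i, |x i| with hS
  have hS0 : 0 ≤ S := Finset.sum_nonneg fun _ _ => abs_nonneg _
  have hup : ∀ ε : ℝ, 0 < ε → ∀ᶠ lam in 𝓝[>] lam0, ξ lam x ≤ ε * S := by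
    intro ε hε
    have hg : ∀ᶠ lam in 𝓝[>] lam0, ∀ i : Fin d,
        ∃ mu, lam < mu ∧ ∃ k : ℕ, 1 ≤ k ∧ ex ε k ≤ bb φ mu i k := by
      rw [eventually_all]
      intro i
      obtain ⟨mu, hmu, hk⟩ := exists_good hN0 h1 hR i lam0 hlam0 ε hε
      filter_upwards [Ioo_mem_nhdsGT hmu] with lam hlam
      exact ⟨mu, hlam.2, hk⟩
    filter_upwards [hg, self_mem_nhdsWithin] with lam hlam hl
    obtain ⟨C, hC⟩ := upper hN0 h1 hR i0 lam ε hε (hcc lam hl) hlam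
    have ht : Tendsto (fun M : ℝ => ε * S + (ε * d + C) / M) atTop (𝓝 (ε * S + 0)) :=
      tendsto_const_nhds.add (hdiv _)
    rw [add_zero] at ht
    refine le_of_tendsto_of_tendsto (hξ lam hl x) ht ?_
    filter_upwards [eventually_gt_atTop 0] with M hM
    rw [div_le_iff₀ hM, add_mul, div_mul_cancel₀ _ hM.ne']
    have h2 := mul_le_mul_of_nonneg_left (l1_flr M hM.le x) hε.le
    have h3 := hC (flr M x)
    rw [← hS] at h2
    linarith
  rw [tendsto_order]
  constructor
  · intro a ha
    filter_upwards [self_mem_nhdsWithin] with lam hl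
    exact ha.trans_le (hlow lam hl)
  · intro a ha
    filter_upwards [hup (a / (S + 1)) (by positivity)] with lam hl
    refine hl.trans_lt ?_
    rw [div_mul_eq_mul_div, div_lt_iff₀ (by positivity)]
    nlinarith

end SIRW

open SIRW

/-- repulsive case: the limiting Lyapunov exponent vanishes at `λ₀`:
`ξ_{λ₀}(x) = lim_{λ↓λ₀} ξ_λ(x) = 0` for every `x ∈ ℝ^d`. -/
theorem stmt9 (d : ℕ) (hd : 1 ≤ d) (φ : ℕ → ℝ≥0∞)
    (hN0 : φ 0 = 0) (hNmono : Monotone φ)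
    (hR : ∀ l m : ℕ, φ l + φ m ≤ φ (l + m))
    (lam0 : ℝ)
    (hlam0 : Filter.Tendsto (fun n : ℕ => Real.log (ZE d φ n).toReal / n) Filter.atTop
      (nhds lam0))
    (ξ : ℝ → (Fin d → ℝ) → ℝ)
    (hξ : ∀ lam : ℝ, lam0 < lam → ∀ x : Fin d → ℝ,
      Filter.Tendsto (fun M : ℝ => -Real.log (HEf φ lam (flr M x)).toReal / M)
        Filter.atTop (nhds (ξ lam x))) :
    ∀ x : Fin d → ℝ,
      Filter.Tendsto (fun lam : ℝ => ξ lam x) (nhdsWithin lam0 (Set.Ioi lam0)) (nhds 0) := by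
  intro x
  exact SIRW.main ⟨0, hd⟩ φ hN0 hNmono hR lam0 hlam0 ξ hξ x
end
end
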